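/- Assume the standing assumptions in dimension n = 3, with u_k → u in L¹(Ω) where u takes only the values ±1 on Ω \ spt(μ) and is locally constant there. Let Ω′ be an open set compactly contained in Ω \ spt(μ). If α({x}) = 0 for every x ∈ closure(Ω′) (i.e. α has no atoms in closure(Ω′)), then u_k → u uniformly on Ω′, i.e. sup_{x ∈ Ω′} |u_k(x) − u(x)| → 0 as k → ∞. -/

import Mathlib

open MeasureTheory Filter Metric Set

noncomputable section

abbrev E (n : ℕ) : Type := EuclideanSpace ℝ (Fin n)

def W (t : ℝ) : ℝ := (t ^ 2 - 1) ^ 2 / 4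

def W' (t : ℝ) : ℝ := t ^ 3 - t

def c0 : ℝ := 2 * Real.sqrt 2 / 3

def lap {n : ℕ} (u : E n → ℝ) (x : E n) : ℝ :=
  ∑ i, (fderiv ℝ (fderiv ℝ u) x) (EuclideanSpace.single i 1) (EuclideanSpace.single i 1)

def areaDensity {n : ℕ} (ev : ℝ) (u : E n → ℝ) (x : E n) : ℝ :=
  ev / 2 * ‖fderiv ℝ u x‖ ^ 2 + (1 / ev) * W (u x)

def willDensity {n : ℕ} (ev : ℝ) (u : E n → ℝ) (x : E n) : ℝ :=
  (ev * lap u x - (1 / ev) * W' (u x)) ^ 2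

def Se {n : ℕ} (ev : ℝ) (Ω : Set (E n)) (u : E n → ℝ) : ℝ :=
  (1 / c0) * ∫ x in Ω, areaDensity ev u x

def We {n : ℕ} (ev : ℝ) (Ω : Set (E n)) (u : E n → ℝ) : ℝ :=
  (1 / (c0 * ev)) * ∫ x in Ω, willDensity ev u x

def mue {n : ℕ} (ev : ℝ) (Ω : Set (E n)) (u : E n → ℝ) (U : Set (E n)) : ℝ :=
  (1 / c0) * ∫ x in U ∩ Ω, areaDensity ev u x

def ale {n : ℕ} (ev : ℝ) (Ω : Set (E n)) (u : E n → ℝ) (U : Set (E n)) : ℝ :=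
  (1 / (c0 * ev)) * ∫ x in U ∩ Ω, willDensity ev u x

def xiPlus {n : ℕ} (ev : ℝ) (Ω : Set (E n)) (u : E n → ℝ) (U : Set (E n)) : ℝ :=
  ∫ x in U ∩ Ω, max (ev / 2 * ‖fderiv ℝ u x‖ ^ 2 - (1 / ev) * W (u x)) 0

def sptM {n : ℕ} (μ : Measure (E n)) : Set (E n) :=
  {x | ∀ r > 0, 0 < μ (ball x r)}

def weakConvA {n : ℕ} (Ω : Set (E n)) (ε : ℕ → ℝ) (u : ℕ → E n → ℝ)
    (μ : Measure (E n)) : Prop :=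
  ∀ φ : BoundedContinuousFunction (E n) ℝ,
    Tendsto (fun k => (1 / c0) * ∫ x in Ω, φ x * areaDensity (ε k) (u k) x) atTop
      (nhds (∫ x, φ x ∂μ))

def weakConvW {n : ℕ} (Ω : Set (E n)) (ε : ℕ → ℝ) (u : ℕ → E n → ℝ)
    (α : Measure (E n)) : Prop :=
  ∀ φ : BoundedContinuousFunction (E n) ℝ,
    Tendsto (fun k => (1 / (c0 * ε k)) * ∫ x in Ω, φ x * willDensity (ε k) (u k) x) atTop
      (nhds (∫ x, φ x ∂α))

/-- The `i`-th standard basis vector of `ℝ³`. -/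
def ee (i : Fin 3) : E 3 := EuclideanSpace.single i 1

/-- The `i`-th partial derivative. -/
def pd (i : Fin 3) (w : E 3 → ℝ) (x : E 3) : ℝ := fderiv ℝ w x (ee i)

lemma pd_add {i : Fin 3} {f g : E 3 → ℝ} {x : E 3} (hf : DifferentiableAt ℝ f x)
    (hg : DifferentiableAt ℝ g x) : pd i (fun y => f y + g y) x = pd i f x + pd i g x := by
  simp [pd, fderiv_fun_add hf hg]

lemma pd_sub {i : Fin 3} {f g : E 3 → ℝ} {x : E 3} (hf : DifferentiableAt ℝ f x)
    (hg : DifferentiableAt ℝ g x) : pd i (fun y => f y - g y) x = pd i f x - pd i g x := by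
  simp [pd, fderiv_fun_sub hf hg]

lemma pd_neg {i : Fin 3} {f : E 3 → ℝ} {x : E 3} :
    pd i (fun y => - f y) x = - pd i f x := by
  simp [pd, fderiv_fun_neg]

lemma pd_mul {i : Fin 3} {f g : E 3 → ℝ} {x : E 3} (hf : DifferentiableAt ℝ f x)
    (hg : DifferentiableAt ℝ g x) :
    pd i (fun y => f y * g y) x = pd i f x * g x + f x * pd i g x := by
  simp [pd, fderiv_fun_mul hf hg]; ring

lemma pd_const {i : Fin 3} {c : ℝ} {x : E 3} : pd i (fun _ => c) x = 0 := by
  simp [pd]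

lemma pd_const_mul {i : Fin 3} {c : ℝ} {f : E 3 → ℝ} {x : E 3} (hf : DifferentiableAt ℝ f x) :
    pd i (fun y => c * f y) x = c * pd i f x := by
  rw [pd_mul (by fun_prop) hf, pd_const]; ring

lemma pd_coord {i j : Fin 3} {x : E 3} : pd i (fun y : E 3 => y j) x = if i = j then 1 else 0 := by
  have h : HasFDerivAt (fun y : E 3 => y j) (EuclideanSpace.proj j : E 3 →L[ℝ] ℝ) x :=
    (EuclideanSpace.proj j : E 3 →L[ℝ] ℝ).hasFDerivAt
  rw [pd, h.fderiv]
  simp [ee, eq_comm]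

lemma pd_comp {i : Fin 3} {g : ℝ → ℝ} {g' : ℝ} {f : E 3 → ℝ} {x : E 3}
    (hg : HasDerivAt g g' (f x)) (hf : DifferentiableAt ℝ f x) :
    pd i (fun y => g (f y)) x = g' * pd i f x := by
  have h := hg.comp_hasFDerivAt x hf.hasFDerivAt
  have h2 : HasFDerivAt (fun y => g (f y)) (g' • fderiv ℝ f x) x := h
  simp [pd, h2.fderiv]

lemma pd_sq {i : Fin 3} {f : E 3 → ℝ} {x : E 3} (hf : DifferentiableAt ℝ f x) :
    pd i (fun y => f y ^ 2) x = 2 * f x * pd i f x := by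
  rw [pd_comp (g := fun t => t ^ 2) (g' := 2 * f x) (by simpa using hasDerivAt_pow 2 (f x)) hf]

lemma ContDiff.pd {n : ℕ} {w : E 3 → ℝ} (i : Fin 3) (hw : ContDiff ℝ (n + 1) w) :
    ContDiff ℝ n (pd i w) := by
  have h : ContDiff ℝ n (fderiv ℝ w) := hw.fderiv_right (m := n) (le_refl _)
  exact h.clm_apply contDiff_const

lemma ContDiff.pd_one {w : E 3 → ℝ} (i : Fin 3) (hw : ContDiff ℝ 1 w) : Continuous (_root_.pd i w) :=
  (ContDiff.pd (n := 0) i (by simpa using hw)).continuous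

lemma ContDiff.pd_two {w : E 3 → ℝ} (i : Fin 3) (hw : ContDiff ℝ 2 w) :
    ContDiff ℝ 1 (_root_.pd i w) := by
  have := ContDiff.pd (n := 1) i (w := w) (by simpa [one_add_one_eq_two] using hw)
  simpa using this

lemma ContDiff.pd_three {w : E 3 → ℝ} (i : Fin 3) (hw : ContDiff ℝ 3 w) :
    ContDiff ℝ 2 (_root_.pd i w) :=
  ContDiff.pd (n := 2) i (w := w) (by
    convert hw using 1
    exact_mod_cast (rfl : (2 + 1 : ℕ) = 3))

lemma HasCompactSupport.pd {w : E 3 → ℝ} (i : Fin 3) (hw : HasCompactSupport w) :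
    HasCompactSupport (_root_.pd i w) := hw.fderiv_apply ℝ (ee i)

lemma pd_comm {w : E 3 → ℝ} (hw : ContDiff ℝ 2 w) (i j : Fin 3) (x : E 3) :
    pd i (pd j w) x = pd j (pd i w) x := by
  have hd : DifferentiableAt ℝ (fderiv ℝ w) x :=
    ((hw.fderiv_right (m := 1) (by norm_num)).differentiable (by norm_num)) x
  have key : ∀ a b : Fin 3, pd a (pd b w) x = fderiv ℝ (fderiv ℝ w) x (ee a) (ee b) := by
    intro a b
    have : pd b w = fun y => (fderiv ℝ w y) (ee b) := rfl
    rw [this, pd, fderiv_clm_apply hd (by fun_prop)]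
    simp
  rw [key, key]
  exact (hw.contDiffAt.isSymmSndFDerivAt (by simp)).eq _ _

lemma lap_eq {w : E 3 → ℝ} (hw : ContDiff ℝ 2 w) (x : E 3) :
    lap w x = ∑ i, pd i (pd i w) x := by
  have hd : DifferentiableAt ℝ (fderiv ℝ w) x :=
    ((hw.fderiv_right (m := 1) (by norm_num)).differentiable (by norm_num)) x
  unfold lap
  refine Finset.sum_congr rfl fun i _ => ?_
  have : pd i w = fun y => (fderiv ℝ w y) (ee i) := rfl
  rw [this, pd, fderiv_clm_apply hd (by fun_prop)]
  simp [ee]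

lemma continuous_lap {w : E 3 → ℝ} (hw : ContDiff ℝ 2 w) : Continuous (lap w) := by
  have : lap w = fun x => ∑ i, pd i (pd i w) x := funext (lap_eq hw)
  rw [this]
  exact continuous_finsetSum _ fun i _ => (hw.pd_two i).pd_one i

lemma contDiff_lap {w : E 3 → ℝ} (hw : ContDiff ℝ 3 w) : ContDiff ℝ 1 (lap w) := by
  have : lap w = fun x => ∑ i, pd i (pd i w) x :=
    funext (lap_eq (hw.of_le (by norm_num)))
  rw [this]
  exact ContDiff.sum fun i _ => (hw.pd_three i).pd_two i

/-- The squared norm of the gradient. -/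
def gsq (w : E 3 → ℝ) (x : E 3) : ℝ := ∑ i, pd i w x ^ 2

lemma gsq_nonneg (w : E 3 → ℝ) (x : E 3) : 0 ≤ gsq w x :=
  Finset.sum_nonneg fun _ _ => sq_nonneg _

lemma gsq_eq (w : E 3 → ℝ) (x : E 3) : gsq w x = ‖fderiv ℝ w x‖ ^ 2 := by
  set L := fderiv ℝ w x with hL
  set g := (InnerProductSpace.toDual ℝ (E 3)).symm L with hg
  have h1 : ‖L‖ = ‖g‖ := by rw [hg]; simp
  rw [h1, EuclideanSpace.norm_sq_eq, gsq]
  refine Finset.sum_congr rfl fun i _ => ?_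
  have : pd i w x = g i := by
    have h2 : L (ee i) = inner ℝ g (ee i) := by rw [hg]; simp
    rw [pd, ← hL, h2, ee, real_inner_comm, EuclideanSpace.inner_single_left]; simp
  rw [this]; simp

lemma continuous_gsq {w : E 3 → ℝ} (hw : ContDiff ℝ 1 w) : Continuous (gsq w) :=
  continuous_finsetSum _ fun i _ => (hw.pd_one i).pow 2

lemma integral_pd_eq_zero {i : Fin 3} {f : E 3 → ℝ} (hf : ContDiff ℝ 1 f)
    (hc : HasCompactSupport f) : ∫ x, pd i f x = 0 := by
  have h := integral_mul_fderiv_eq_neg_fderiv_mul_of_integrable (μ := (volume : Measure (E 3)))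
    (f := fun _ => (1 : ℝ)) (g := f) (v := ee i) (by simp)
    (by
      simp only [one_mul]
      exact (hf.pd_one i).integrable_of_hasCompactSupport (hc.pd i))
    (by
      simp only [one_mul]
      exact hf.continuous.integrable_of_hasCompactSupport hc)
    (fun _ _ => by fun_prop) (fun x _ => hf.differentiable (by norm_num) x)
  simpa [pd] using h

lemma norm_sq_eq_three (x : E 3) : ‖x‖ ^ 2 = x 0 ^ 2 + x 1 ^ 2 + x 2 ^ 2 := by
  rw [EuclideanSpace.norm_sq_eq, Fin.sum_univ_three]; simp

lemma abs_coord_le (x : E 3) (i : Fin 3) : |x i| ≤ ‖x‖ := by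
  simpa using PiLp.norm_apply_le x i

/-- Necessary second order condition at a local maximum on the line. -/
lemma deriv_deriv_nonpos_of_isLocalMax {g : ℝ → ℝ} {t : ℝ} (h : IsLocalMax g t)
    (hc : ContinuousAt g t) : deriv (deriv g) t ≤ 0 := by
  by_contra hpos
  push Not at hpos
  have hmin := isLocalMin_of_deriv_deriv_pos hpos h.deriv_eq_zero hc
  have heq : g =ᶠ[nhds t] fun _ => g t := by
    filter_upwards [h, hmin] with s h1 h2 using le_antisymm h1 h2
  have : deriv (deriv g) t = 0 := by
    rw [heq.deriv.deriv_eq]; simp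
  linarith

lemma pd_eq_zero_of_isLocalMax {g : E 3 → ℝ} {x : E 3} (h : IsLocalMax g x) (i : Fin 3) :
    pd i g x = 0 := by
  simp [pd, h.fderiv_eq_zero]

lemma pd_pd_nonpos_of_isLocalMax {g : E 3 → ℝ} (hg : ContDiff ℝ 2 g) {x : E 3}
    (h : IsLocalMax g x) (i : Fin 3) : pd i (pd i g) x ≤ 0 := by
  have hline : ∀ t : ℝ, HasDerivAt (fun t : ℝ => x + t • ee i) (ee i) t := by
    intro t
    simpa using ((hasDerivAt_id t).smul_const (ee i)).const_add x
  have hd : ∀ (q : E 3 → ℝ), Differentiable ℝ q → ∀ t,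
      HasDerivAt (fun t : ℝ => q (x + t • ee i)) (pd i q (x + t • ee i)) t := by
    intro q hq t
    exact (hq _).hasFDerivAt.comp_hasDerivAt t (hline t)
  have h1 : deriv (fun t : ℝ => g (x + t • ee i)) = fun t => pd i g (x + t • ee i) :=
    funext fun t => (hd g (hg.differentiable (by norm_num)) t).deriv
  have h2 : deriv (fun t : ℝ => pd i g (x + t • ee i)) 0 = pd i (pd i g) x := by
    have := (hd (pd i g) ((hg.pd_two i).differentiable (by norm_num)) 0).deriv
    simpa using this
  rw [← h2, ← h1]
  apply deriv_deriv_nonpos_of_isLocalMax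
  · have hcont : ContinuousAt (fun t : ℝ => x + t • ee i) 0 := (hline 0).continuousAt
    have : Tendsto (fun t : ℝ => x + t • ee i) (nhds 0) (nhds x) := by
      simpa [ContinuousAt] using hcont
    have h3 : ∀ᶠ y in nhds x, g y ≤ g x := h
    have := this.eventually h3
    simpa [IsLocalMax, IsMaxFilter] using this
  · exact (hd g (hg.differentiable (by norm_num)) 0).continuousAt

lemma lap_nonpos_of_isLocalMax {g : E 3 → ℝ} (hg : ContDiff ℝ 2 g) {x : E 3}
    (h : IsLocalMax g x) : lap g x ≤ 0 := by
  rw [lap_eq hg]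
  exact Finset.sum_nonpos fun i _ => pd_pd_nonpos_of_isLocalMax hg h i

/-- A continuous function on a closed ball that is smaller on the sphere than at the centre has
an interior local maximum. -/
lemma exists_isLocalMax_of_sphere {g : E 3 → ℝ} (hg : Continuous g) {x₀ : E 3} {L : ℝ}
    (hL : 0 < L) (hs : ∀ x, dist x x₀ = L → g x < g x₀) :
    ∃ x ∈ ball x₀ L, IsLocalMax g x ∧ g x₀ ≤ g x := by
  obtain ⟨x, hx, hmax⟩ := (isCompact_closedBall x₀ L).exists_isMaxOn
    ⟨x₀, mem_closedBall_self hL.le⟩ hg.continuousOn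
  have hx0 : g x₀ ≤ g x := hmax (mem_closedBall_self hL.le)
  have hxb : x ∈ ball x₀ L := by
    rcases (mem_closedBall.1 hx).lt_or_eq with h | h
    · exact h
    · exact absurd (hs x h) (not_lt.2 hx0)
  refine ⟨x, hxb, ?_, hx0⟩
  exact (hmax.on_subset ball_subset_closedBall).isLocalMax (isOpen_ball.mem_nhds hxb)

lemma dist_sq_eq (x x₀ : E 3) :
    dist x x₀ ^ 2 = (x 0 - x₀ 0) ^ 2 + (x 1 - x₀ 1) ^ 2 + (x 2 - x₀ 2) ^ 2 := by
  rw [dist_eq_norm, norm_sq_eq_three]; simp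

lemma contDiff_coord {n : WithTop ℕ∞} (i : Fin 3) : ContDiff ℝ n (fun x : E 3 => x i) :=
  (EuclideanSpace.proj i : E 3 →L[ℝ] ℝ).contDiff

/-- Interior maximum of a function penalised by a paraboloid. -/
lemma exists_penalised_max {g : E 3 → ℝ} (hg : ContDiff ℝ 2 g) {x₀ : E 3} {L A : ℝ}
    (hL : 0 < L) (hA : 0 ≤ A) (hs : ∀ x, dist x x₀ = L → g x < g x₀ + A) :
    ∃ x ∈ ball x₀ L, g x₀ ≤ g x ∧ (∀ i, pd i g x = 2 * A / L ^ 2 * (x i - x₀ i)) ∧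
      lap g x ≤ 6 * A / L ^ 2 := by
  set c := A / L ^ 2 with hc
  have hc0 : 0 ≤ c := by positivity
  set P : E 3 → ℝ := fun x => c * ((x 0 - x₀ 0) ^ 2 + (x 1 - x₀ 1) ^ 2 + (x 2 - x₀ 2) ^ 2) with hP
  have hPd : ∀ x, P x = c * dist x x₀ ^ 2 := fun x => by rw [dist_sq_eq]
  have hcd : ∀ j, ContDiff ℝ 2 (fun x : E 3 => (x j - x₀ j)) := fun j =>
    (contDiff_coord j).sub contDiff_const
  have hPc : ContDiff ℝ 2 P := by
    have := ((((hcd 0).pow 2).add ((hcd 1).pow 2)).add ((hcd 2).pow 2)).const_smul c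
    simpa [hP] using this
  have hd1 : ∀ j x, DifferentiableAt ℝ (fun x : E 3 => (x j - x₀ j)) x := fun j x =>
    (hcd j).differentiable (by norm_num) x
  have hpc : ∀ i j x, pd i (fun x : E 3 => x j - x₀ j) x = if i = j then 1 else 0 := by
    intro i j x
    rw [pd_sub ((contDiff_coord (n := 1) j).differentiable (by norm_num) x) (by fun_prop),
      pd_const, pd_coord]; simp
  have hpP : ∀ i, pd i P = fun x => 2 * c * (x i - x₀ i) := by
    intro i
    funext x
    have hd2 : ∀ j, DifferentiableAt ℝ (fun x : E 3 => (x j - x₀ j) ^ 2) x := fun j => (hd1 j x).pow 2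
    rw [hP, pd_const_mul (((hd2 0).fun_add (hd2 1)).fun_add (hd2 2)), pd_add ((hd2 0).fun_add (hd2 1)) (hd2 2),
      pd_add (hd2 0) (hd2 1), pd_sq (hd1 0 x), pd_sq (hd1 1 x), pd_sq (hd1 2 x)]
    simp only [hpc]
    fin_cases i <;> simp <;> ring
  have hlP : ∀ x, lap P x = 6 * c := by
    intro x
    rw [lap_eq hPc]
    have : ∀ i, pd i (pd i P) x = 2 * c := by
      intro i
      rw [hpP i, pd_const_mul (hd1 i x), hpc]; simp
    simp [this]; ring
  have hGc : ContDiff ℝ 2 (fun x => g x - P x) := hg.sub hPc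
  obtain ⟨x, hxb, hmax, hle⟩ := exists_isLocalMax_of_sphere (g := fun x => g x - P x)
    hGc.continuous hL (fun x hx => by
      have := hs x hx
      simp only [hPd, hx, dist_self]
      have h2 : c * L ^ 2 = A := by rw [hc]; field_simp
      rw [h2]; simp; linarith)
  have hgd : ∀ y, DifferentiableAt ℝ g y := hg.differentiable (by norm_num)
  have hPdiff : ∀ y, DifferentiableAt ℝ P y := hPc.differentiable (by norm_num)
  refine ⟨x, hxb, ?_, ?_, ?_⟩
  · have h1 : P x₀ = 0 := by simp [hPd]
    have h2 : 0 ≤ P x := by rw [hPd]; positivity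
    simp only [h1] at hle
    linarith
  · intro i
    have h1 := pd_eq_zero_of_isLocalMax hmax i
    rw [pd_sub (hgd x) (hPdiff x), hpP] at h1
    rw [hc] at h1
    linear_combination h1
  · have h1 := lap_nonpos_of_isLocalMax hGc hmax
    have h2 : lap (fun x => g x - P x) x = lap g x - lap P x := by
      rw [lap_eq hGc, lap_eq hg, lap_eq hPc, ← Finset.sum_sub_distrib]
      refine Finset.sum_congr rfl fun i _ => ?_
      have : pd i (fun x => g x - P x) = fun x => pd i g x - pd i P x :=
        funext fun y => pd_sub (hgd y) (hPdiff y)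
      rw [this, pd_sub ((hg.pd_two i).differentiable (by norm_num) x)
        ((hPc.pd_two i).differentiable (by norm_num) x)]
    rw [h2, hlP, hc] at h1
    linear_combination h1

/-- The product of Lebesgue measure on `(0, 1]` and on the unit ball. -/
def nu : Measure (ℝ × E 3) :=
  (volume.restrict (Ioc (0 : ℝ) 1)).prod (volume.restrict (ball (0 : E 3) 1))

instance : IsFiniteMeasure (volume.restrict (ball (0 : E 3) 1)) :=
  ⟨by rw [Measure.restrict_apply_univ]; exact measure_ball_lt_top⟩

lemma Continuous.integrableOn_ball {g : E 3 → ℝ} (hg : Continuous g) (c : E 3) (r : ℝ) :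
    IntegrableOn g (ball c r) :=
  (hg.continuousOn.integrableOn_compact (isCompact_closedBall c r)).mono_set ball_subset_closedBall

lemma isFiniteMeasure_restrict_ball (c : E 3) (r : ℝ) :
    IsFiniteMeasure ((volume : Measure (E 3)).restrict (ball c r)) :=
  ⟨by rw [Measure.restrict_apply_univ]; exact measure_ball_lt_top⟩

lemma exists_norm_le {F : Type} [NormedAddCommGroup F] {ψ : E 3 → F} (hψ : Continuous ψ)
    (hc : HasCompactSupport ψ) : ∃ C, 0 ≤ C ∧ ∀ x, ‖ψ x‖ ≤ C := by
  obtain ⟨C, hC⟩ := hψ.bounded_above_of_compact_support hc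
  exact ⟨C, (norm_nonneg _).trans (hC 0), hC⟩

instance : IsFiniteMeasure nu := by unfold nu; infer_instance

lemma ae_nu : ∀ᵐ z ∂nu, z.1 ∈ Ioc (0 : ℝ) 1 ∧ z.2 ∈ ball (0 : E 3) 1 := by
  have h : nu = (volume.prod volume).restrict (Ioc (0 : ℝ) 1 ×ˢ ball (0 : E 3) 1) := by
    rw [nu, Measure.prod_restrict]
  rw [h]
  filter_upwards [ae_restrict_mem (measurableSet_Ioc.prod measurableSet_ball)] with z hz using hz

/-- Weighted averages of translates, indexed by `(0, 1] × B₁`. -/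
def Op {F : Type} [NormedAddCommGroup F] [NormedSpace ℝ F] (a : ℝ × E 3 → ℝ)
    (p : ℝ × E 3 → E 3) (ψ : E 3 → F) (x : E 3) : F :=
  ∫ z, a z • ψ (x + p z) ∂nu

/-- Admissible weights and shifts for `Op`. -/
structure Adm (a : ℝ × E 3 → ℝ) (p : ℝ × E 3 → E 3) (A : ℝ) : Prop where
  ca : Continuous a
  cp : Continuous p
  nonneg : 0 ≤ A
  bound : ∀ s ∈ Ioc (0 : ℝ) 1, ∀ y ∈ ball (0 : E 3) 1, |a (s, y)| ≤ A
  shift : ∀ s ∈ Ioc (0 : ℝ) 1, ∀ y ∈ ball (0 : E 3) 1, ‖p (s, y)‖ < 1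

lemma Adm.ae {a p A} (h : Adm a p A) : ∀ᵐ z ∂nu, |a z| ≤ A ∧ ‖p z‖ < 1 := by
  filter_upwards [ae_nu] with z hz
  exact ⟨h.bound z.1 hz.1 z.2 hz.2, h.shift z.1 hz.1 z.2 hz.2⟩

section
variable {F : Type} [NormedAddCommGroup F] [NormedSpace ℝ F] {a : ℝ × E 3 → ℝ}
  {p : ℝ × E 3 → E 3} {A : ℝ} {ψ : E 3 → F}

lemma Adm.aesm (h : Adm a p A) (hψ : Continuous ψ) (x : E 3) :
    AEStronglyMeasurable (fun z => a z • ψ (x + p z)) nu := by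
  have : Continuous (fun z => a z • ψ (x + p z)) :=
    h.ca.smul (hψ.comp (continuous_const.add h.cp))
  exact this.aestronglyMeasurable

lemma Adm.integrable (h : Adm a p A) (hψ : Continuous ψ) (hc : HasCompactSupport ψ) (x : E 3) :
    Integrable (fun z => a z • ψ (x + p z)) nu := by
  obtain ⟨C, hC0, hC⟩ := exists_norm_le hψ hc
  refine Integrable.of_bound (h.aesm hψ x) (A * C) ?_
  filter_upwards [h.ae] with z hz
  rw [norm_smul, Real.norm_eq_abs]
  exact mul_le_mul hz.1 (hC _) (norm_nonneg _) h.nonneg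

lemma Adm.continuous_Op (h : Adm a p A) (hψ : Continuous ψ) (hc : HasCompactSupport ψ) :
    Continuous (Op a p ψ) := by
  obtain ⟨C, hC0, hC⟩ := exists_norm_le hψ hc
  refine continuous_of_dominated (bound := fun _ => A * C) (fun x => h.aesm hψ x) ?_
    (integrable_const _) ?_
  · intro x
    filter_upwards [h.ae] with z hz
    rw [norm_smul, Real.norm_eq_abs]
    exact mul_le_mul hz.1 (hC _) (norm_nonneg _) h.nonneg
  · refine Eventually.of_forall fun z => ?_
    exact continuous_const.smul (hψ.comp (continuous_id.add continuous_const))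

lemma Adm.hasFDerivAt_Op (h : Adm a p A) (hψ : ContDiff ℝ 1 ψ) (hc : HasCompactSupport ψ)
    (x : E 3) : HasFDerivAt (Op a p ψ) (Op a p (fderiv ℝ ψ) x) x := by
  have hcf := hψ.continuous_fderiv (by norm_num)
  obtain ⟨C, hC0, hC⟩ := exists_norm_le hcf (hc.fderiv ℝ)
  refine hasFDerivAt_integral_of_dominated_of_fderiv_le (s := univ) (bound := fun _ => A * C)
    (F' := fun x z => a z • fderiv ℝ ψ (x + p z)) univ_mem ?_ (h.integrable hψ.continuous hc x)
    (h.aesm hcf x) ?_ (integrable_const _) ?_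
  · exact Eventually.of_forall fun y => h.aesm hψ.continuous y
  · filter_upwards [h.ae] with z hz y _
    rw [norm_smul, Real.norm_eq_abs]
    exact mul_le_mul hz.1 (hC _) (norm_nonneg _) h.nonneg
  · refine Eventually.of_forall fun z y _ => ?_
    have h1 : HasFDerivAt ψ (fderiv ℝ ψ (y + p z)) (y + p z) :=
      (hψ.differentiable (by norm_num) _).hasFDerivAt
    have h2 : HasFDerivAt (fun y : E 3 => y + p z) (ContinuousLinearMap.id ℝ (E 3)) y :=
      (hasFDerivAt_id y).add_const _
    have h3 := (h1.comp y h2).fun_const_smul (a z)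
    simpa using h3

end

lemma Adm.contDiff_Op {a p A} (h : Adm a p A) (n : ℕ) :
    ∀ {F : Type} [NormedAddCommGroup F] [NormedSpace ℝ F] {ψ : E 3 → F}, ContDiff ℝ n ψ →
      HasCompactSupport ψ → ContDiff ℝ n (Op a p ψ) := by
  induction n with
  | zero =>
    intro F _ _ ψ hψ hc
    exact contDiff_zero.2 (h.continuous_Op hψ.continuous hc)
  | succ n ih =>
    intro F _ _ ψ hψ hc
    have h1 : ContDiff ℝ 1 ψ := hψ.of_le (by exact_mod_cast Nat.le_add_left 1 n)
    have hfd : fderiv ℝ (Op a p ψ) = Op a p (fderiv ℝ ψ) :=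
      funext fun x => (h.hasFDerivAt_Op h1 hc x).fderiv
    have hcast : ((n + 1 : ℕ) : WithTop ℕ∞) = n + 1 := by push_cast; rfl
    rw [hcast, contDiff_succ_iff_fderiv]
    refine ⟨fun x => (h.hasFDerivAt_Op h1 hc x).differentiableAt, by simp, ?_⟩
    rw [hfd]
    exact ih (hψ.fderiv_right (m := n) (by rw [hcast])) (hc.fderiv ℝ)

lemma Adm.pd_Op {a p A} (h : Adm a p A) {ψ : E 3 → ℝ} (hψ : ContDiff ℝ 1 ψ)
    (hc : HasCompactSupport ψ) (i : Fin 3) (x : E 3) :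
    pd i (Op a p ψ) x = Op a p (pd i ψ) x := by
  rw [pd, (h.hasFDerivAt_Op hψ hc x).fderiv, Op, ContinuousLinearMap.integral_apply
    (h.integrable (hψ.continuous_fderiv (by norm_num)) (hc.fderiv ℝ) x)]
  rfl

lemma Adm.lap_Op {a p A} (h : Adm a p A) {ψ : E 3 → ℝ} (hψ : ContDiff ℝ 2 ψ)
    (hc : HasCompactSupport ψ) (x : E 3) : lap (Op a p ψ) x = Op a p (lap ψ) x := by
  have hO : ContDiff ℝ 2 (Op a p ψ) := h.contDiff_Op 2 (by exact_mod_cast hψ) hc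
  have h1 : ContDiff ℝ 1 ψ := hψ.of_le (by norm_num)
  rw [lap_eq hO]
  have h2 : ∀ i, pd i (Op a p ψ) = Op a p (pd i ψ) := fun i => funext (h.pd_Op h1 hc i)
  have h3 : lap ψ = fun x => ∑ i, pd i (pd i ψ) x := funext (lap_eq hψ)
  simp only [h2, h3]
  have h4 : ∀ i, pd i (Op a p (pd i ψ)) x = Op a p (pd i (pd i ψ)) x := fun i =>
    h.pd_Op (hψ.pd_two i) (hc.pd i) i x
  simp only [h4, Op, smul_eq_mul, Finset.mul_sum]
  rw [integral_finsetSum]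
  intro i _
  exact h.integrable ((hψ.pd_two i).pd_one i) ((hc.pd i).pd i) x

lemma Adm.hasCompactSupport_Op {a p A} (h : Adm a p A) {ψ : E 3 → ℝ}
    (hc : HasCompactSupport ψ) : HasCompactSupport (Op a p ψ) := by
  obtain ⟨r, hr⟩ := hc.isCompact.isBounded.subset_closedBall 0
  refine HasCompactSupport.intro (isCompact_closedBall (0 : E 3) (r + 1)) fun x hx => ?_
  rw [Op]
  refine integral_eq_zero_of_ae ?_
  filter_upwards [h.ae] with z hz
  have : ψ (x + p z) = 0 := by
    refine image_eq_zero_of_notMem_tsupport fun hmem => hx ?_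
    have h1 := hr hmem
    rw [mem_closedBall_zero_iff] at h1 ⊢
    calc ‖x‖ = ‖(x + p z) - p z‖ := by simp
      _ ≤ ‖x + p z‖ + ‖p z‖ := norm_sub_le _ _
      _ ≤ r + 1 := by linarith [hz.2]
  simp [this]

lemma Adm.Op_sub {a p A} (h : Adm a p A) {φ ψ : E 3 → ℝ} (hφ : Continuous φ)
    (hcφ : HasCompactSupport φ) (hψ : Continuous ψ) (hcψ : HasCompactSupport ψ) (x : E 3) :
    Op a p (fun y => φ y - ψ y) x = Op a p φ x - Op a p ψ x := by
  simp only [Op, smul_sub]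
  exact integral_sub (h.integrable hφ hcφ x) (h.integrable hψ hcψ x)

lemma Adm.abs_Op_le {a p A} (h : Adm a p A) {ψ : E 3 → ℝ} {x : E 3} {C : ℝ}
    (hC : ∀ y ∈ ball x 1, |ψ y| ≤ C) : |Op a p ψ x| ≤ A * C * nu.real univ := by
  rw [Op, ← Real.norm_eq_abs]
  refine norm_integral_le_of_norm_le_const ?_
  filter_upwards [h.ae] with z hz
  rw [norm_smul, Real.norm_eq_abs]
  refine mul_le_mul hz.1 (hC _ ?_) (norm_nonneg _) h.nonneg
  simpa [mem_ball, dist_eq_norm] using hz.2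

/-- Cauchy-Schwarz inequality for integrals of real functions. -/
lemma sq_integral_mul_le {Z : Type*} [MeasurableSpace Z] {ν : Measure Z} {f g : Z → ℝ}
    (hf : Integrable (fun z => f z ^ 2) ν) (hg : Integrable (fun z => g z ^ 2) ν)
    (hfg : Integrable (fun z => f z * g z) ν) :
    (∫ z, f z * g z ∂ν) ^ 2 ≤ (∫ z, f z ^ 2 ∂ν) * ∫ z, g z ^ 2 ∂ν := by
  have key : ∀ t : ℝ, 0 ≤ (∫ z, g z ^ 2 ∂ν) * (t * t) + (-2 * ∫ z, f z * g z ∂ν) * t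
      + ∫ z, f z ^ 2 ∂ν := by
    intro t
    have h1 : 0 ≤ ∫ z, (f z - t * g z) ^ 2 ∂ν := integral_nonneg fun z => sq_nonneg _
    have h2 : (fun z => (f z - t * g z) ^ 2)
        = fun z => (f z ^ 2 + (-2 * t) * (f z * g z)) + (t * t) * g z ^ 2 := by
      funext z; ring
    have h3 : Integrable (fun z => f z ^ 2 + (-2 * t) * (f z * g z)) ν :=
      hf.add (hfg.const_mul _)
    rw [h2, integral_add h3 (hg.const_mul _), integral_add hf (hfg.const_mul _), integral_const_mul, integral_const_mul] at h1
    linarith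
  have := discrim_le_zero key
  rw [discrim] at this
  nlinarith

lemma sq_integral_le {Z : Type*} [MeasurableSpace Z] {ν : Measure Z} [IsFiniteMeasure ν]
    {g : Z → ℝ} (hg : Integrable (fun z => g z ^ 2) ν) (hg1 : Integrable g ν) :
    (∫ z, g z ∂ν) ^ 2 ≤ ν.real univ * ∫ z, g z ^ 2 ∂ν := by
  have := sq_integral_mul_le (f := fun _ => (1 : ℝ)) (g := g) (ν := ν) (by simp) hg (by simpa)
  simpa using this

/-- Tonelli for averages of translates. -/
lemma setIntegral_translates_le {Z : Type*} [MeasurableSpace Z] {ν : Measure Z}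
    [IsFiniteMeasure ν] {p : Z → E 3} (hp : Measurable p) {d : ℝ}
    (hd : ∀ᵐ z ∂ν, ‖p z‖ ≤ d) {g : E 3 → ℝ} (hg : Continuous g) (hg0 : ∀ x, 0 ≤ g x)
    (hc : HasCompactSupport g) (c : E 3) (r : ℝ) :
    ∫ x in ball c r, (∫ z, g (x + p z) ∂ν) ≤ ν.real univ * ∫ x in ball c (r + d), g x := by
  obtain ⟨C, hC0, hC⟩ := exists_norm_le hg hc
  have := isFiniteMeasure_restrict_ball c r
  have hgi := hg.integrable_of_hasCompactSupport hc (μ := volume)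
  rw [integral_integral_swap]
  · calc ∫ z, (∫ x in ball c r, g (x + p z)) ∂ν
        ≤ ∫ z, (∫ x in ball c (r + d), g x) ∂ν := by
          refine integral_mono_of_nonneg (Eventually.of_forall fun z => integral_nonneg fun x => hg0 _)
            (integrable_const _) ?_
          filter_upwards [hd] with z hz
          have h1 : ∫ x in ball c r, g (x + p z) = ∫ x in ball (c + p z) r, g x := by
            have hmp := (measurePreserving_add_right (volume : Measure (E 3)) (p z))
            have := hmp.setIntegral_preimage_emb
              (MeasurableEquiv.addRight (p z)).measurableEmbedding g (ball (c + p z) r)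
            rw [← this]
            congr 2
            ext x
            simp [mem_ball, dist_eq_norm]
          rw [h1]
          refine setIntegral_mono_set hgi.integrableOn (Eventually.of_forall fun x => hg0 x) ?_
          refine (ball_subset_ball' ?_).eventuallyLE
          simpa [dist_eq_norm] using hz
      _ = ν.real univ * ∫ x in ball c (r + d), g x := by simp
  · refine Integrable.of_bound ?_ C (Eventually.of_forall fun q => hC _)
    have : Measurable (fun q : E 3 × Z => g (q.1 + p q.2)) :=
      hg.measurable.comp (measurable_fst.add (hp.comp measurable_snd))
    exact this.aestronglyMeasurable

lemma Adm.integral_sq_Op_le {a p A} (h : Adm a p A) {ψ : E 3 → ℝ} (hψ : Continuous ψ)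
    (hc : HasCompactSupport ψ) (c : E 3) (r : ℝ) :
    ∫ x in ball c r, Op a p ψ x ^ 2 ≤
      (A * nu.real univ) ^ 2 * ∫ x in ball c (r + 1), ψ x ^ 2 := by
  obtain ⟨C, hC0, hC⟩ := exists_norm_le hψ hc
  have hcsq : HasCompactSupport (fun x => ψ x ^ 2) := hc.comp_left (g := fun t => t ^ 2) (by simp)
  have hint : ∀ x, Integrable (fun z => ψ (x + p z) ^ 2) nu := by
    intro x
    refine Integrable.of_bound (C := C ^ 2) ?_ (Eventually.of_forall fun z => ?_)
    · exact ((hψ.comp (continuous_const.add h.cp)).pow 2).aestronglyMeasurable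
    · rw [norm_pow]; exact pow_le_pow_left₀ (norm_nonneg _) (hC _) 2
  have hpt : ∀ x, Op a p ψ x ^ 2 ≤ (nu.real univ * A ^ 2) * ∫ z, ψ (x + p z) ^ 2 ∂nu := by
    intro x
    have h1 : Integrable (fun z => (a z • ψ (x + p z)) ^ 2) nu := by
      refine Integrable.of_bound ((h.aesm hψ x).pow 2) ((A * C) ^ 2) ?_
      filter_upwards [h.ae] with z hz
      rw [norm_pow, norm_smul, Real.norm_eq_abs]
      exact pow_le_pow_left₀ (by positivity)
        (mul_le_mul hz.1 (hC _) (norm_nonneg _) h.nonneg) 2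
    refine (sq_integral_le h1 (h.integrable hψ hc x)).trans ?_
    rw [mul_assoc]
    refine mul_le_mul_of_nonneg_left ?_ measureReal_nonneg
    rw [← integral_const_mul]
    refine integral_mono_ae h1 ((hint x).const_mul _) ?_
    filter_upwards [h.ae] with z hz
    simp only [smul_eq_mul, mul_pow]
    refine mul_le_mul_of_nonneg_right ?_ (sq_nonneg _)
    rw [← sq_abs]
    exact pow_le_pow_left₀ (abs_nonneg _) hz.1 2
  have hcontI : Continuous (fun x => ∫ z, ψ (x + p z) ^ 2 ∂nu) := by
    refine continuous_of_dominated (bound := fun _ => C ^ 2) (fun x => (hint x).aestronglyMeasurable)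
      (fun x => Eventually.of_forall fun z => ?_) (integrable_const _) (Eventually.of_forall fun z => ?_)
    · rw [norm_pow]; exact pow_le_pow_left₀ (norm_nonneg _) (hC _) 2
    · exact (hψ.comp (continuous_id.add continuous_const)).pow 2
  calc ∫ x in ball c r, Op a p ψ x ^ 2
      ≤ ∫ x in ball c r, (nu.real univ * A ^ 2) * ∫ z, ψ (x + p z) ^ 2 ∂nu := by
        exact setIntegral_mono (((h.continuous_Op hψ hc).pow 2).integrableOn_ball c r)
          ((continuous_const.mul hcontI).integrableOn_ball c r) hpt
    _ = (nu.real univ * A ^ 2) * ∫ x in ball c r, ∫ z, ψ (x + p z) ^ 2 ∂nu := by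
        rw [integral_const_mul]
    _ ≤ (nu.real univ * A ^ 2) * (nu.real univ * ∫ x in ball c (r + 1), ψ x ^ 2) := by
        refine mul_le_mul_of_nonneg_left ?_ (mul_nonneg measureReal_nonneg (sq_nonneg _))
        exact setIntegral_translates_le h.cp.measurable (d := 1)
          (by filter_upwards [h.ae] with z hz using hz.2.le) (hψ.pow 2) (fun x => sq_nonneg _) hcsq c r
    _ = _ := by ring

/-- The truncated paraboloid `max (1 - |y|²) 0`. -/
def mm (y : E 3) : ℝ := max (1 - ‖y‖ ^ 2) 0

lemma continuous_mm : Continuous mm := by unfold mm; fun_prop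

lemma mm_nonneg (y : E 3) : 0 ≤ mm y := le_max_right _ _

lemma mm_le_one (y : E 3) : mm y ≤ 1 := max_le (by nlinarith [sq_nonneg ‖y‖]) zero_le_one

lemma mm_eq_zero {y : E 3} (hy : y ∉ ball (0 : E 3) 1) : mm y = 0 := by
  have : 1 ≤ ‖y‖ := by simpa using hy
  exact max_eq_right (by nlinarith)

lemma hasCompactSupport_mm : HasCompactSupport mm :=
  HasCompactSupport.intro (isCompact_closedBall (0 : E 3) 1) fun _ hx =>
    mm_eq_zero fun h => hx (ball_subset_closedBall h)

lemma hasDerivAt_max_pow (n : ℕ) (t : ℝ) :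
    HasDerivAt (fun t : ℝ => max t 0 ^ (n + 2)) ((n + 2 : ℝ) * max t 0 ^ (n + 1)) t := by
  rcases lt_trichotomy t 0 with h | h | h
  · have h1 : (fun t : ℝ => max t 0 ^ (n + 2)) =ᶠ[nhds t] fun _ => 0 := by
      filter_upwards [eventually_lt_nhds h] with s hs
      rw [max_eq_right hs.le]; simp
    rw [max_eq_right h.le]
    simpa using (hasDerivAt_const t (0 : ℝ)).congr_of_eventuallyEq h1
  · subst h
    simp only [max_self, ne_eq, Nat.add_eq_zero_iff, one_ne_zero, and_false, not_false_eq_true,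
      zero_pow, mul_zero]
    rw [hasDerivAt_iff_isLittleO]
    simp only [sub_zero, max_self, smul_zero, ne_eq, Nat.add_eq_zero_iff, OfNat.ofNat_ne_zero,
      and_false, not_false_eq_true, zero_pow]
    have h1 : (fun s : ℝ => max s 0 ^ (n + 2)) =O[nhds 0] fun s => s ^ (n + 2) := by
      refine Asymptotics.IsBigO.of_bound 1 (Eventually.of_forall fun s => ?_)
      rw [norm_pow, norm_pow, one_mul]
      refine pow_le_pow_left₀ (norm_nonneg _) ?_ _
      rw [Real.norm_eq_abs, Real.norm_eq_abs, abs_of_nonneg (le_max_right _ _)]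
      exact max_le (le_abs_self _) (abs_nonneg _)
    refine h1.trans_isLittleO ?_
    simpa using Asymptotics.isLittleO_pow_pow (𝕜 := ℝ) (m := 1) (n := n + 2) (by omega)
  · have h1 : (fun t : ℝ => max t 0 ^ (n + 2)) =ᶠ[nhds t] fun t => t ^ (n + 2) := by
      filter_upwards [eventually_gt_nhds h] with s hs
      rw [max_eq_left hs.le]
    rw [max_eq_left h.le]
    have := (hasDerivAt_pow (n + 2) t).congr_of_eventuallyEq h1
    simpa using this

lemma contDiff_max_pow (n : ℕ) : ContDiff ℝ 1 (fun t : ℝ => max t 0 ^ (n + 2)) := by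
  rw [contDiff_one_iff_deriv]
  refine ⟨fun t => (hasDerivAt_max_pow n t).differentiableAt, ?_⟩
  have : deriv (fun t : ℝ => max t 0 ^ (n + 2)) = fun t => (n + 2 : ℝ) * max t 0 ^ (n + 1) :=
    funext fun t => (hasDerivAt_max_pow n t).deriv
  rw [this]
  fun_prop

lemma contDiff_mm_pow (n : ℕ) : ContDiff ℝ 1 (fun y => mm y ^ (n + 2)) :=
  (contDiff_max_pow n).comp (contDiff_const.sub (contDiff_norm_sq ℝ))

lemma pd_norm_sq (i : Fin 3) (y : E 3) : pd i (fun y : E 3 => ‖y‖ ^ 2) y = 2 * y i := by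
  have h : ∀ y : E 3, ‖y‖ ^ 2 = y 0 ^ 2 + y 1 ^ 2 + y 2 ^ 2 := norm_sq_eq_three
  have hd : ∀ j, DifferentiableAt ℝ (fun y : E 3 => y j) y := fun j => by fun_prop
  simp only [h]
  rw [pd_add (by fun_prop) (by fun_prop), pd_add (by fun_prop) (by fun_prop), pd_sq (hd 0),
    pd_sq (hd 1), pd_sq (hd 2), pd_coord, pd_coord, pd_coord]
  fin_cases i <;> simp

lemma pd_mm_pow (n : ℕ) (i : Fin 3) (y : E 3) :
    pd i (fun y => mm y ^ (n + 2)) y = -(2 * (n + 2)) * mm y ^ (n + 1) * y i := by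
  have hd : DifferentiableAt ℝ (fun y : E 3 => ‖y‖ ^ 2) y :=
    (contDiff_norm_sq ℝ (n := 1)).differentiable (by norm_num) y
  have h := pd_comp (i := i) (x := y) (f := fun y : E 3 => 1 - ‖y‖ ^ 2)
    (hasDerivAt_max_pow n (1 - ‖y‖ ^ 2)) ((differentiableAt_const _).sub hd)
  have h2 : pd i (fun y : E 3 => 1 - ‖y‖ ^ 2) y = - (2 * y i) := by
    rw [pd_sub (differentiableAt_const _) hd, pd_const, pd_norm_sq]; ring
  rw [h2] at h
  exact h.trans (by unfold mm; ring)

lemma integral_mm_sq_pos : 0 < ∫ y, mm y ^ 2 := by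
  have hc : HasCompactSupport fun y => mm y ^ 2 :=
    hasCompactSupport_mm.comp_left (g := fun t => t ^ 2) (by simp)
  refine (continuous_mm.pow 2).integral_pos_of_hasCompactSupport_nonneg_nonzero hc
    (fun y => sq_nonneg _) (x := 0) (by simp [mm])

/-- Normalising constant of the kernels. -/
def cK : ℝ := 1 / (6 * ∫ y, mm y ^ 2)

lemma cK_pos : 0 < cK := by
  have := integral_mm_sq_pos
  unfold cK; positivity

/-- The averaging kernel. -/
def rho (y : E 3) : ℝ := 6 * cK * mm y ^ 2

/-- The potential of the averaging kernel. -/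
def kf (y : E 3) : ℝ := cK * mm y ^ 3

lemma continuous_rho : Continuous rho := continuous_const.mul (continuous_mm.pow 2)
lemma continuous_kf : Continuous kf := continuous_const.mul (continuous_mm.pow 3)

lemma contDiff_rho : ContDiff ℝ 1 rho := contDiff_const.mul (contDiff_mm_pow 0)
lemma contDiff_kf : ContDiff ℝ 1 kf := contDiff_const.mul (contDiff_mm_pow 1)

lemma rho_eq_zero {y : E 3} (hy : y ∉ ball (0 : E 3) 1) : rho y = 0 := by
  simp [rho, mm_eq_zero hy]
lemma kf_eq_zero {y : E 3} (hy : y ∉ ball (0 : E 3) 1) : kf y = 0 := by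
  simp [kf, mm_eq_zero hy]

lemma hasCompactSupport_of_ball {k : E 3 → ℝ} (h : ∀ y, y ∉ ball (0 : E 3) 1 → k y = 0) :
    HasCompactSupport k :=
  HasCompactSupport.intro (isCompact_closedBall (0 : E 3) 1) fun y hx =>
    h y fun h => hx (ball_subset_closedBall h)

lemma integral_rho : ∫ y, rho y = 1 := by
  have := integral_mm_sq_pos
  simp only [rho, cK]
  rw [integral_const_mul]
  field_simp

lemma pd_kf (i : Fin 3) (y : E 3) : pd i kf y = - (rho y * y i) := by
  have h := pd_const_mul (i := i) (x := y) (c := cK) ((contDiff_mm_pow 1).differentiable (by norm_num) y)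
  rw [pd_mm_pow] at h
  refine h.trans ?_
  unfold rho; push_cast; ring

lemma pd_rho (i : Fin 3) (y : E 3) : pd i rho y = - (24 * cK * mm y * y i) := by
  have h := pd_const_mul (i := i) (x := y) (c := 6 * cK)
    ((contDiff_mm_pow 0).differentiable (by norm_num) y)
  rw [pd_mm_pow] at h
  refine h.trans ?_
  push_cast; ring

lemma kernel_bounds (y : E 3) (hy : y ∈ ball (0 : E 3) 1) :
    |rho y| ≤ 24 * cK ∧ |kf y| ≤ 24 * cK ∧ (∀ i, |rho y * y i| ≤ 24 * cK) ∧
      ∀ i, |24 * cK * mm y * y i| ≤ 24 * cK := by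
  have hc := cK_pos
  have h0 := mm_nonneg y
  have h1 := mm_le_one y
  have h2 : mm y ^ 2 ≤ 1 := pow_le_one₀ h0 h1
  have h3 : mm y ^ 3 ≤ 1 := pow_le_one₀ h0 h1
  have hy1 : ∀ i, |y i| ≤ 1 := fun i => (abs_coord_le y i).trans (by simpa using (mem_ball_zero_iff.1 hy).le)
  have hr : |rho y| ≤ 24 * cK := by
    rw [rho, abs_of_nonneg (by positivity)]; nlinarith
  refine ⟨hr, ?_, fun i => ?_, fun i => ?_⟩
  · rw [kf, abs_of_nonneg (by positivity)]; nlinarith [pow_nonneg h0 3]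
  · rw [abs_mul]; nlinarith [hy1 i, abs_nonneg (y i), abs_nonneg (rho y)]
  · rw [abs_mul, abs_of_nonneg (by positivity)]
    have : mm y * |y i| ≤ 1 := by nlinarith [hy1 i, abs_nonneg (y i)]
    nlinarith

/-- Averaging operator at unit scale. -/
def RO (ψ : E 3 → ℝ) : E 3 → ℝ := Op (fun z => rho z.2) (fun z => z.2) ψ
/-- Truncated Newton potential. -/
def NO (ψ : E 3 → ℝ) : E 3 → ℝ := Op (fun z => z.1 * kf z.2) (fun z => z.1 • z.2) ψ
/-- Partial derivative of `RO`. -/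
def ROd (i : Fin 3) (ψ : E 3 → ℝ) : E 3 → ℝ :=
  Op (fun z => 24 * cK * mm z.2 * z.2 i) (fun z => z.2) ψ
/-- Partial derivative of `NO`. -/
def NOd (i : Fin 3) (ψ : E 3 → ℝ) : E 3 → ℝ := Op (fun z => rho z.2 * z.2 i) (fun z => z.1 • z.2) ψ

lemma shift_aux {s : ℝ} (hs : s ∈ Ioc (0 : ℝ) 1) {y : E 3} (hy : y ∈ ball (0 : E 3) 1) :
    ‖s • y‖ < 1 := by
  rw [norm_smul, Real.norm_eq_abs, abs_of_pos hs.1]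
  have := mem_ball_zero_iff.1 hy
  nlinarith [hs.1, hs.2, norm_nonneg y]

lemma adm_RO : Adm (fun z => rho z.2) (fun z => z.2) (24 * cK) where
  ca := continuous_rho.comp continuous_snd
  cp := continuous_snd
  nonneg := by have := cK_pos; positivity
  bound s hs y hy := (kernel_bounds y hy).1
  shift s hs y hy := by simpa using hy

lemma adm_NO : Adm (fun z => z.1 * kf z.2) (fun z => z.1 • z.2) (24 * cK) where
  ca := continuous_fst.mul (continuous_kf.comp continuous_snd)
  cp := continuous_fst.smul continuous_snd
  nonneg := by have := cK_pos; positivity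
  bound s hs y hy := by
    have := (kernel_bounds y hy).2.1
    simp only
    rw [abs_mul, abs_of_pos hs.1]
    nlinarith [hs.1, hs.2, abs_nonneg (kf y)]
  shift s hs y hy := shift_aux hs hy

lemma adm_ROd (i : Fin 3) : Adm (fun z => 24 * cK * mm z.2 * z.2 i) (fun z => z.2) (24 * cK) where
  ca := by have := continuous_mm; fun_prop
  cp := continuous_snd
  nonneg := by have := cK_pos; positivity
  bound s hs y hy := (kernel_bounds y hy).2.2.2 i
  shift s hs y hy := by simpa using hy

lemma adm_NOd (i : Fin 3) : Adm (fun z => rho z.2 * z.2 i) (fun z => z.1 • z.2) (24 * cK) where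
  ca := by have := continuous_rho; fun_prop
  cp := continuous_fst.smul continuous_snd
  nonneg := by have := cK_pos; positivity
  bound s hs y hy := (kernel_bounds y hy).2.2.1 i
  shift s hs y hy := shift_aux hs hy

/-- Fubini for `Op`. -/
lemma Adm.Op_eq {a p A} (h : Adm a p A) {ψ : E 3 → ℝ} (hψ : Continuous ψ)
    (hc : HasCompactSupport ψ) (ha : ∀ s, ∀ y, y ∉ ball (0 : E 3) 1 → a (s, y) = 0) (x : E 3) :
    Op a p ψ x = ∫ s in (0 : ℝ)..1, ∫ y, a (s, y) * ψ (x + p (s, y)) := by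
  rw [Op, nu, integral_prod _ (h.integrable hψ hc x), intervalIntegral.integral_of_le zero_le_one]
  refine integral_congr_ae (Eventually.of_forall fun s => ?_)
  simp only [smul_eq_mul]
  exact setIntegral_eq_integral_of_forall_compl_eq_zero fun y hy => by rw [ha s y hy, zero_mul]

lemma pd_affine (i : Fin 3) {ψ : E 3 → ℝ} (hψ : ContDiff ℝ 1 ψ) (x y : E 3) (s : ℝ) :
    pd i (fun y => ψ (x + s • y)) y = s * pd i ψ (x + s • y) := by
  have h1 : HasFDerivAt (fun y : E 3 => x + s • y) (s • ContinuousLinearMap.id ℝ (E 3)) y :=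
    ((hasFDerivAt_id y).const_smul s).const_add x
  have h2 := (hψ.differentiable (by norm_num) (x + s • y)).hasFDerivAt.comp y h1
  have h3 : HasFDerivAt (fun y => ψ (x + s • y)) _ y := h2
  rw [pd, h3.fderiv]
  simp [pd]

lemma integral_kernel_by_parts (i : Fin 3) {k ψ : E 3 → ℝ} (hk : ContDiff ℝ 1 k)
    (hkc : HasCompactSupport k) (hψ : ContDiff ℝ 1 ψ) (x : E 3) (s : ℝ) :
    ∫ y, k y * (s * pd i ψ (x + s • y)) = - ∫ y, pd i k y * ψ (x + s • y) := by
  have hψs : ContDiff ℝ 1 (fun y : E 3 => ψ (x + s • y)) := hψ.comp (by fun_prop)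
  have h0 := integral_pd_eq_zero (i := i) (hk.mul hψs) hkc.mul_right
  have h1 : ∀ y, pd i (fun y => k y * ψ (x + s • y)) y
      = pd i k y * ψ (x + s • y) + k y * (s * pd i ψ (x + s • y)) := fun y => by
    rw [pd_mul (hk.differentiable (by norm_num) y) (hψs.differentiable (by norm_num) y),
      pd_affine i hψ]
  have h2 : Integrable (fun y => pd i k y * ψ (x + s • y)) :=
    ((hk.pd_one i).mul hψs.continuous).integrable_of_hasCompactSupport (hkc.pd i).mul_right
  have h3 : Integrable (fun y => k y * (s * pd i ψ (x + s • y))) := by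
    have : Continuous fun y : E 3 => s * pd i ψ (x + s • y) :=
      continuous_const.mul ((hψ.pd_one i).comp (by fun_prop))
    exact (hk.continuous.mul this).integrable_of_hasCompactSupport hkc.mul_right
  have h4 : ∫ y, (pd i k y * ψ (x + s • y) + k y * (s * pd i ψ (x + s • y))) = 0 := by
    rw [← h0]; exact integral_congr_ae (Eventually.of_forall fun y => (h1 y).symm)
  rw [integral_add h2 h3] at h4
  linarith

lemma pd_RO (i : Fin 3) {ψ : E 3 → ℝ} (hψ : ContDiff ℝ 1 ψ) (hc : HasCompactSupport ψ) (x : E 3) :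
    pd i (RO ψ) x = ROd i ψ x := by
  rw [RO, adm_RO.pd_Op hψ hc, adm_RO.Op_eq (hψ.pd_one i) (hc.pd i) (fun s y hy => rho_eq_zero hy),
    ROd, (adm_ROd i).Op_eq hψ.continuous hc (fun s y hy => by simp [mm_eq_zero hy])]
  congr 1
  funext s
  have := integral_kernel_by_parts i contDiff_rho (hasCompactSupport_of_ball fun y => rho_eq_zero)
    hψ x 1
  simp only [one_smul, one_mul, pd_rho] at this
  rw [this, ← integral_neg]
  congr 1; funext y; ring

lemma pd_NO (i : Fin 3) {ψ : E 3 → ℝ} (hψ : ContDiff ℝ 1 ψ) (hc : HasCompactSupport ψ) (x : E 3) :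
    pd i (NO ψ) x = NOd i ψ x := by
  rw [NO, adm_NO.pd_Op hψ hc, adm_NO.Op_eq (hψ.pd_one i) (hc.pd i)
    (fun s y hy => by simp [kf_eq_zero hy]),
    NOd, (adm_NOd i).Op_eq hψ.continuous hc (fun s y hy => by simp [rho_eq_zero hy])]
  congr 1
  funext s
  have := integral_kernel_by_parts i contDiff_kf (hasCompactSupport_of_ball fun y => kf_eq_zero)
    hψ x s
  simp only [pd_kf] at this
  have h2 : ∀ y, s * kf y * pd i ψ (x + s • y) = kf y * (s * pd i ψ (x + s • y)) := fun y => by ring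
  simp only [h2]
  rw [this, ← integral_neg]
  congr 1; funext y; ring

lemma fderiv_eq_sum_pd (w : E 3 → ℝ) (x : E 3) :
    fderiv ℝ w x = ∑ i, pd i w x • (EuclideanSpace.proj i : E 3 →L[ℝ] ℝ) := by
  ext v
  have hv : v = ∑ i, v i • ee i := by
    ext j
    simp [ee, Finset.sum_apply, Pi.single_apply]
  conv_lhs => rw [hv]
  simp [pd, mul_comm]

lemma fderiv_apply_eq_sum (w : E 3 → ℝ) (x v : E 3) :
    fderiv ℝ w x v = ∑ i, pd i w x * v i := by
  rw [fderiv_eq_sum_pd]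
  simp

lemma contDiff_of_pd {n : ℕ} {w : E 3 → ℝ} (hw : Differentiable ℝ w)
    (h : ∀ i, ContDiff ℝ n (pd i w)) : ContDiff ℝ (n + 1) w := by
  rw [contDiff_succ_iff_fderiv]
  refine ⟨hw, by simp, ?_⟩
  rw [funext (fderiv_eq_sum_pd w)]
  exact ContDiff.sum fun i _ => (h i).smul contDiff_const

lemma contDiff_RO {ψ : E 3 → ℝ} (hψ : ContDiff ℝ 2 ψ) (hc : HasCompactSupport ψ) :
    ContDiff ℝ 3 (RO ψ) := by
  have h1 : ContDiff ℝ 1 ψ := hψ.of_le (by norm_num)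
  have := contDiff_of_pd (n := 2) (w := RO ψ) (fun x => (adm_RO.hasFDerivAt_Op h1 hc x).differentiableAt)
    fun i => by
      rw [funext (pd_RO i h1 hc)]
      exact (adm_ROd i).contDiff_Op 2 (by exact_mod_cast hψ) hc
  exact this.of_le (by norm_num)

lemma contDiff_NO {ψ : E 3 → ℝ} (hψ : ContDiff ℝ 2 ψ) (hc : HasCompactSupport ψ) :
    ContDiff ℝ 3 (NO ψ) := by
  have h1 : ContDiff ℝ 1 ψ := hψ.of_le (by norm_num)
  have := contDiff_of_pd (n := 2) (w := NO ψ) (fun x => (adm_NO.hasFDerivAt_Op h1 hc x).differentiableAt)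
    fun i => by
      rw [funext (pd_NO i h1 hc)]
      exact (adm_NOd i).contDiff_Op 2 (by exact_mod_cast hψ) hc
  exact this.of_le (by norm_num)

/-- Mean value formula: averaging minus identity is the potential of the Laplacian. -/
lemma RO_sub_self {ψ : E 3 → ℝ} (hψ : ContDiff ℝ 2 ψ) (hc : HasCompactSupport ψ) (x : E 3) :
    RO ψ x - ψ x = NO (lap ψ) x := by
  have h1 : ContDiff ℝ 1 ψ := hψ.of_le (by norm_num)
  have hlc : HasCompactSupport (lap ψ) := by
    rw [funext (lap_eq hψ)]
    have : ∀ i : Fin 3, HasCompactSupport (pd i (pd i ψ)) := fun i => (hc.pd i).pd i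
    simp only [Fin.sum_univ_three]
    exact ((this 0).add (this 1)).add (this 2)
  set M : ℝ → ℝ := fun s => ∫ y, rho y * ψ (x + s • y) with hM
  have hder : ∀ s, HasDerivAt M (∫ y, s * kf y * lap ψ (x + s • y)) s := by
    intro s
    obtain ⟨C, hC0, hC⟩ := exists_norm_le (h1.continuous_fderiv (by norm_num)) (hc.fderiv ℝ)
    have hrc : HasCompactSupport rho := hasCompactSupport_of_ball fun y => rho_eq_zero
    have hψs : ∀ s : ℝ, Continuous fun y : E 3 => ψ (x + s • y) := fun s =>
      hψ.continuous.comp (by fun_prop)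
    have hfs : Continuous fun y : E 3 => fderiv ℝ ψ (x + s • y) y :=
      ((h1.continuous_fderiv (by norm_num)).comp (by fun_prop)).clm_apply continuous_id
    have hD := hasDerivAt_integral_of_dominated_loc_of_deriv_le (μ := volume) (s := univ) (x₀ := s)
      (F := fun s y => rho y * ψ (x + s • y)) (F' := fun s y => rho y * fderiv ℝ ψ (x + s • y) y)
      (bound := fun y => |rho y| * C) univ_mem
      (Eventually.of_forall fun s => (continuous_rho.mul (hψs s)).aestronglyMeasurable)
      ((continuous_rho.mul (hψs s)).integrable_of_hasCompactSupport hrc.mul_right)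
      (continuous_rho.mul hfs).aestronglyMeasurable
      (Eventually.of_forall fun y t _ => by
        rw [norm_mul, Real.norm_eq_abs (rho y)]
        by_cases hy : y ∈ ball (0 : E 3) 1
        · refine mul_le_mul_of_nonneg_left ?_ (abs_nonneg _)
          refine (ContinuousLinearMap.le_opNorm _ _).trans ?_
          have := hC (x + t • y)
          have hy := mem_ball_zero_iff.1 hy
          nlinarith [norm_nonneg y, norm_nonneg (fderiv ℝ ψ (x + t • y))]
        · simp [rho_eq_zero hy])
      ((continuous_rho.abs.mul continuous_const).integrable_of_hasCompactSupport
        (hrc.abs.mul_right))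
      (Eventually.of_forall fun y t _ => by
        have h2 : HasDerivAt (fun t : ℝ => x + t • y) y t := by
          simpa using ((hasDerivAt_id t).smul_const y).const_add x
        have h3 := (h1.differentiable (by norm_num) (x + t • y)).hasFDerivAt.comp_hasDerivAt t h2
        exact h3.const_mul _)
    have heq : ∫ y, rho y * fderiv ℝ ψ (x + s • y) y = ∫ y, s * kf y * lap ψ (x + s • y) := by
      have hkc : HasCompactSupport kf := hasCompactSupport_of_ball fun y => kf_eq_zero
      have e1 : ∀ y, rho y * fderiv ℝ ψ (x + s • y) y
          = ∑ i, - (pd i kf y * pd i ψ (x + s • y)) := fun y => by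
        rw [fderiv_apply_eq_sum, Finset.mul_sum]
        simp only [pd_kf]
        exact Finset.sum_congr rfl fun i _ => by ring
      have e2 : ∀ y, s * kf y * lap ψ (x + s • y)
          = ∑ i, kf y * (s * pd i (pd i ψ) (x + s • y)) := fun y => by
        rw [lap_eq hψ, Finset.mul_sum]
        exact Finset.sum_congr rfl fun i _ => by ring
      simp only [e1, e2]
      rw [integral_finsetSum, integral_finsetSum]
      · refine Finset.sum_congr rfl fun i _ => ?_
        rw [integral_kernel_by_parts i contDiff_kf hkc (hψ.pd_two i), integral_neg]
      · intro i _
        exact (continuous_kf.mul (continuous_const.mul (((hψ.pd_two i).pd_one i).comp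
          (by fun_prop)))).integrable_of_hasCompactSupport hkc.mul_right
      · intro i _
        exact ((contDiff_kf.pd_one i).mul ((hψ.pd_two i).continuous.comp
          (by fun_prop))).neg.integrable_of_hasCompactSupport (hkc.pd i).mul_right.neg
    rw [← heq]
    exact hD.2
  have hN := adm_NO.Op_eq (continuous_lap hψ) hlc (fun s y hy => by simp [kf_eq_zero hy]) x
  have hR := adm_RO.Op_eq hψ.continuous hc (fun s y hy => rho_eq_zero hy) x
  have hcont : Continuous fun s : ℝ => ∫ y, s * kf y * lap ψ (x + s • y) := by
    obtain ⟨C, hC0, hC⟩ := exists_norm_le (continuous_lap hψ) hlc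
    have hkc : HasCompactSupport kf := hasCompactSupport_of_ball fun y => kf_eq_zero
    have : Continuous fun s : ℝ => ∫ y, kf y * lap ψ (x + s • y) := by
      refine continuous_of_dominated (bound := fun y => |kf y| * C) (fun s => ?_) (fun s =>
        Eventually.of_forall fun y => ?_) ((continuous_kf.abs.mul
          continuous_const).integrable_of_hasCompactSupport hkc.abs.mul_right)
          (Eventually.of_forall fun y => ?_)
      · exact (continuous_kf.mul ((continuous_lap hψ).comp (by fun_prop))).aestronglyMeasurable
      · rw [norm_mul]
        exact mul_le_mul_of_nonneg_left (hC _) (abs_nonneg _)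
      · exact continuous_const.mul ((continuous_lap hψ).comp (by fun_prop))
    simp only [mul_assoc, integral_const_mul]
    exact continuous_id.mul this
  have hftc := intervalIntegral.integral_eq_sub_of_hasDerivAt (a := 0) (b := 1)
    (fun s _ => hder s) (hcont.intervalIntegrable 0 1)
  rw [NO, hN, RO, hR]
  simp only
  rw [hftc]
  simp only [hM, one_smul, zero_smul, add_zero, integral_mul_const, integral_rho, one_mul,
    intervalIntegral.integral_const, sub_zero]

lemma setIntegral_ball_translate (g : E 3 → ℝ) (x c : E 3) (r : ℝ) :
    ∫ y in ball c r, g (x + y) = ∫ y in ball (x + c) r, g y := by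
  have hmp := (measurePreserving_add_left (volume : Measure (E 3)) x)
  have := hmp.setIntegral_preimage_emb
    (MeasurableEquiv.addLeft x).measurableEmbedding g (ball (x + c) r)
  rw [← this]
  congr 2
  ext y
  simp [mem_ball, dist_eq_norm]

lemma setIntegral_ball_scale (g : E 3 → ℝ) (x : E 3) {s : ℝ} (hs : 0 < s) (r : ℝ) :
    ∫ y in ball (0 : E 3) r, g (x + s • y) = (s ^ 3)⁻¹ * ∫ y in ball x (s * r), g y := by
  have h := Measure.setIntegral_comp_smul_of_pos (volume : Measure (E 3)) (fun y => g (x + y))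
    (ball (0 : E 3) r) hs
  rw [h, _root_.smul_ball hs.ne', setIntegral_ball_translate]
  simp [abs_of_pos hs]

lemma setIntegral_sq_mono {g : E 3 → ℝ} (hg : Continuous g) {x y : E 3} {r r' : ℝ}
    (h : ball x r ⊆ ball y r') : ∫ z in ball x r, g z ^ 2 ≤ ∫ z in ball y r', g z ^ 2 :=
  setIntegral_mono_set ((hg.pow 2).integrableOn_ball y r')
    (Eventually.of_forall fun z => sq_nonneg _) h.eventuallyLE

lemma sq_kernel_le {k ψ : E 3 → ℝ} (hk : Continuous k)
    (hk0 : ∀ y, y ∉ ball (0 : E 3) 1 → k y = 0) (hψ : Continuous ψ) (x : E 3) {s : ℝ}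
    (hs : s ∈ Ioc (0 : ℝ) 1) :
    (∫ y, k y * ψ (x + s • y)) ^ 2 ≤
      (∫ y in ball (0 : E 3) 1, k y ^ 2) * ((s ^ 3)⁻¹ * ∫ y in ball x 1, ψ y ^ 2) := by
  have hψs : Continuous fun y : E 3 => ψ (x + s • y) := hψ.comp (by fun_prop)
  rw [← setIntegral_eq_integral_of_forall_compl_eq_zero (s := ball (0 : E 3) 1)
    (fun y hy => by rw [hk0 y hy, zero_mul])]
  refine (sq_integral_mul_le ((hk.pow 2).integrableOn_ball 0 1) ((hψs.pow 2).integrableOn_ball 0 1)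
    ((hk.mul hψs).integrableOn_ball 0 1)).trans ?_
  refine mul_le_mul_of_nonneg_left ?_ (integral_nonneg fun y => sq_nonneg _)
  rw [setIntegral_ball_scale (fun y => ψ y ^ 2) x hs.1]
  have : 0 ≤ (s ^ 3)⁻¹ := by have := hs.1; positivity
  refine mul_le_mul_of_nonneg_left (setIntegral_sq_mono hψ (ball_subset_ball ?_)) this
  linarith [hs.2]

/-- Constant in the local `L² → L^∞` estimates. -/
def KK : ℝ := 4 * (∫ y in ball (0 : E 3) 1, kf y ^ 2) + ∫ y in ball (0 : E 3) 1, rho y ^ 2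

lemma integral_sq_nonneg (g : E 3 → ℝ) (s : Set (E 3)) : 0 ≤ ∫ y in s, g y ^ 2 :=
  integral_nonneg fun y => sq_nonneg _

lemma KK_nonneg : 0 ≤ KK := by
  have h1 := integral_sq_nonneg kf (ball 0 1)
  have h2 := integral_sq_nonneg rho (ball 0 1)
  unfold KK; linarith

lemma sq_RO_le {ψ : E 3 → ℝ} (hψ : Continuous ψ) (hc : HasCompactSupport ψ) (x : E 3) :
    RO ψ x ^ 2 ≤ KK * ∫ y in ball x 1, ψ y ^ 2 := by
  have h := sq_kernel_le continuous_rho (fun y => rho_eq_zero) hψ x (s := 1) (by simp)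
  rw [RO, adm_RO.Op_eq hψ hc (fun s y hy => rho_eq_zero hy) x]
  simp only [one_smul, one_pow, inv_one, one_mul] at h
  simp only [intervalIntegral.integral_const, sub_zero, one_smul]
  refine h.trans (mul_le_mul_of_nonneg_right ?_ (integral_sq_nonneg _ _))
  have h1 := integral_sq_nonneg kf (ball 0 1)
  unfold KK; linarith

lemma sq_NO_le {ψ : E 3 → ℝ} (hψ : Continuous ψ) (hc : HasCompactSupport ψ) (x : E 3) :
    NO ψ x ^ 2 ≤ KK * ∫ y in ball x 1, ψ y ^ 2 := by
  set F := ∫ y in ball x 1, ψ y ^ 2 with hF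
  have hF0 : 0 ≤ F := integral_sq_nonneg _ _
  set K := ∫ y in ball (0 : E 3) 1, kf y ^ 2 with hK
  have hK0 : 0 ≤ K := integral_sq_nonneg _ _
  have hb : ∀ s ∈ Ioc (0 : ℝ) 1, ‖∫ y, s * kf y * ψ (x + s • y)‖ ≤ √(K * F) * s ^ (-(1 / 2) : ℝ) := by
    intro s hs
    have h := sq_kernel_le continuous_kf (fun y => kf_eq_zero) hψ x hs
    rw [← hK, ← hF] at h
    have hs0 := hs.1
    simp only [mul_assoc, integral_const_mul]
    rw [Real.norm_eq_abs]
    refine abs_le_of_sq_le_sq ?_ (by positivity)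
    rw [mul_pow, mul_pow, Real.sq_sqrt (by positivity), ← Real.rpow_natCast (s ^ (-(1 / 2) : ℝ)) 2,
      ← Real.rpow_mul hs0.le]
    norm_num
    rw [Real.rpow_neg_one]
    calc s ^ 2 * (∫ y, kf y * ψ (x + s • y)) ^ 2 ≤ s ^ 2 * (K * ((s ^ 3)⁻¹ * F)) := by gcongr
      _ = K * F * s⁻¹ := by field_simp
  have hint : IntervalIntegrable (fun s : ℝ => √(K * F) * s ^ (-(1 / 2) : ℝ)) volume 0 1 :=
    (intervalIntegral.intervalIntegrable_rpow' (by norm_num)).const_mul _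
  have h1 : |NO ψ x| ≤ 2 * √(K * F) := by
    rw [NO, adm_NO.Op_eq hψ hc (fun s y hy => by simp [kf_eq_zero hy]) x]
    refine (intervalIntegral.norm_integral_le_of_norm_le zero_le_one
      (Eventually.of_forall hb) hint).trans ?_
    rw [intervalIntegral.integral_const_mul, integral_rpow (by norm_num)]
    norm_num
    linarith
  have h2 : NO ψ x ^ 2 ≤ (2 * √(K * F)) ^ 2 := sq_le_sq' (by linarith [neg_abs_le (NO ψ x)])
    ((le_abs_self _).trans h1)
  rw [mul_pow, Real.sq_sqrt (by positivity)] at h2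
  have h3 := integral_sq_nonneg rho (ball 0 1)
  unfold KK
  nlinarith

lemma lap_mul {f g : E 3 → ℝ} (hf : ContDiff ℝ 2 f) (hg : ContDiff ℝ 2 g) (x : E 3) :
    lap (fun y => f y * g y) x = lap f x * g x + 2 * (∑ i, pd i f x * pd i g x) + f x * lap g x := by
  rw [lap_eq (hf.mul hg), lap_eq hf, lap_eq hg]
  have hfd : ∀ y, DifferentiableAt ℝ f y := hf.differentiable (by norm_num)
  have hgd : ∀ y, DifferentiableAt ℝ g y := hg.differentiable (by norm_num)
  have h1 : ∀ i, pd i (fun y => f y * g y) = fun y => pd i f y * g y + f y * pd i g y := fun i =>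
    funext fun y => pd_mul (hfd y) (hgd y)
  have hf1 : ∀ i, DifferentiableAt ℝ (pd i f) x := fun i =>
    (hf.pd_two i).differentiable (by norm_num) x
  have hg1 : ∀ i, DifferentiableAt ℝ (pd i g) x := fun i =>
    (hg.pd_two i).differentiable (by norm_num) x
  have h2 : ∀ i, pd i (pd i (fun y => f y * g y)) x
      = pd i (pd i f) x * g x + 2 * (pd i f x * pd i g x) + f x * pd i (pd i g) x := fun i => by
    rw [h1, pd_add ((hf1 i).fun_mul (hgd x)) ((hfd x).fun_mul (hg1 i)), pd_mul (hf1 i) (hgd x),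
      pd_mul (hfd x) (hg1 i)]
    ring
  simp only [h2, Finset.sum_add_distrib, Finset.sum_mul, Finset.mul_sum]

/-- A Keller–Osserman bound. -/
lemma keller_osserman {g : E 3 → ℝ} (hg : ContDiff ℝ 2 g) (x₀ : E 3)
    (h : ∀ x ∈ ball x₀ 1, 11 ≤ g x → g x ^ 3 / 8 ≤ lap g x) : g x₀ ≤ 11 := by
  by_contra! hlt
  set ζ : E 3 → ℝ := fun x => 1 - ‖x - x₀‖ ^ 2 with hζ
  have hζc : ContDiff ℝ 2 ζ := by
    have : ContDiff ℝ 2 (fun x : E 3 => ‖x - x₀‖ ^ 2) :=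
      (contDiff_norm_sq ℝ).comp (contDiff_id.sub contDiff_const)
    exact contDiff_const.sub this
  have hdc : ∀ (j : Fin 3) x, DifferentiableAt ℝ (fun x : E 3 => x j - x₀ j) x := fun j x => by fun_prop
  have hpζ : ∀ i, pd i ζ = fun x => -2 * (x i - x₀ i) := by
    intro i
    funext x
    have hn : ∀ x : E 3, ‖x - x₀‖ ^ 2 = (x 0 - x₀ 0) ^ 2 + (x 1 - x₀ 1) ^ 2 + (x 2 - x₀ 2) ^ 2 :=
      fun x => by rw [norm_sq_eq_three]; simp
    have hpc : ∀ j : Fin 3, pd i (fun x : E 3 => x j - x₀ j) x = if i = j then 1 else 0 := fun j => by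
      rw [pd_sub (by fun_prop) (by fun_prop), pd_const, pd_coord]; simp
    simp only [hζ, hn]
    rw [pd_sub (by fun_prop) (by fun_prop), pd_const, pd_add (by fun_prop) (by fun_prop),
      pd_add (by fun_prop) (by fun_prop), pd_sq (hdc 0 x), pd_sq (hdc 1 x), pd_sq (hdc 2 x), hpc,
      hpc, hpc]
    fin_cases i <;> simp
  have hlζ : ∀ x, lap ζ x = -6 := by
    intro x
    rw [lap_eq hζc]
    have : ∀ i, pd i (pd i ζ) x = -2 := fun i => by
      rw [hpζ, pd_const_mul (by fun_prop), pd_sub (by fun_prop) (by fun_prop), pd_const, pd_coord]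
      simp
    simp [this]; norm_num
  have hφc : ContDiff ℝ 2 (fun x => ζ x * g x) := hζc.mul hg
  obtain ⟨x, hxb, hmax, hle⟩ := exists_isLocalMax_of_sphere (g := fun x => ζ x * g x) (x₀ := x₀)
    hφc.continuous one_pos (fun x hx => by
      rw [dist_eq_norm] at hx
      simp only [hζ, hx, sub_self, norm_zero]
      norm_num
      linarith)
  have hz0 : ζ x₀ = 1 := by simp [hζ]
  rw [hz0, one_mul] at hle
  have hxn : ‖x - x₀‖ < 1 := by rwa [mem_ball, dist_eq_norm] at hxb
  have hn0 := norm_nonneg (x - x₀)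
  have hzpos : 0 < ζ x := by simp only [hζ]; nlinarith
  have hz1 : ζ x ≤ 1 := by simp only [hζ]; nlinarith
  have hgx : 11 < g x := by
    by_contra! hc
    have : 0 < g x := by
      by_contra! hneg
      nlinarith [mul_nonneg hzpos.le (neg_nonneg.2 hneg)]
    nlinarith
  have hl := lap_nonpos_of_isLocalMax hφc hmax
  rw [lap_mul hζc hg, hlζ] at hl
  have hp : ∀ i, ζ x * pd i g x = 2 * (x i - x₀ i) * g x := fun i => by
    have := pd_eq_zero_of_isLocalMax hmax i
    rw [pd_mul (hζc.differentiable (by norm_num) x) (hg.differentiable (by norm_num) x), hpζ] at this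
    linarith
  have hs : ζ x * (∑ i, pd i ζ x * pd i g x) = -4 * ‖x - x₀‖ ^ 2 * g x := by
    rw [Finset.mul_sum, norm_sq_eq_three, Fin.sum_univ_three]
    simp only [hpζ, PiLp.sub_apply]
    linear_combination (-2 * (x 0 - x₀ 0)) * hp 0 + (-2 * (x 1 - x₀ 1)) * hp 1
      + (-2 * (x 2 - x₀ 2)) * hp 2
  have hh := h x hxb hgx.le
  have h5 : ζ x * (-6 * g x) + 2 * (-4 * ‖x - x₀‖ ^ 2 * g x) + ζ x ^ 2 * lap g x ≤ 0 := by
    have := mul_nonpos_of_nonneg_of_nonpos hzpos.le hl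
    rw [← hs]
    linarith
  have h6 : ζ x ^ 2 * (g x ^ 3 / 8) ≤ ζ x ^ 2 * lap g x := by gcongr
  have h7 : 121 * g x ≤ (ζ x * g x) ^ 2 * g x := by
    have : (121 : ℝ) ≤ (ζ x * g x) ^ 2 := by nlinarith
    nlinarith
  have h8 : ζ x * g x ≤ g x := by nlinarith
  have h9 : ‖x - x₀‖ ^ 2 * g x ≤ g x := by nlinarith [pow_le_one₀ hn0 hxn.le (n := 2)]
  nlinarith

/-- The Allen–Cahn residual. -/
def res (v : E 3 → ℝ) (x : E 3) : ℝ := lap v x - W' (v x)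

/-- One regularisation step. -/
def TT (v : E 3 → ℝ) (x : E 3) : ℝ := RO v x - NO (fun y => W' (v y)) x

lemma contDiff_W' {n : WithTop ℕ∞} : ContDiff ℝ n W' := by unfold W'; fun_prop

lemma continuous_W' : Continuous W' := by unfold W'; fun_prop

lemma continuous_W : Continuous W := by unfold W; fun_prop

lemma contDiff_W {n : WithTop ℕ∞} : ContDiff ℝ n W := by unfold W; fun_prop

lemma hasDerivAt_W' (t : ℝ) : HasDerivAt W' (3 * t ^ 2 - 1) t := by
  have := (hasDerivAt_pow 3 t).fun_sub (hasDerivAt_id' t)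
  exact this.congr_deriv (by norm_num)

lemma hasDerivAt_W (t : ℝ) : HasDerivAt W (W' t) t := by
  have := (((hasDerivAt_pow 2 t).sub_const 1).pow 2).div_const 4
  refine this.congr_deriv ?_
  unfold W'; simp; ring

lemma W_nonneg (t : ℝ) : 0 ≤ W t := by unfold W; positivity

section
variable {v : E 3 → ℝ}

lemma HasCompactSupport.W' (hc : HasCompactSupport v) : HasCompactSupport fun y => W' (v y) :=
  hc.comp_left (g := _root_.W') (by simp [_root_.W'])

lemma HasCompactSupport.lap (hv : ContDiff ℝ 2 v) (hc : HasCompactSupport v) :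
    HasCompactSupport (lap v) := by
  rw [funext (lap_eq hv)]
  have : ∀ i : Fin 3, HasCompactSupport (_root_.pd i (_root_.pd i v)) := fun i => (hc.pd i).pd i
  simp only [Fin.sum_univ_three]
  exact ((this 0).add (this 1)).add (this 2)

lemma HasCompactSupport.res (hv : ContDiff ℝ 2 v) (hc : HasCompactSupport v) :
    HasCompactSupport (res v) :=
  (HasCompactSupport.lap hv hc).sub hc.W'

lemma continuous_res (hv : ContDiff ℝ 2 v) : Continuous (res v) :=
  (continuous_lap hv).sub (continuous_W'.comp hv.continuous)

lemma contDiff_res (hv : ContDiff ℝ 3 v) : ContDiff ℝ 1 (res v) :=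
  (contDiff_lap hv).sub (contDiff_W'.comp (hv.of_le (by norm_num)))

lemma contDiff_TT (hv : ContDiff ℝ 2 v) (hc : HasCompactSupport v) : ContDiff ℝ 3 (TT v) :=
  (contDiff_RO hv hc).sub (contDiff_NO (contDiff_W'.comp hv) hc.W')

lemma hasCompactSupport_TT (hc : HasCompactSupport v) : HasCompactSupport (TT v) :=
  (adm_RO.hasCompactSupport_Op hc).sub (adm_NO.hasCompactSupport_Op hc.W')

lemma TT_sub_self (hv : ContDiff ℝ 2 v) (hc : HasCompactSupport v) (x : E 3) :
    TT v x - v x = NO (res v) x := by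
  have h1 := RO_sub_self hv hc x
  have h2 := adm_NO.Op_sub (continuous_lap hv) (HasCompactSupport.lap hv hc)
    (continuous_W'.comp hv.continuous) hc.W' x
  have h3 : NO (res v) x = NO (lap v) x - NO (fun y => W' (v y)) x := h2
  rw [h3, TT]
  linarith

lemma lap_sub {f g : E 3 → ℝ} (hf : ContDiff ℝ 2 f) (hg : ContDiff ℝ 2 g) (x : E 3) :
    lap (fun y => f y - g y) x = lap f x - lap g x := by
  rw [lap_eq (hf.sub hg), lap_eq hf, lap_eq hg, ← Finset.sum_sub_distrib]
  refine Finset.sum_congr rfl fun i _ => ?_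
  have : pd i (fun x => f x - g x) = fun x => pd i f x - pd i g x :=
    funext fun y => pd_sub (hf.differentiable (by norm_num) y) (hg.differentiable (by norm_num) y)
  rw [this, pd_sub ((hf.pd_two i).differentiable (by norm_num) x)
    ((hg.pd_two i).differentiable (by norm_num) x)]

lemma lap_TT (hv : ContDiff ℝ 2 v) (hc : HasCompactSupport v) (x : E 3) :
    lap (TT v) x = W' (v x) + RO (res v) x := by
  have hW : ContDiff ℝ 2 fun y => W' (v y) := contDiff_W'.comp hv
  have h1 : lap (TT v) x = lap (RO v) x - lap (NO fun y => W' (v y)) x :=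
    lap_sub ((contDiff_RO hv hc).of_le (by norm_num)) ((contDiff_NO hW hc.W').of_le (by norm_num)) x
  have h2 : lap (RO v) x = RO (lap v) x := adm_RO.lap_Op hv hc x
  have h3 : lap (NO fun y => W' (v y)) x = NO (lap fun y => W' (v y)) x := adm_NO.lap_Op hW hc.W' x
  have h4 := RO_sub_self hW hc.W' x
  have h5 : RO (res v) x = RO (lap v) x - RO (fun y => W' (v y)) x :=
    adm_RO.Op_sub (continuous_lap hv) (HasCompactSupport.lap hv hc)
    (continuous_W'.comp hv.continuous) hc.W' x
  rw [h1, h2, h3, ← h4, h5]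
  ring

lemma res_TT (hv : ContDiff ℝ 2 v) (hc : HasCompactSupport v) (x : E 3) :
    res (TT v) x = W' (v x) - W' (TT v x) + RO (res v) x := by
  rw [res, lap_TT hv hc]; ring

lemma pd_TT (hv : ContDiff ℝ 2 v) (hc : HasCompactSupport v) (i : Fin 3) (x : E 3) :
    pd i (TT v) x = ROd i v x - NOd i (fun y => W' (v y)) x := by
  have h1 : ContDiff ℝ 1 v := hv.of_le (by norm_num)
  have hW : ContDiff ℝ 2 fun y => W' (v y) := contDiff_W'.comp hv
  rw [← pd_RO i h1 hc, ← pd_NO i (hW.of_le (by norm_num)) hc.W']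
  exact pd_sub ((contDiff_RO hv hc).differentiable (by norm_num) x)
    ((contDiff_NO hW hc.W').differentiable (by norm_num) x)

lemma pd_TT' (hv : ContDiff ℝ 2 v) (hc : HasCompactSupport v) (i : Fin 3) (x : E 3) :
    pd i (TT v) x = RO (pd i v) x - NO (fun y => (3 * v y ^ 2 - 1) * pd i v y) x := by
  have h1 : ContDiff ℝ 1 v := hv.of_le (by norm_num)
  have hW : ContDiff ℝ 2 fun y => W' (v y) := contDiff_W'.comp hv
  have e1 : pd i (RO v) x = RO (pd i v) x := adm_RO.pd_Op h1 hc i x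
  have e2 : pd i (NO fun y => W' (v y)) x = NO (pd i fun y => W' (v y)) x :=
    adm_NO.pd_Op (hW.of_le (by norm_num)) hc.W' i x
  have e3 : pd i (fun y => W' (v y)) = fun y => (3 * v y ^ 2 - 1) * pd i v y :=
    funext fun y => pd_comp (hasDerivAt_W' _) (h1.differentiable (by norm_num) y)
  rw [← e1, ← e3, ← e2]
  exact pd_sub ((contDiff_RO hv hc).differentiable (by norm_num) x)
    ((contDiff_NO hW hc.W').differentiable (by norm_num) x)

end

lemma W'_sub_le {a b : ℝ} (ha : |a| ≤ 12) (hb : |b| ≤ 12) : |W' a - W' b| ≤ 433 * |a - b| := by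
  have : W' a - W' b = (a ^ 2 + a * b + b ^ 2 - 1) * (a - b) := by unfold W'; ring
  rw [this, abs_mul]
  refine mul_le_mul_of_nonneg_right ?_ (abs_nonneg _)
  rw [abs_le] at *
  constructor <;> nlinarith

lemma W'_le {a : ℝ} (ha : |a| ≤ 12) : |W' a| ≤ 1716 := by
  have := W'_sub_le ha (b := 0) (by simp)
  have h0 : W' 0 = 0 := by simp [W']
  have h1 : W' a = a * (a ^ 2 - 1) := by unfold W'; ring
  rw [h1, abs_mul]
  have : |a ^ 2 - 1| ≤ 143 := by
    rw [abs_le] at *; constructor <;> nlinarith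
  nlinarith [abs_nonneg a, abs_nonneg (a ^ 2 - 1)]

/-- First regularisation step: pointwise bounds. -/
lemma TT_bounds {v : E 3 → ℝ} (hv : ContDiff ℝ 2 v) (hc : HasCompactSupport v) {x : E 3} {t : ℝ}
    (ht : t ≤ 1) (ht0 : 0 ≤ t) (hF : KK * ∫ y in ball x 6, res v y ^ 2 ≤ t ^ 2) :
    ∀ y ∈ ball x 4, |TT v y - v y| ≤ t ∧ |RO (res v) y| ≤ t ∧ |TT v y| ≤ 11 ∧ |v y| ≤ 12 ∧
      |res (TT v) y| ≤ 434 * t := by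
  have hfc := continuous_res hv
  have hfs := HasCompactSupport.res hv hc
  have hsm : ∀ y ∈ ball x 5, |TT v y - v y| ≤ t ∧ |RO (res v) y| ≤ t := by
    intro y hy
    have hsub : ball y 1 ⊆ ball x 6 := ball_subset_ball' (by rw [mem_ball] at hy; linarith)
    have h1 := mul_le_mul_of_nonneg_left (setIntegral_sq_mono hfc hsub) KK_nonneg
    constructor
    · rw [TT_sub_self hv hc]
      exact abs_le_of_sq_le_sq ((sq_NO_le hfc hfs y).trans (h1.trans hF)) ht0
    · exact abs_le_of_sq_le_sq ((sq_RO_le hfc hfs y).trans (h1.trans hF)) ht0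
  have hT3 := contDiff_TT hv hc
  have hT2 : ContDiff ℝ 2 (TT v) := hT3.of_le (by norm_num)
  have hKO : ∀ y ∈ ball x 4, |TT v y| ≤ 11 := by
    intro y hy
    have hsub : ball y 1 ⊆ ball x 5 := ball_subset_ball' (by rw [mem_ball] at hy; linarith)
    refine abs_le.2 ⟨?_, ?_⟩
    · have hn : ContDiff ℝ 2 (fun z => - TT v z) := hT2.neg
      have := keller_osserman hn y fun z hz h11 => by
        have hl : lap (fun z => - TT v z) z = - lap (TT v) z := by
          have := lap_sub (contDiff_const (c := (0 : ℝ))) hT2 z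
          have h0 : lap (fun _ : E 3 => (0 : ℝ)) z = 0 := by
            rw [lap_eq contDiff_const]
            have : ∀ i, pd i (fun _ : E 3 => (0 : ℝ)) = fun _ => 0 := fun i => funext fun _ => pd_const
            simp [this, pd_const]
          rw [h0] at this
          simpa using this
        have h := hsm z (hsub hz)
        rw [hl, lap_TT hv hc]
        have h1 := (abs_le.1 h.1).1
        have h1' := (abs_le.1 h.1).2
        have h2 := (abs_le.1 h.2).2
        set a := - TT v z with ha
        set b := - v z with hb
        have hb1 : a - 1 ≤ b := by rw [ha, hb]; linarith
        have e : W' (v z) = - (b ^ 3 - b) := by rw [hb]; unfold W'; ring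
        rw [e]
        have hmono : (a - 1) ^ 3 - (a - 1) ≤ b ^ 3 - b := by
          have : 0 ≤ (b - (a - 1)) * (b ^ 2 + b * (a - 1) + (a - 1) ^ 2 - 1) :=
            mul_nonneg (by linarith) (by nlinarith)
          nlinarith
        have : a ^ 3 / 8 + 1 ≤ (a - 1) ^ 3 - (a - 1) := by
          obtain ⟨d, hd⟩ : ∃ d, a = d + 11 := ⟨a - 11, by ring⟩
          have hd0 : 0 ≤ d := by linarith
          rw [hd]
          nlinarith [pow_nonneg hd0 3, pow_nonneg hd0 2]
        linarith
      linarith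
    · refine keller_osserman hT2 y fun z hz h11 => ?_
      have h := hsm z (hsub hz)
      rw [lap_TT hv hc]
      have h1 := (abs_le.1 h.1).1
      have h1' := (abs_le.1 h.1).2
      have h2 := (abs_le.1 h.2).1
      set a := TT v z with ha
      set b := v z with hb
      have hb1 : a - 1 ≤ b := by linarith
      have e : W' b = (b ^ 3 - b) := rfl
      rw [e]
      have hmono : (a - 1) ^ 3 - (a - 1) ≤ b ^ 3 - b := by
        have : 0 ≤ (b - (a - 1)) * (b ^ 2 + b * (a - 1) + (a - 1) ^ 2 - 1) :=
          mul_nonneg (by linarith) (by nlinarith)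
        nlinarith
      have : a ^ 3 / 8 + 1 ≤ (a - 1) ^ 3 - (a - 1) := by
        obtain ⟨d, hd⟩ : ∃ d, a = d + 11 := ⟨a - 11, by ring⟩
        have hd0 : 0 ≤ d := by linarith
        rw [hd]
        nlinarith [pow_nonneg hd0 3, pow_nonneg hd0 2]
      linarith
  intro y hy
  have h5 := hsm y (ball_subset_ball (by norm_num) hy)
  have h11 := hKO y hy
  have h12 : |v y| ≤ 12 := by
    have := abs_sub_abs_le_abs_sub (v y) (TT v y)
    rw [abs_sub_comm] at this
    linarith [h5.1]
  refine ⟨h5.1, h5.2, h11, h12, ?_⟩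
  rw [res_TT hv hc]
  have h6 := W'_sub_le h12 (h11.trans (by norm_num))
  rw [abs_sub_comm (v y)] at h6
  have h7 := abs_add_le (W' (v y) - W' (TT v y)) (RO (res v) y)
  linarith [h5.1, h5.2]

/-- Local `L²` mass. -/
def FF (f : E 3 → ℝ) (ρ : ℝ) (x : E 3) : ℝ := ∫ y in ball x ρ, f y ^ 2

lemma FF_nonneg (f : E 3 → ℝ) (ρ : ℝ) (x : E 3) : 0 ≤ FF f ρ x := integral_sq_nonneg _ _

lemma FF_eq (f : E 3 → ℝ) (ρ : ℝ) (x : E 3) : FF f ρ x = ∫ y in ball (0 : E 3) ρ, f (x + y) ^ 2 := by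
  have := setIntegral_ball_translate (fun y => f y ^ 2) x 0 ρ
  rw [add_zero] at this
  exact this.symm

lemma continuous_FF {f : E 3 → ℝ} (hf : Continuous f) (hc : HasCompactSupport f) (ρ : ℝ) :
    Continuous (FF f ρ) := by
  obtain ⟨C, hC0, hC⟩ := exists_norm_le hf hc
  have := isFiniteMeasure_restrict_ball (0 : E 3) ρ
  rw [funext (FF_eq f ρ)]
  refine continuous_of_dominated (bound := fun _ => C ^ 2) (fun x => ?_)
    (fun x => Eventually.of_forall fun z => ?_) (integrable_const _) (Eventually.of_forall fun z => ?_)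
  · have : Continuous fun y => f (x + y) ^ 2 := by fun_prop
    exact this.aestronglyMeasurable
  · rw [norm_pow]; exact pow_le_pow_left₀ (norm_nonneg _) (hC _) 2
  · fun_prop

lemma integral_FF_le {f : E 3 → ℝ} (hf : Continuous f) (hc : HasCompactSupport f) (ρ : ℝ) (c : E 3)
    (r : ℝ) : ∫ x in ball c r, FF f ρ x ≤
      ((volume : Measure (E 3)).restrict (ball 0 ρ)).real univ * FF f (r + ρ) c := by
  have := isFiniteMeasure_restrict_ball (0 : E 3) ρ
  have hd : ∀ᵐ z ∂volume.restrict (ball (0 : E 3) ρ), ‖z‖ ≤ ρ := by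
    filter_upwards [ae_restrict_mem measurableSet_ball] with z hz
    exact (mem_ball_zero_iff.1 hz).le
  have h := setIntegral_translates_le (ν := volume.restrict (ball (0 : E 3) ρ)) (p := fun y => y)
    measurable_id hd (g := fun y => f y ^ 2) (hf.pow 2) (fun x => sq_nonneg _)
    (hc.comp_left (g := fun t => t ^ 2) (by simp)) c r
  simp only [FF_eq f ρ]
  exact h

lemma W'_sub_le' {a b C : ℝ} (hC : 0 ≤ C) (ha : |a| ≤ C) (hb : |b| ≤ C) :
    |W' a - W' b| ≤ (3 * C ^ 2 + 1) * |a - b| := by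
  have : W' a - W' b = (a ^ 2 + a * b + b ^ 2 - 1) * (a - b) := by unfold W'; ring
  rw [this, abs_mul]
  refine mul_le_mul_of_nonneg_right ?_ (abs_nonneg _)
  rw [abs_le] at *
  constructor <;> nlinarith

/-- The twice regularised function: pointwise bounds. -/
lemma exists_TT_TT_bounds : ∃ C : ℝ, 12 ≤ C ∧ ∀ v : E 3 → ℝ, ContDiff ℝ 2 v → HasCompactSupport v →
    ∀ (x : E 3) (t : ℝ), 0 ≤ t → t ≤ 1 → KK * FF (res v) 6 x ≤ t ^ 2 →
      |TT (TT v) x| ≤ C ∧ (∀ i, |pd i (TT (TT v)) x| ≤ C) ∧ |res (TT (TT v)) x| ≤ C * t ∧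
      (∀ i, |pd i (res (TT (TT v))) x| ≤ C * t) ∧ |TT (TT v) x - v x| ≤ C * t ∧
      ∀ i, |pd i (TT (TT v)) x - pd i (TT v) x| ≤ C * t := by
  set c₁ := 24 * cK * nu.real univ with hc₁
  have hc₁0 : 0 ≤ c₁ := by have := cK_pos; positivity
  set b := 12 + 434 * c₁ with hb
  have hb0 : 0 ≤ b := by positivity
  set g := 1728 * c₁ with hg
  have hg0 : 0 ≤ g := by positivity
  set d := 434 * c₁ with hd
  have hd0 : 0 ≤ d := by positivity
  refine ⟨b + g + d + ((3 * b ^ 2 + 1) * d + d) + (6 * b * d * g), ?_, ?_⟩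
  · have : 0 ≤ g + d + ((3 * b ^ 2 + 1) * d + d) + (6 * b * d * g) := by positivity
    rw [hb]; linarith
  intro v hv hc x t ht0 ht1 hF
  set C := b + g + d + ((3 * b ^ 2 + 1) * d + d) + (6 * b * d * g) with hC
  have hA := TT_bounds hv hc ht1 ht0 hF
  set v₁ := TT v with hv₁
  have hv1c : ContDiff ℝ 3 v₁ := contDiff_TT hv hc
  have hv1 : ContDiff ℝ 2 v₁ := hv1c.of_le (by norm_num)
  have hc1 : HasCompactSupport v₁ := hasCompactSupport_TT hc
  set w := TT v₁ with hw
  have hwc : ContDiff ℝ 3 w := contDiff_TT hv1 hc1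
  have hf1c : ContDiff ℝ 1 (res v₁) := contDiff_res hv1c
  have hf1s : HasCompactSupport (res v₁) := HasCompactSupport.res hv1 hc1
  have h14 : ∀ y ∈ ball x 1, y ∈ ball x 4 := fun y hy => ball_subset_ball (by norm_num) hy
  have hx1 := hA x (mem_ball_self (by norm_num))
  have hNO : |NO (res v₁) x| ≤ d * t := by
    refine (adm_NO.abs_Op_le fun y hy => (hA y (h14 y hy)).2.2.2.2).trans (le_of_eq ?_)
    rw [hd, hc₁]; ring
  have hRO : |RO (res v₁) x| ≤ d * t := by
    refine (adm_RO.abs_Op_le fun y hy => (hA y (h14 y hy)).2.2.2.2).trans (le_of_eq ?_)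
    rw [hd, hc₁]; ring
  have hNOd : ∀ i, |NOd i (res v₁) x| ≤ d * t := fun i => by
    refine ((adm_NOd i).abs_Op_le fun y hy => (hA y (h14 y hy)).2.2.2.2).trans (le_of_eq ?_)
    rw [hd, hc₁]; ring
  have hROd : ∀ i, |ROd i (res v₁) x| ≤ d * t := fun i => by
    refine ((adm_ROd i).abs_Op_le fun y hy => (hA y (h14 y hy)).2.2.2.2).trans (le_of_eq ?_)
    rw [hd, hc₁]; ring
  have hwv : |w x - v₁ x| ≤ d * t := by rw [hw, TT_sub_self hv1 hc1]; exact hNO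
  have hdt : d * t ≤ d := by nlinarith
  have hwb : |w x| ≤ b := by
    have := abs_sub_abs_le_abs_sub (w x) (v₁ x)
    rw [hb]
    linarith [hx1.2.2.1]
  have hv1b : |v₁ x| ≤ b := by rw [hb]; linarith [hx1.2.2.1]
  have hpv1 : ∀ i, |pd i v₁ x| ≤ g := fun i => by
    rw [hv₁, pd_TT hv hc]
    have h1 : |ROd i v x| ≤ 24 * cK * 12 * nu.real univ :=
      (adm_ROd i).abs_Op_le fun y hy => (hA y (h14 y hy)).2.2.2.1
    have h2 : |NOd i (fun y => W' (v y)) x| ≤ 24 * cK * 1716 * nu.real univ :=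
      (adm_NOd i).abs_Op_le fun y hy => W'_le (hA y (h14 y hy)).2.2.2.1
    have h3 := abs_sub (ROd i v x) (NOd i (fun y => W' (v y)) x)
    rw [hg, hc₁]
    nlinarith
  have hpwv : ∀ i, |pd i w x - pd i v₁ x| ≤ d * t := fun i => by
    have e : NO (res v₁) = fun y => w y - v₁ y := funext fun y => (TT_sub_self hv1 hc1 y).symm
    rw [← pd_sub (hwc.differentiable (by norm_num) x) (hv1.differentiable (by norm_num) x), ← e,
      pd_NO i hf1c hf1s]
    exact hNOd i
  have hCd : d * t ≤ C * t := by
    refine mul_le_mul_of_nonneg_right ?_ ht0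
    have : 0 ≤ b + g + ((3 * b ^ 2 + 1) * d + d) + (6 * b * d * g) := by positivity
    rw [hC]; linarith
  have h3b : 0 ≤ (3 * b ^ 2 + 1) * d := by positivity
  have h4b : 0 ≤ 6 * b * d * g := by positivity
  refine ⟨by linarith, fun i => ?_, ?_, fun i => ?_, ?_, fun i => (hpwv i).trans hCd⟩
  · have := abs_sub_abs_le_abs_sub (pd i w x) (pd i v₁ x)
    linarith [hpv1 i, hpwv i]
  · rw [res_TT hv1 hc1]
    have h1 := W'_sub_le' hb0 hv1b hwb
    rw [abs_sub_comm (v₁ x)] at h1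
    have h2 := abs_add_le (W' (v₁ x) - W' (w x)) (RO (res v₁) x)
    have h3 : (3 * b ^ 2 + 1) * |w x - v₁ x| ≤ (3 * b ^ 2 + 1) * (d * t) := by gcongr
    have h4 : ((3 * b ^ 2 + 1) * d + d) * t ≤ C * t :=
      mul_le_mul_of_nonneg_right (by linarith) ht0
    linarith
  · have e : res w = fun y => (W' (v₁ y) - W' (w y)) + RO (res v₁) y := funext (res_TT hv1 hc1)
    have dv : DifferentiableAt ℝ v₁ x := hv1.differentiable (by norm_num) x
    have dw : DifferentiableAt ℝ w x := hwc.differentiable (by norm_num) x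
    have dWv : DifferentiableAt ℝ (fun y => W' (v₁ y)) x :=
      (hasDerivAt_W' _).differentiableAt.fun_comp' x dv
    have dWw : DifferentiableAt ℝ (fun y => W' (w y)) x :=
      (hasDerivAt_W' _).differentiableAt.fun_comp' x dw
    have dR : DifferentiableAt ℝ (RO (res v₁)) x :=
      (adm_RO.hasFDerivAt_Op hf1c hf1s x).differentiableAt
    rw [e, pd_add (dWv.fun_sub dWw) dR, pd_sub dWv dWw, pd_comp (hasDerivAt_W' _) dv,
      pd_comp (hasDerivAt_W' _) dw, pd_RO i hf1c hf1s]
    have e2 : (3 * v₁ x ^ 2 - 1) * pd i v₁ x - (3 * w x ^ 2 - 1) * pd i w x + ROd i (res v₁) x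
        = - (3 * ((w x + v₁ x) * (w x - v₁ x)) * pd i v₁ x)
          - (3 * w x ^ 2 - 1) * (pd i w x - pd i v₁ x) + ROd i (res v₁) x := by ring
    rw [e2]
    have h1 : |3 * ((w x + v₁ x) * (w x - v₁ x)) * pd i v₁ x| ≤ 3 * ((2 * b) * (d * t)) * g := by
      rw [abs_mul, abs_mul, abs_mul]
      have : |w x + v₁ x| ≤ 2 * b := (abs_add_le _ _).trans (by linarith)
      have h3 : |(3 : ℝ)| = 3 := abs_of_pos (by norm_num)
      rw [h3]
      gcongr
      exact hpv1 i
    have h2 : |(3 * w x ^ 2 - 1) * (pd i w x - pd i v₁ x)| ≤ (3 * b ^ 2 + 1) * (d * t) := by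
      rw [abs_mul]
      have : |3 * w x ^ 2 - 1| ≤ 3 * b ^ 2 + 1 := by
        have hw2 : w x ^ 2 ≤ b ^ 2 := sq_le_sq' (by linarith [(abs_le.1 hwb).1]) (abs_le.1 hwb).2
        rw [abs_le]; constructor <;> nlinarith [sq_nonneg (w x)]
      gcongr
      exact hpwv i
    have h3 := abs_add_le (- (3 * ((w x + v₁ x) * (w x - v₁ x)) * pd i v₁ x)
          - (3 * w x ^ 2 - 1) * (pd i w x - pd i v₁ x)) (ROd i (res v₁) x)
    have h4 := abs_sub (- (3 * ((w x + v₁ x) * (w x - v₁ x)) * pd i v₁ x))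
      ((3 * w x ^ 2 - 1) * (pd i w x - pd i v₁ x))
    rw [abs_neg] at h4
    have h5 : (6 * b * d * g + (3 * b ^ 2 + 1) * d + d) * t ≤ C * t :=
      mul_le_mul_of_nonneg_right (by linarith) ht0
    linarith [hROd i]
  · have h1 : |w x - v x| ≤ d * t + t := by
      have := abs_add_le (w x - v₁ x) (v₁ x - v x)
      rw [sub_add_sub_cancel] at this
      linarith [hx1.1]
    have h5 : (d + 1) * t ≤ C * t :=
      mul_le_mul_of_nonneg_right (by linarith) ht0
    linarith

/-- The diffuse energy density at scale one. -/
def en (w : E 3 → ℝ) (x : E 3) : ℝ := gsq w x / 2 + W (w x)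

lemma en_nonneg (w : E 3 → ℝ) (x : E 3) : 0 ≤ en w x := by
  have := gsq_nonneg w x
  have := W_nonneg (w x)
  unfold en; positivity

lemma continuous_en {w : E 3 → ℝ} (hw : ContDiff ℝ 1 w) : Continuous (en w) :=
  ((continuous_gsq hw).div_const 2).add (continuous_W.comp hw.continuous)

lemma W_le_of_close {a b C d : ℝ} (ha : |a| ≤ C) (hb : |b| ≤ C) (hd : |a - b| ≤ d) :
    W a ≤ 2 * W b + 2 * C ^ 2 * d ^ 2 := by
  have h1 : (a ^ 2 - 1) ^ 2 ≤ 2 * (b ^ 2 - 1) ^ 2 + 2 * ((a - b) * (a + b)) ^ 2 := by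
    have : a ^ 2 - 1 = (b ^ 2 - 1) + (a - b) * (a + b) := by ring
    rw [this]
    nlinarith [sq_nonneg ((b ^ 2 - 1) - (a - b) * (a + b))]
  have h2 : (a - b) ^ 2 ≤ d ^ 2 := by rw [← sq_abs]; gcongr
  have h3 : (a + b) ^ 2 ≤ (2 * C) ^ 2 := by
    rw [← sq_abs]
    have := abs_add_le a b
    gcongr; linarith
  have h4 : ((a - b) * (a + b)) ^ 2 ≤ d ^ 2 * (2 * C) ^ 2 := by
    rw [mul_pow]; gcongr
  unfold W
  nlinarith

lemma integral_sq_pd_TT_le {v : E 3 → ℝ} (hv : ContDiff ℝ 2 v) (hc : HasCompactSupport v) (c : E 3)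
    (r : ℝ) (hb : ∀ y ∈ ball c (r + 1), |v y| ≤ 12) (i : Fin 3) :
    ∫ x in ball c r, pd i (TT v) x ^ 2 ≤ (2 * (1 + 433 ^ 2) * (24 * cK * nu.real univ) ^ 2) *
      ∫ x in ball c (r + 1), pd i v x ^ 2 := by
  have h1 : ContDiff ℝ 1 v := hv.of_le (by norm_num)
  have hp : Continuous (pd i v) := h1.pd_one i
  have hps : HasCompactSupport (pd i v) := hc.pd i
  set q : E 3 → ℝ := fun y => (3 * v y ^ 2 - 1) * pd i v y with hq
  have hqc : Continuous q := by have := hv.continuous; fun_prop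
  have hqs : HasCompactSupport q := hps.mul_left
  set c₁ := 24 * cK * nu.real univ with hc₁
  have e1 := adm_RO.integral_sq_Op_le hp hps c r
  have e2 := adm_NO.integral_sq_Op_le hqc hqs c r
  have cR : Continuous (RO (pd i v)) := adm_RO.continuous_Op hp hps
  have cN : Continuous (NO q) := adm_NO.continuous_Op hqc hqs
  have e3 : ∫ x in ball c (r + 1), q x ^ 2 ≤ 433 ^ 2 * ∫ x in ball c (r + 1), pd i v x ^ 2 := by
    rw [← integral_const_mul]
    refine setIntegral_mono_on ((hqc.pow 2).integrableOn_ball c _)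
      ((continuous_const.mul (hp.pow 2)).integrableOn_ball c _) measurableSet_ball fun y hy => ?_
    have hy := hb y hy
    simp only [hq, mul_pow]
    refine mul_le_mul_of_nonneg_right ?_ (sq_nonneg _)
    rw [abs_le] at hy
    have : v y ^ 2 ≤ 144 := by nlinarith
    refine sq_le_sq' ?_ ?_ <;> nlinarith [sq_nonneg (v y)]
  calc ∫ x in ball c r, pd i (TT v) x ^ 2
      ≤ ∫ x in ball c r, (2 * RO (pd i v) x ^ 2 + 2 * NO q x ^ 2) := by
        refine setIntegral_mono ?_ ?_ fun x => ?_
        · exact (((contDiff_TT hv hc).of_le (by norm_num : (1 : WithTop ℕ∞) ≤ 3)).pd_one i).pow 2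
            |>.integrableOn_ball c r
        · exact ((continuous_const.mul (cR.pow 2)).add (continuous_const.mul (cN.pow 2)))
            |>.integrableOn_ball c r
        · simp only [pd_TT' hv hc]
          nlinarith [sq_nonneg (RO (pd i v) x + NO q x)]
    _ = 2 * (∫ x in ball c r, RO (pd i v) x ^ 2) + 2 * ∫ x in ball c r, NO q x ^ 2 := by
        have c1 : Continuous fun x => 2 * RO (pd i v) x ^ 2 := continuous_const.mul (cR.pow 2)
        have c2 : Continuous fun x => 2 * NO q x ^ 2 := continuous_const.mul (cN.pow 2)
        rw [integral_add (c1.integrableOn_ball c r) (c2.integrableOn_ball c r),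
          integral_const_mul, integral_const_mul]
    _ ≤ 2 * (c₁ ^ 2 * ∫ x in ball c (r + 1), pd i v x ^ 2)
        + 2 * (c₁ ^ 2 * (433 ^ 2 * ∫ x in ball c (r + 1), pd i v x ^ 2)) := by
        have := e2.trans (mul_le_mul_of_nonneg_left e3 (sq_nonneg c₁))
        have e1' : ∫ x in ball c r, RO (pd i v) x ^ 2 ≤ c₁ ^ 2 * ∫ x in ball c (r + 1), pd i v x ^ 2 := e1
        have e2' : ∫ x in ball c r, NO q x ^ 2 ≤
          c₁ ^ 2 * (433 ^ 2 * ∫ x in ball c (r + 1), pd i v x ^ 2) := this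
        linarith
    _ = _ := by ring

theorem exists_regularisation : ∃ C η₀ : ℝ, 12 ≤ C ∧ 0 < η₀ ∧ ∀ v : E 3 → ℝ, ContDiff ℝ 2 v →
    HasCompactSupport v → ∃ w : E 3 → ℝ, ContDiff ℝ 3 w ∧ HasCompactSupport w ∧
      (∀ x, FF (res v) 6 x ≤ η₀ → |w x| ≤ C ∧ (∀ i, |pd i w x| ≤ C) ∧
        res w x ^ 2 ≤ C * FF (res v) 6 x ∧ (∀ i, pd i (res w) x ^ 2 ≤ C * FF (res v) 6 x) ∧
        (w x - v x) ^ 2 ≤ C * FF (res v) 6 x) ∧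
      ∀ (c : E 3) (r : ℝ), FF (res v) (r + 8) c ≤ η₀ →
        ∫ x in ball c r, en w x ≤ C * ((∫ x in ball c (r + 8), en v x) + FF (res v) (r + 8) c) := by
  obtain ⟨C₁, hC₁, hb⟩ := exists_TT_TT_bounds
  set c₂ := 2 * (1 + 433 ^ 2) * (24 * cK * nu.real univ) ^ 2 with hc₂
  have hc₂0 : 0 ≤ c₂ := by positivity
  set V := ((volume : Measure (E 3)).restrict (ball 0 6)).real univ with hV
  have hV0 : 0 ≤ V := measureReal_nonneg
  have hK := KK_nonneg
  set c₃ := (3 * C₁ ^ 2 + 2 * C₁ ^ 4) * KK with hc₃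
  have hc₃0 : 0 ≤ c₃ := by positivity
  set C := C₁ + C₁ ^ 2 * KK + 2 * c₂ + 2 + c₃ * V with hC
  refine ⟨C, 1 / (KK + 1), ?_, by positivity, ?_⟩
  · have : 0 ≤ C₁ ^ 2 * KK + 2 * c₂ + 2 + c₃ * V := by positivity
    rw [hC]; linarith
  intro v hv hc
  have hv1 : ContDiff ℝ 1 v := hv.of_le (by norm_num)
  have hfc := continuous_res hv
  have hfs := HasCompactSupport.res hv hc
  set w := TT (TT v) with hw
  have hT3 := contDiff_TT hv hc
  have hT2 : ContDiff ℝ 2 (TT v) := hT3.of_le (by norm_num)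
  have hw3 : ContDiff ℝ 3 w := contDiff_TT hT2 (hasCompactSupport_TT hc)
  have hw1 : ContDiff ℝ 1 w := hw3.of_le (by norm_num)
  have hη : ∀ x, FF (res v) 6 x ≤ 1 / (KK + 1) → KK * FF (res v) 6 x ≤ 1 := fun x hx => by
    have h1 := mul_le_mul_of_nonneg_left hx hK
    refine h1.trans ?_
    rw [mul_one_div, div_le_one (by positivity)]
    linarith
  have hbx : ∀ x, FF (res v) 6 x ≤ 1 / (KK + 1) → |w x| ≤ C₁ ∧ (∀ i, |pd i w x| ≤ C₁) ∧
      |res w x| ≤ C₁ * √(KK * FF (res v) 6 x) ∧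
      (∀ i, |pd i (res w) x| ≤ C₁ * √(KK * FF (res v) 6 x)) ∧
      |w x - v x| ≤ C₁ * √(KK * FF (res v) 6 x) ∧
      ∀ i, |pd i w x - pd i (TT v) x| ≤ C₁ * √(KK * FF (res v) 6 x) := fun x hx => by
    refine hb v hv hc x _ (Real.sqrt_nonneg _) ?_ ?_
    · rw [Real.sqrt_le_one]; exact hη x hx
    · rw [Real.sq_sqrt (mul_nonneg hK (FF_nonneg _ _ _))]
  have hsq : ∀ x (a : ℝ), |a| ≤ C₁ * √(KK * FF (res v) 6 x) → a ^ 2 ≤ C₁ ^ 2 * KK * FF (res v) 6 x := by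
    intro x a ha
    have := pow_le_pow_left₀ (abs_nonneg a) ha 2
    rwa [sq_abs, mul_pow, Real.sq_sqrt (mul_nonneg hK (FF_nonneg _ _ _)), ← mul_assoc] at this
  have hup : ∀ x, C₁ ^ 2 * KK * FF (res v) 6 x ≤ C * FF (res v) 6 x := fun x => by
    refine mul_le_mul_of_nonneg_right ?_ (FF_nonneg _ _ _)
    have : 0 ≤ 2 * c₂ + 2 + c₃ * V := by positivity
    rw [hC]; linarith
  have hC1C : C₁ ≤ C := by
    have : 0 ≤ C₁ ^ 2 * KK + 2 * c₂ + 2 + c₃ * V := by positivity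
    rw [hC]; linarith
  refine ⟨w, hw3, hasCompactSupport_TT (hasCompactSupport_TT hc), fun x hx => ?_, fun c r hr => ?_⟩
  · obtain ⟨h1, h2, h3, h4, h5, -⟩ := hbx x hx
    exact ⟨h1.trans hC1C, fun i => (h2 i).trans hC1C, (hsq x _ h3).trans (hup x),
      fun i => (hsq x _ (h4 i)).trans (hup x), (hsq x _ h5).trans (hup x)⟩
  · have hF6 : ∀ y ∈ ball c (r + 1), FF (res v) 6 y ≤ 1 / (KK + 1) := fun y hy => by
      refine (setIntegral_sq_mono hfc (ball_subset_ball' ?_)).trans hr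
      rw [mem_ball] at hy; linarith
    have hv12 : ∀ y ∈ ball c (r + 1), |v y| ≤ 12 := fun y hy =>
      (TT_bounds hv hc le_rfl zero_le_one (by rw [one_pow]; exact hη y (hF6 y hy)) y
        (mem_ball_self (by norm_num))).2.2.2.1
    have hpt : ∀ x ∈ ball c r, en w x ≤ (∑ i, pd i (TT v) x ^ 2) + 2 * W (v x)
        + c₃ * FF (res v) 6 x := by
      intro x hx
      have hx1 : x ∈ ball c (r + 1) := ball_subset_ball (by linarith) hx
      obtain ⟨h1, -, -, -, h5, h6⟩ := hbx x (hF6 x hx1)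
      have hW := W_le_of_close h1 ((hv12 x hx1).trans hC₁) h5
      rw [mul_pow, Real.sq_sqrt (mul_nonneg hK (FF_nonneg _ _ _))] at hW
      have hg : ∀ i, pd i w x ^ 2 ≤ 2 * pd i (TT v) x ^ 2 + 2 * (C₁ ^ 2 * KK * FF (res v) 6 x) := by
        intro i
        have := hsq x _ (h6 i)
        nlinarith [sq_nonneg (pd i w x - 2 * pd i (TT v) x)]
      simp only [en, gsq, Fin.sum_univ_three]
      rw [hc₃]
      linarith [hg 0, hg 1, hg 2]
    have cFF := continuous_FF hfc hfs 6
    have cT : ∀ i, Continuous fun x => pd i (TT v) x ^ 2 := fun i =>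
      ((hT2.of_le (by norm_num : (1 : WithTop ℕ∞) ≤ 2)).pd_one i).pow 2
    have cW : Continuous fun x => 2 * W (v x) := continuous_const.mul (continuous_W.comp hv.continuous)
    have cS : Continuous fun x => ∑ i, pd i (TT v) x ^ 2 := continuous_finsetSum _ fun i _ => cT i
    have hmon : ∀ {g : E 3 → ℝ} {ρ : ℝ}, Continuous g → (∀ x, 0 ≤ g x) → ρ ≤ r + 8 →
        ∫ x in ball c ρ, g x ≤ ∫ x in ball c (r + 8), g x := fun hg hg0 hρ =>
      setIntegral_mono_set (hg.integrableOn_ball c _) (Eventually.of_forall hg0)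
        (ball_subset_ball hρ).eventuallyLE
    have i1 : ∫ x in ball c r, (∑ i, pd i (TT v) x ^ 2) ≤ 2 * c₂ * ∫ x in ball c (r + 8), en v x := by
      rw [integral_finsetSum _ fun i _ => (cT i).integrableOn_ball c r]
      calc ∑ i, ∫ x in ball c r, pd i (TT v) x ^ 2
          ≤ ∑ i, c₂ * ∫ x in ball c (r + 1), pd i v x ^ 2 :=
            Finset.sum_le_sum fun i _ => integral_sq_pd_TT_le hv hc c r hv12 i
        _ = c₂ * ∫ x in ball c (r + 1), gsq v x := by
            have cP : ∀ i, Continuous fun x => pd i v x ^ 2 := fun i => (hv1.pd_one i).pow 2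
            rw [← Finset.mul_sum, ← integral_finsetSum _ fun i _ =>
              (cP i).integrableOn_ball c (r + 1)]
            rfl
        _ ≤ c₂ * ∫ x in ball c (r + 8), 2 * en v x := by
            refine mul_le_mul_of_nonneg_left ?_ hc₂0
            refine (hmon (continuous_gsq hv1) (gsq_nonneg v) (by linarith)).trans ?_
            refine setIntegral_mono ((continuous_gsq hv1).integrableOn_ball c _)
              ((continuous_const.mul (continuous_en hv1)).integrableOn_ball c _) fun x => ?_
            have := W_nonneg (v x)
            simp only [en]; linarith
        _ = _ := by rw [integral_const_mul]; ring
    have i2 : ∫ x in ball c r, 2 * W (v x) ≤ 2 * ∫ x in ball c (r + 8), en v x := by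
      rw [← integral_const_mul]
      refine (hmon cW (fun x => by have := W_nonneg (v x); positivity) (by linarith)).trans ?_
      refine setIntegral_mono (cW.integrableOn_ball c _)
        ((continuous_const.mul (continuous_en hv1)).integrableOn_ball c _) fun x => ?_
      have := gsq_nonneg v x
      simp only [en]; linarith
    have i3 : ∫ x in ball c r, c₃ * FF (res v) 6 x ≤ c₃ * V * FF (res v) (r + 8) c := by
      rw [integral_const_mul, mul_assoc c₃ V]
      refine mul_le_mul_of_nonneg_left ?_ hc₃0
      refine (integral_FF_le hfc hfs 6 c r).trans ?_
      refine mul_le_mul_of_nonneg_left ?_ hV0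
      exact setIntegral_sq_mono hfc (ball_subset_ball (by linarith))
    have hE0 : 0 ≤ ∫ x in ball c (r + 8), en v x := integral_nonneg (en_nonneg v)
    have hFr0 := FF_nonneg (res v) (r + 8) c
    calc ∫ x in ball c r, en w x ≤ ∫ x in ball c r, ((∑ i, pd i (TT v) x ^ 2) + 2 * W (v x)
        + c₃ * FF (res v) 6 x) :=
          setIntegral_mono_on ((continuous_en hw1).integrableOn_ball c r)
            (((cS.add cW).add (continuous_const.mul cFF)).integrableOn_ball c r) measurableSet_ball hpt
      _ = (∫ x in ball c r, ∑ i, pd i (TT v) x ^ 2) + (∫ x in ball c r, 2 * W (v x))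
        + ∫ x in ball c r, c₃ * FF (res v) 6 x := by
          have c1 : Continuous fun x => (∑ i, pd i (TT v) x ^ 2) + 2 * W (v x) := cS.add cW
          have c2 : Continuous fun x => c₃ * FF (res v) 6 x := continuous_const.mul cFF
          rw [integral_add (c1.integrableOn_ball c r) (c2.integrableOn_ball c r),
            integral_add (cS.integrableOn_ball c r) (cW.integrableOn_ball c r)]
      _ ≤ (2 * c₂ + 2) * (∫ x in ball c (r + 8), en v x) + c₃ * V * FF (res v) (r + 8) c := by
          linarith
      _ ≤ C * (∫ x in ball c (r + 8), en v x) + C * FF (res v) (r + 8) c := by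
          have a1 : 2 * c₂ + 2 ≤ C := by
            have : 0 ≤ C₁ + C₁ ^ 2 * KK + c₃ * V := by positivity
            rw [hC]; linarith
          have a2 : c₃ * V ≤ C := by
            have : 0 ≤ C₁ + C₁ ^ 2 * KK + 2 * c₂ + 2 := by positivity
            rw [hC]; linarith
          gcongr
      _ = _ := by ring

lemma res_neg {w : E 3 → ℝ} (hw : ContDiff ℝ 2 w) (x : E 3) :
    res (fun y => - w y) x = - res w x := by
  have h1 : ∀ i, pd i (fun y => - w y) = fun y => - pd i w y := fun i => funext fun y => pd_neg
  rw [res, res, lap_eq hw, lap_eq hw.neg]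
  simp only [h1, pd_neg, Finset.sum_neg_distrib, W']
  ring

lemma le_one_add_of_res_le {w : E 3 → ℝ} (hw : ContDiff ℝ 2 w) {x₀ : E 3} {L C β ρ : ℝ}
    (hL : 0 < L) (hC : 0 < C) (hρ : 0 < ρ) (hwC : ∀ x, dist x x₀ ≤ L → |w x| ≤ C)
    (hres : ∀ x, dist x x₀ ≤ L → |res w x| ≤ β) (hβ : β + 6 * C / L ^ 2 < 2 * ρ) :
    w x₀ ≤ 1 + ρ := by
  by_contra hcon
  push Not at hcon
  obtain ⟨x, hx, h1, -, h3⟩ := exists_penalised_max hw hL hC.le (x₀ := x₀) fun x hx => by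
    have := (abs_le.1 (hwC x hx.le)).2
    linarith
  have hr := (abs_le.1 (hres x (mem_ball.1 hx).le)).1
  have hlow : 2 * ρ ≤ W' (w x) := by
    have ht : 1 + ρ ≤ w x := by linarith
    have : (2 : ℝ) ≤ w x * (w x + 1) := by nlinarith
    have h2 : 2 * ρ ≤ (w x * (w x + 1)) * (w x - 1) := by nlinarith
    unfold W'; nlinarith
  unfold res at hr
  linarith

lemma abs_le_one_add_of_res_le {w : E 3 → ℝ} (hw : ContDiff ℝ 2 w) {x₀ : E 3} {L C β ρ : ℝ}
    (hL : 0 < L) (hC : 0 < C) (hρ : 0 < ρ) (hwC : ∀ x, dist x x₀ ≤ L → |w x| ≤ C)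
    (hres : ∀ x, dist x x₀ ≤ L → |res w x| ≤ β) (hβ : β + 6 * C / L ^ 2 < 2 * ρ) :
    |w x₀| ≤ 1 + ρ := by
  refine abs_le'.2 ⟨le_one_add_of_res_le hw hL hC hρ hwC hres hβ,
    le_one_add_of_res_le hw.neg hL hC hρ (w := fun y => - w y) (fun x hx => ?_) (fun x hx => ?_) hβ⟩
  · rw [abs_neg]; exact hwC x hx
  · rw [res_neg hw, abs_neg]; exact hres x hx

/-- The modified discrepancy. -/
def psi (δ : ℝ) (w : E 3 → ℝ) (x : E 3) : ℝ :=
  gsq w x / 2 - (W (w x) + δ * (1 - w x ^ 2 / 8))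

lemma contDiff_gsq {w : E 3 → ℝ} (hw : ContDiff ℝ 3 w) : ContDiff ℝ 2 (gsq w) :=
  ContDiff.sum fun i _ => (hw.pd_three i).pow 2

lemma contDiff_psi {w : E 3 → ℝ} (hw : ContDiff ℝ 3 w) (δ : ℝ) : ContDiff ℝ 2 (psi δ w) := by
  have h1 := contDiff_gsq hw
  have h2 : ContDiff ℝ 2 w := hw.of_le (by norm_num)
  have h3 : ContDiff ℝ 2 (fun x => W (w x)) := contDiff_W.comp h2
  unfold psi
  fun_prop

lemma pd_psi {w : E 3 → ℝ} (hw : ContDiff ℝ 3 w) (δ : ℝ) (i : Fin 3) (x : E 3) :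
    pd i (psi δ w) x = (∑ j, pd j w x * pd i (pd j w) x)
      - (w x ^ 3 - w x - δ / 4 * w x) * pd i w x := by
  have hd : Differentiable ℝ w := hw.differentiable (by norm_num)
  have hdp : ∀ j, Differentiable ℝ (pd j w) := fun j => (hw.pd_three j).differentiable (by norm_num)
  have e : psi δ w = fun x => (pd 0 w x ^ 2 + pd 1 w x ^ 2 + pd 2 w x ^ 2) * (1 / 2)
      - (fun t => W t + δ * (1 - t ^ 2 / 8)) (w x) := by
    funext x; simp only [psi, gsq, Fin.sum_univ_three]; ring
  have hQ : HasDerivAt (fun t => W t + δ * (1 - t ^ 2 / 8)) (w x ^ 3 - w x - δ / 4 * w x) (w x) := by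
    have h1 := (hasDerivAt_W (w x)).add
      (((((hasDerivAt_id (w x)).pow 2).div_const 8).const_sub 1).const_mul δ)
    refine h1.congr_deriv ?_
    simp [W']; ring
  have hQd : DifferentiableAt ℝ (fun x => (fun t => W t + δ * (1 - t ^ 2 / 8)) (w x)) x :=
    hQ.differentiableAt.comp x (hd x)
  rw [e, pd_sub (by have h0 := hdp 0; have h1 := hdp 1; have h2 := hdp 2; fun_prop) hQd, pd_comp hQ (hd x),
    pd_mul (by have h0 := hdp 0; have h1 := hdp 1; have h2 := hdp 2; fun_prop) (by fun_prop),
    pd_add (((hdp 0 x).fun_pow 2).fun_add ((hdp 1 x).fun_pow 2)) ((hdp 2 x).fun_pow 2),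
    pd_add ((hdp 0 x).fun_pow 2) ((hdp 1 x).fun_pow 2), pd_sq (hdp 0 x), pd_sq (hdp 1 x), pd_sq (hdp 2 x),
    pd_const, Fin.sum_univ_three]
  ring

lemma pd_lap {w : E 3 → ℝ} (hw : ContDiff ℝ 3 w) (j : Fin 3) (x : E 3) :
    pd j (lap w) x = ∑ i, pd i (pd i (pd j w)) x := by
  have h2 : ContDiff ℝ 2 w := hw.of_le (by norm_num)
  have hd : ∀ i, Differentiable ℝ (pd i (pd i w)) := fun i =>
    ((hw.pd_three i).pd_two i).differentiable (by norm_num)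
  have e : lap w = fun x => pd 0 (pd 0 w) x + pd 1 (pd 1 w) x + pd 2 (pd 2 w) x := by
    funext x; rw [lap_eq h2, Fin.sum_univ_three]
  have hc : ∀ i, pd i (pd i (pd j w)) x = pd j (pd i (pd i w)) x := fun i => by
    rw [show pd i (pd j w) = pd j (pd i w) from funext fun y => pd_comm h2 i j y,
      pd_comm (hw.pd_three i)]
  rw [e, pd_add ((hd 0 x).fun_add (hd 1 x)) (hd 2 x), pd_add (hd 0 x) (hd 1 x), Fin.sum_univ_three,
    hc, hc, hc]

lemma lap_psi {w : E 3 → ℝ} (hw : ContDiff ℝ 3 w) (δ : ℝ) (x : E 3) :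
    lap (psi δ w) x = (∑ i, ∑ j, pd i (pd j w) x ^ 2) + (∑ j, pd j w x * pd j (res w) x)
      + δ / 4 * gsq w x
      - (w x ^ 3 - w x - δ / 4 * w x) * (W' (w x) + res w x) := by
  have h2 : ContDiff ℝ 2 w := hw.of_le (by norm_num)
  have hd : Differentiable ℝ w := hw.differentiable (by norm_num)
  have hdp : ∀ j, Differentiable ℝ (pd j w) := fun j => (hw.pd_three j).differentiable (by norm_num)
  have hdpp : ∀ i j, Differentiable ℝ (pd i (pd j w)) := fun i j =>
    ((hw.pd_three j).pd_two i).differentiable (by norm_num)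
  have hdl : Differentiable ℝ (lap w) := (contDiff_lap hw).differentiable (by norm_num)
  have hres : ∀ j, pd j (lap w) x = pd j (res w) x + (3 * w x ^ 2 - 1) * pd j w x := fun j => by
    have hW : DifferentiableAt ℝ (fun y => W' (w y)) x :=
      (hasDerivAt_W' (w x)).differentiableAt.comp x (hd x)
    have : pd j (res w) x = pd j (lap w) x - (3 * w x ^ 2 - 1) * pd j w x := by
      rw [show res w = fun y => lap w y - W' (w y) from rfl, pd_sub (hdl x) hW,
        pd_comp (hasDerivAt_W' (w x)) (hd x)]
    linarith
  have hres' : ∀ j, ∑ i, pd i (pd i (pd j w)) x = pd j (res w) x + (3 * w x ^ 2 - 1) * pd j w x :=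
    fun j => by rw [← hres, pd_lap hw]
  have hii : ∀ i, pd i (pd i (psi δ w)) x = (∑ j, (pd i (pd j w) x ^ 2 + pd j w x * pd i (pd i (pd j w)) x))
      - ((3 * w x ^ 2 - 1 - δ / 4) * pd i w x ^ 2
        + (w x ^ 3 - w x - δ / 4 * w x) * pd i (pd i w) x) := fun i => by
    have hQ : HasDerivAt (fun t => t ^ 3 - t - δ / 4 * t) (3 * w x ^ 2 - 1 - δ / 4) (w x) := by
      have h1 := (((hasDerivAt_id (w x)).pow 3).sub (hasDerivAt_id (w x))).sub
        ((hasDerivAt_id (w x)).const_mul (δ / 4))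
      refine h1.congr_deriv ?_
      simp
    have hQd : DifferentiableAt ℝ (fun x => (fun t => t ^ 3 - t - δ / 4 * t) (w x)) x :=
      hQ.differentiableAt.comp x (hd x)
    have e : pd i (psi δ w) = fun x => (pd 0 w x * pd i (pd 0 w) x + pd 1 w x * pd i (pd 1 w) x
        + pd 2 w x * pd i (pd 2 w) x) - (fun t => t ^ 3 - t - δ / 4 * t) (w x) * pd i w x := by
      funext y; rw [pd_psi hw, Fin.sum_univ_three]
    have hm : ∀ j, DifferentiableAt ℝ (fun y => pd j w y * pd i (pd j w) y) x := fun j =>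
      (hdp j x).fun_mul (hdpp i j x)
    rw [e, pd_sub (((hm 0).fun_add (hm 1)).fun_add (hm 2)) (hQd.fun_mul (hdp i x)),
      pd_add ((hm 0).fun_add (hm 1)) (hm 2), pd_add (hm 0) (hm 1),
      pd_mul (hdp 0 x) (hdpp i 0 x), pd_mul (hdp 1 x) (hdpp i 1 x), pd_mul (hdp 2 x) (hdpp i 2 x),
      pd_mul hQd (hdp i x), pd_comp hQ (hd x), Fin.sum_univ_three]
    ring
  have hl : pd 0 (pd 0 w) x + pd 1 (pd 1 w) x + pd 2 (pd 2 w) x = W' (w x) + res w x := by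
    have := lap_eq h2 x
    rw [Fin.sum_univ_three] at this
    rw [← this, res]; ring
  rw [lap_eq (contDiff_psi hw δ)]
  have r0 := hres' 0
  have r1 := hres' 1
  have r2 := hres' 2
  simp only [Fin.sum_univ_three] at r0 r1 r2
  simp only [hii, gsq, Fin.sum_univ_three]
  rw [← hl]
  linear_combination pd 0 w x * r0 + pd 1 w x * r1 + pd 2 w x * r2

lemma hessian_cauchy_schwarz (H : Fin 3 → Fin 3 → ℝ) (p g : Fin 3 → ℝ) (q : ℝ)
    (h : ∀ i, g i = (∑ j, p j * H i j) - q * p i) :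
    q ^ 2 * (∑ i, p i ^ 2) + 2 * q * ∑ i, g i * p i ≤ (∑ i, ∑ j, H i j ^ 2) * ∑ i, p i ^ 2 := by
  have h1 : ∀ i, (∑ j, p j * H i j) ^ 2 ≤ (∑ j, p j ^ 2) * ∑ j, H i j ^ 2 := fun i =>
    Finset.sum_mul_sq_le_sq_mul_sq _ _ _
  have h2 : ∀ i, q ^ 2 * p i ^ 2 + 2 * q * (g i * p i) ≤ (∑ j, p j ^ 2) * ∑ j, H i j ^ 2 := fun i => by
    refine le_trans ?_ (h1 i)
    rw [show (∑ j, p j * H i j) = g i + q * p i by rw [h i]; ring]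
    nlinarith [sq_nonneg (g i)]
  calc _ = ∑ i, (q ^ 2 * p i ^ 2 + 2 * q * (g i * p i)) := by
        rw [Finset.sum_add_distrib, Finset.mul_sum, Finset.mul_sum]
    _ ≤ ∑ i, (∑ j, p j ^ 2) * ∑ j, H i j ^ 2 := Finset.sum_le_sum fun i _ => h2 i
    _ = _ := by rw [← Finset.mul_sum]; ring

set_option maxHeartbeats 1000000 in
lemma discrepancy_le {w : E 3 → ℝ} (hw : ContDiff ℝ 3 w) {x₀ : E 3} {L C β δ : ℝ}
    (hC : 1 ≤ C) (hδ : 0 < δ) (hδ1 : δ ≤ 1) (hL : 10000 * C ^ 3 / δ ^ 3 ≤ L)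
    (hβ : β ≤ δ ^ 2 / (640 * C))
    (hb : ∀ x, dist x x₀ ≤ 2 * L → |w x| ≤ C ∧ (∀ i, |pd i w x| ≤ C) ∧ |res w x| ≤ β ∧
      ∀ i, |pd i (res w) x| ≤ β) :
    gsq w x₀ / 2 - W (w x₀) ≤ δ := by
  have h2 : ContDiff ℝ 2 w := hw.of_le (by norm_num)
  have hC0 : 0 < C := by linarith
  have hδ3 : δ ^ 3 ≤ δ := by nlinarith [sq_nonneg δ]
  have hLδ : 10000 * C ^ 3 ≤ L * δ ^ 3 := by rwa [div_le_iff₀ (by positivity)] at hL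
  have hC3 : 1 ≤ C ^ 3 := one_le_pow₀ hC
  have hC2 : 1 ≤ C ^ 2 := one_le_pow₀ hC
  have hL0 : 0 < L := lt_of_lt_of_le (by positivity) hL
  have hβC : C * β ≤ δ ^ 2 / 640 := by
    rw [le_div_iff₀ (by positivity)] at hβ ⊢; nlinarith
  have hβ0 : 0 ≤ β := (abs_nonneg _).trans (hb x₀ (by simp; linarith)).2.2.1
  have hββ : β ≤ δ ^ 2 / 640 := by nlinarith
  have hLL : C ^ 2 / L ^ 2 ≤ δ ^ 2 / 10000 := by
    rw [div_le_div_iff₀ (by positivity) (by positivity)]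
    have h4 : 100 * C ≤ L * δ := by
      have : L * δ ^ 3 ≤ L * δ := mul_le_mul_of_nonneg_left hδ3 hL0.le
      nlinarith [sq_nonneg C]
    nlinarith [mul_self_le_mul_self (by positivity) h4]
  have hCL : C / L ^ 2 ≤ C ^ 2 / L ^ 2 := by gcongr; nlinarith
  have hδ2 : δ ^ 2 ≤ δ := by nlinarith
  have hw1 : ∀ x, dist x x₀ ≤ L → |w x| ≤ 1 + δ / 48 := fun x hx => by
    refine abs_le_one_add_of_res_le h2 hL0 hC0 (by positivity) (β := β)
      (fun y hy => (hb y ?_).1) (fun y hy => (hb y ?_).2.2.1) ?_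
    · linarith [dist_triangle y x x₀]
    · linarith [dist_triangle y x x₀]
    · rw [mul_div_assoc]; linarith
  have hwsq : ∀ x, dist x x₀ ≤ L → w x ^ 2 ≤ 1 + δ / 16 := fun x hx => by
    have := pow_le_pow_left₀ (abs_nonneg _) (hw1 x hx) 2
    rw [sq_abs] at this
    nlinarith
  have hgC : ∀ x, dist x x₀ ≤ L → gsq w x ≤ 3 * C ^ 2 := fun x hx => by
    have h := fun i => pow_le_pow_left₀ (abs_nonneg _) ((hb x (by linarith)).2.1 i) 2
    simp only [sq_abs] at h
    simp only [gsq, Fin.sum_univ_three]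
    linarith [h 0, h 1, h 2]
  suffices h : psi δ w x₀ ≤ 0 by
    unfold psi at h
    nlinarith [sq_nonneg (w x₀)]
  by_contra hcon
  push Not at hcon
  obtain ⟨x, hx, hx1, hx2, hx3⟩ := exists_penalised_max (contDiff_psi hw δ) hL0
    (A := 2 * C ^ 2) (by positivity) (x₀ := x₀) fun x hx => by
      have a1 := hgC x hx.le
      have a2 := hwsq x hx.le
      have a3 := W_nonneg (w x)
      unfold psi at hcon ⊢
      have : 0 ≤ δ * (1 - w x ^ 2 / 8) := mul_nonneg hδ.le (by linarith)
      linarith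
  have hxL : dist x x₀ ≤ L := (mem_ball.1 hx).le
  obtain ⟨-, b2, b3, b4⟩ := hb x (by linarith)
  have bw := hwsq x hxL
  have hψ : 0 < psi δ w x := hcon.trans_le hx1
  set q := w x ^ 3 - w x - δ / 4 * w x with hq
  set P := gsq w x with hP
  have hPδ : δ ≤ P := by
    unfold psi at hψ
    have a3 := W_nonneg (w x)
    have : δ * (1 / 2) ≤ δ * (1 - w x ^ 2 / 8) := mul_le_mul_of_nonneg_left (by linarith) hδ.le
    linarith
  have hP0 : 0 < P := hδ.trans_le hPδ
  have hq5 : |q| ≤ 5 := by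
    have hw2 := abs_le.1 ((hw1 x hxL).trans (by linarith : 1 + δ / 48 ≤ 2))
    have e : q = w x * (w x ^ 2 - 1 - δ / 4) := by rw [hq]; ring
    rw [e, abs_mul]
    have c1 : |w x| ≤ 2 := abs_le.2 hw2
    have c2 : |w x ^ 2 - 1 - δ / 4| ≤ 2 := abs_le.2 ⟨by nlinarith [sq_nonneg (w x)], by linarith⟩
    nlinarith [abs_nonneg (w x), abs_nonneg (w x ^ 2 - 1 - δ / 4)]
  have hgrad : ∀ i, |pd i (psi δ w) x| ≤ 4 * C ^ 2 / L := fun i => by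
    rw [hx2 i, abs_mul, abs_of_nonneg (by positivity)]
    have : |x i - x₀ i| ≤ L := by
      have := abs_coord_le (x - x₀) i
      rw [← dist_eq_norm] at this
      exact (by simpa using this : |x i - x₀ i| ≤ dist x x₀).trans hxL
    calc 2 * (2 * C ^ 2) / L ^ 2 * |x i - x₀ i| ≤ 2 * (2 * C ^ 2) / L ^ 2 * L := by gcongr
      _ = _ := by field_simp; ring
  set S := ∑ i, pd i (psi δ w) x * pd i w x with hS
  have hSb : |S| ≤ 12 * C ^ 3 / L := by
    have : ∀ i, |pd i (psi δ w) x * pd i w x| ≤ 4 * C ^ 2 / L * C := fun i => by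
      rw [abs_mul]; exact mul_le_mul (hgrad i) (b2 i) (abs_nonneg _) (by positivity)
    calc |S| ≤ ∑ i, |pd i (psi δ w) x * pd i w x| := Finset.abs_sum_le_sum_abs _ _
      _ ≤ ∑ _i : Fin 3, 4 * C ^ 2 / L * C := Finset.sum_le_sum fun i _ => this i
      _ = _ := by simp; ring
  set HH := ∑ i, ∑ j, pd i (pd j w) x ^ 2 with hHd
  have hCS : q ^ 2 * P + 2 * q * S ≤ HH * P :=
    hessian_cauchy_schwarz (fun i j => pd i (pd j w) x) (fun i => pd i w x)
      (fun i => pd i (psi δ w) x) q fun i => pd_psi hw δ i x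
  have hSδ : 2 * |q| * |S| ≤ δ ^ 2 / 50 * P := by
    have c1 : 2 * |q| * |S| ≤ 2 * 5 * (12 * C ^ 3 / L) := by gcongr
    have c2 : 2 * 5 * (12 * C ^ 3 / L) ≤ δ ^ 2 / 50 * δ := by
      rw [← mul_div_assoc, div_le_iff₀ hL0]; linarith
    exact c1.trans (c2.trans (mul_le_mul_of_nonneg_left hPδ (by positivity)))
  have hHH : q ^ 2 - δ ^ 2 / 50 ≤ HH := by
    have : -(2 * |q| * |S|) ≤ 2 * q * S := by
      have := neg_abs_le (2 * q * S)
      rwa [abs_mul, abs_mul, abs_two] at this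
    by_contra hlt
    push Not at hlt
    have h5 := mul_lt_mul_of_pos_right hlt hP0
    rw [sub_mul] at h5
    linarith
  have hp : -(δ ^ 2 / 200) ≤ ∑ j, pd j w x * pd j (res w) x := by
    have c : ∀ j, -(δ ^ 2 / 640) ≤ pd j w x * pd j (res w) x := fun j => by
      have h := mul_le_mul (b2 j) (b4 j) (abs_nonneg _) hC0.le
      rw [← abs_mul] at h
      linarith [neg_abs_le (pd j w x * pd j (res w) x)]
    rw [Fin.sum_univ_three]
    linarith [c 0, c 1, c 2, sq_nonneg δ]
  have hqr : q * res w x ≤ δ ^ 2 / 100 := by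
    have h := mul_le_mul hq5 b3 (abs_nonneg _) (by norm_num)
    rw [← abs_mul] at h
    linarith [le_abs_self (q * res w x)]
  have hqW : - (δ ^ 2 / 32) ≤ q ^ 2 - q * W' (w x) := by
    have e : q ^ 2 - q * W' (w x) = - (δ / 4) * (w x ^ 2 * (w x ^ 2 - 1)) + (δ / 4 * w x) ^ 2 := by
      rw [hq, W']; ring
    have : w x ^ 2 * (w x ^ 2 - 1) ≤ δ / 8 := by
      rcases le_total (w x ^ 2) 1 with h | h
      · nlinarith [mul_nonneg (sq_nonneg (w x)) (sub_nonneg.2 h)]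
      · nlinarith
    rw [e]
    nlinarith [sq_nonneg (δ / 4 * w x)]
  have hl := lap_psi hw δ x
  rw [mul_add, ← hq, ← hP, ← hHd] at hl
  have hPP : δ ^ 2 / 4 ≤ δ / 4 * P := by nlinarith
  have hfin : 6 * (2 * C ^ 2) / L ^ 2 ≤ δ ^ 2 / 100 := by
    rw [show 6 * (2 * C ^ 2) / L ^ 2 = 12 * (C ^ 2 / L ^ 2) by ring]; nlinarith
  have hδ20 : 0 < δ ^ 2 := by positivity
  linarith

/-- The radial derivative `x · ∇w`. -/
def rad (w : E 3 → ℝ) (x : E 3) : ℝ := ∑ j, x j * pd j w x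

lemma contDiff_rad {w : E 3 → ℝ} (hw : ContDiff ℝ 2 w) : ContDiff ℝ 1 (rad w) :=
  ContDiff.sum fun j _ => (contDiff_coord j).mul (hw.pd_two j)

lemma pd_rad {w : E 3 → ℝ} (hw : ContDiff ℝ 2 w) (i : Fin 3) (x : E 3) :
    pd i (rad w) x = pd i w x + ∑ j, x j * pd i (pd j w) x := by
  have hdp : ∀ j, DifferentiableAt ℝ (pd j w) x := fun j => (hw.pd_two j).differentiable (by norm_num) x
  have hdc : ∀ j : Fin 3, DifferentiableAt ℝ (fun y : E 3 => y j) x := fun j =>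
    (contDiff_coord (n := 1) j).differentiable (by norm_num) x
  have hm : ∀ j, DifferentiableAt ℝ (fun y : E 3 => y j * pd j w y) x := fun j =>
    (hdc j).fun_mul (hdp j)
  have e : rad w = fun y => y 0 * pd 0 w y + y 1 * pd 1 w y + y 2 * pd 2 w y := by
    funext y; rw [rad, Fin.sum_univ_three]
  rw [e, pd_add ((hm 0).fun_add (hm 1)) (hm 2), pd_add (hm 0) (hm 1), pd_mul (hdc 0) (hdp 0),
    pd_mul (hdc 1) (hdp 1), pd_mul (hdc 2) (hdp 2), pd_coord, pd_coord, pd_coord, Fin.sum_univ_three]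
  fin_cases i <;> simp <;> ring

lemma contDiff_en {w : E 3 → ℝ} (hw : ContDiff ℝ 2 w) : ContDiff ℝ 1 (en w) := by
  have h1 : ContDiff ℝ 1 (gsq w) := ContDiff.sum fun i _ => (hw.pd_two i).pow 2
  exact (h1.div_const 2).add (contDiff_W.comp (hw.of_le (by norm_num)))

lemma pd_en {w : E 3 → ℝ} (hw : ContDiff ℝ 2 w) (i : Fin 3) (x : E 3) :
    pd i (en w) x = (∑ j, pd j w x * pd i (pd j w) x) + W' (w x) * pd i w x := by
  have hd : DifferentiableAt ℝ w x := hw.differentiable (by norm_num) x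
  have hdp : ∀ j, DifferentiableAt ℝ (pd j w) x := fun j => (hw.pd_two j).differentiable (by norm_num) x
  have e : en w = fun y => (pd 0 w y ^ 2 + pd 1 w y ^ 2 + pd 2 w y ^ 2) * (1 / 2) + W (w y) := by
    funext y; simp only [en, gsq, Fin.sum_univ_three]; ring
  have hW : DifferentiableAt ℝ (fun y => W (w y)) x := (hasDerivAt_W (w x)).differentiableAt.comp x hd
  have h0 := (hdp 0).fun_pow 2
  have h1 := (hdp 1).fun_pow 2
  have h2 := (hdp 2).fun_pow 2
  rw [e, pd_add (((h0.fun_add h1).fun_add h2).fun_mul (differentiableAt_const _)) hW,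
    pd_mul ((h0.fun_add h1).fun_add h2) (differentiableAt_const _), pd_add (h0.fun_add h1) h2,
    pd_add h0 h1, pd_sq (hdp 0), pd_sq (hdp 1), pd_sq (hdp 2), pd_const,
    pd_comp (hasDerivAt_W (w x)) hd, Fin.sum_univ_three]
  ring

/-- Divergence of the stress-energy field multiplied by a radial weight. -/
lemma div_stress {w φ : E 3 → ℝ} (hw : ContDiff ℝ 2 w) (x : E 3) (hφ : DifferentiableAt ℝ φ x) {l : ℝ}
    (hl : ∀ i, pd i φ x = l * x i) :
    ∑ i, pd i (fun y => φ y * (rad w y * pd i w y - en w y * y i)) x =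
      l * rad w x ^ 2 - l * ‖x‖ ^ 2 * en w x
        + φ x * (gsq w x - 3 * en w x + rad w x * res w x) := by
  have hdp : ∀ j, DifferentiableAt ℝ (pd j w) x := fun j => (hw.pd_two j).differentiable (by norm_num) x
  have hdc : ∀ j : Fin 3, DifferentiableAt ℝ (fun y : E 3 => y j) x := fun j =>
    (contDiff_coord (n := 1) j).differentiable (by norm_num) x
  have hr : DifferentiableAt ℝ (rad w) x := (contDiff_rad hw).differentiable (by norm_num) x
  have he : DifferentiableAt ℝ (en w) x := (contDiff_en hw).differentiable (by norm_num) x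
  have hi : ∀ i, pd i (fun y => φ y * (rad w y * pd i w y - en w y * y i)) x =
      l * x i * (rad w x * pd i w x - en w x * x i) + φ x * ((pd i w x + ∑ j, x j * pd i (pd j w) x) * pd i w x
        + rad w x * pd i (pd i w) x - (((∑ j, pd j w x * pd i (pd j w) x) + W' (w x) * pd i w x) * x i
          + en w x)) := fun i => by
    rw [pd_mul hφ ((hr.fun_mul (hdp i)).fun_sub (he.fun_mul (hdc i))),
      pd_sub (hr.fun_mul (hdp i)) (he.fun_mul (hdc i)), pd_mul hr (hdp i), pd_mul he (hdc i),
      pd_rad hw, pd_en hw, hl, pd_coord, if_pos rfl]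
    ring
  have hlap : pd 0 (pd 0 w) x + pd 1 (pd 1 w) x + pd 2 (pd 2 w) x = W' (w x) + res w x := by
    have := lap_eq hw x
    rw [Fin.sum_univ_three] at this
    rw [← this, res]; ring
  have s1 := pd_comm hw 1 0 x
  have s2 := pd_comm hw 2 0 x
  have s3 := pd_comm hw 2 1 x
  rw [Fin.sum_univ_three, hi, hi, hi, norm_sq_eq_three]
  have hrr : res w x = pd 0 (pd 0 w) x + pd 1 (pd 1 w) x + pd 2 (pd 2 w) x - W' (w x) := by linarith
  rw [hrr]
  simp only [Fin.sum_univ_three, s1, s2, s3, rad, gsq]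
  ring

/-- Divergence of a weighted multiple of the gradient. -/
lemma div_test {w φ Z : E 3 → ℝ} (hw : ContDiff ℝ 2 w) (x : E 3) (hφ : DifferentiableAt ℝ φ x)
    (hZ : DifferentiableAt ℝ Z x) {l Zw Zt : ℝ} (hl : ∀ i, pd i φ x = l * x i)
    (hZi : ∀ i, pd i Z x = Zw * pd i w x + Zt * x i) :
    ∑ i, pd i (fun y => φ y * (Z y * pd i w y)) x =
      l * rad w x * Z x + φ x * (Zw * gsq w x + Zt * rad w x + Z x * (W' (w x) + res w x)) := by
  have hdp : ∀ j, DifferentiableAt ℝ (pd j w) x := fun j => (hw.pd_two j).differentiable (by norm_num) x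
  have hi : ∀ i, pd i (fun y => φ y * (Z y * pd i w y)) x =
      l * x i * (Z x * pd i w x) + φ x * ((Zw * pd i w x + Zt * x i) * pd i w x + Z x * pd i (pd i w) x) :=
    fun i => by
    rw [pd_mul hφ (hZ.fun_mul (hdp i)), pd_mul hZ (hdp i), hl, hZi]
  have hlap : pd 0 (pd 0 w) x + pd 1 (pd 1 w) x + pd 2 (pd 2 w) x = W' (w x) + res w x := by
    have := lap_eq hw x
    rw [Fin.sum_univ_three] at this
    rw [← this, res]; ring
  rw [Fin.sum_univ_three, hi, hi, hi, ← hlap]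
  simp only [Fin.sum_univ_three, rad, gsq]
  ring

lemma rad_sq_le (w : E 3 → ℝ) (x : E 3) : rad w x ^ 2 ≤ ‖x‖ ^ 2 * gsq w x := by
  rw [EuclideanSpace.norm_sq_eq, rad, gsq]
  simp only [Real.norm_eq_abs, sq_abs]
  exact Finset.sum_mul_sq_le_sq_mul_sq _ _ _

/-- The slowly decaying weight `(a + |x|²)^(-1/100)`. -/
def tau (a : ℝ) (x : E 3) : ℝ := (a + ‖x‖ ^ 2) ^ (-(1 / 100) : ℝ)

lemma tau_pos {a : ℝ} (ha : 0 < a) (x : E 3) : 0 < tau a x := Real.rpow_pos_of_pos (by positivity) _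

lemma tau_pow {a : ℝ} (ha : 0 < a) (x : E 3) : tau a x ^ 100 * (a + ‖x‖ ^ 2) = 1 := by
  have h : 0 < a + ‖x‖ ^ 2 := by positivity
  rw [tau, ← Real.rpow_natCast, ← Real.rpow_mul h.le]
  norm_num
  rw [Real.rpow_neg_one, inv_mul_cancel₀ h.ne']

lemma tau_le {a t : ℝ} (ha : 0 < a) (ht : 0 < t) (hat : 1 ≤ a * t ^ 100) (x : E 3) : tau a x ≤ t := by
  refine le_of_pow_le_pow_left₀ (n := 100) (by norm_num) ht.le ?_
  have h1 := tau_pow ha x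
  have h2 : 0 < tau a x ^ 100 := pow_pos (tau_pos ha x) _
  have h3 : tau a x ^ 100 * a ≤ 1 := by nlinarith [sq_nonneg ‖x‖]
  nlinarith [mul_le_mul_of_nonneg_left h3 (pow_pos ht 100).le, mul_le_mul_of_nonneg_left hat h2.le]

lemma contDiff_tau {n : WithTop ℕ∞} {a : ℝ} (ha : 0 < a) : ContDiff ℝ n (tau a) :=
  ContDiff.rpow_const_of_ne (contDiff_const.add (contDiff_norm_sq ℝ)) fun x => by positivity

lemma pd_tau {a : ℝ} (ha : 0 < a) (i : Fin 3) (x : E 3) :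
    pd i (tau a) x = - (tau a x ^ 101 / 50) * x i := by
  have h : 0 < a + ‖x‖ ^ 2 := by positivity
  have hn : DifferentiableAt ℝ (fun y : E 3 => ‖y‖ ^ 2) x :=
    (contDiff_norm_sq ℝ (n := 1)).differentiable (by norm_num) x
  have h1 := (Real.hasDerivAt_rpow_const (x := a + ‖x‖ ^ 2) (p := -(1 / 100)) (Or.inl h.ne'))
  have h2 := pd_comp (i := i) (f := fun y : E 3 => a + ‖y‖ ^ 2) h1
    ((differentiableAt_const a).fun_add hn)
  rw [pd_add (differentiableAt_const a) hn, pd_const, pd_norm_sq] at h2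
  have e : (a + ‖x‖ ^ 2) ^ (-(1 / 100) - 1 : ℝ) = tau a x ^ 101 := by
    rw [tau, ← Real.rpow_natCast _ 101, ← Real.rpow_mul h.le]; norm_num
  rw [e] at h2
  exact h2.trans (by ring)

/-- The cutoff base `max (1 - |x|²/R²) 0`. -/
def kap (R : ℝ) (x : E 3) : ℝ := max (1 - ‖x‖ ^ 2 / R ^ 2) 0

lemma kap_nonneg (R : ℝ) (x : E 3) : 0 ≤ kap R x := le_max_right _ _

lemma kap_le_one (R : ℝ) (x : E 3) : kap R x ≤ 1 :=
  max_le (by have : 0 ≤ ‖x‖ ^ 2 / R ^ 2 := by positivity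
             linarith) zero_le_one

lemma kap_eq_zero {R : ℝ} (hR : 0 < R) {x : E 3} (hx : R ≤ ‖x‖) : kap R x = 0 := by
  refine max_eq_right ?_
  rw [sub_nonpos, le_div_iff₀ (by positivity), one_mul]
  exact pow_le_pow_left₀ hR.le hx 2

lemma continuous_kap (R : ℝ) : Continuous (kap R) := by unfold kap; fun_prop

lemma contDiff_kap_sq (R : ℝ) : ContDiff ℝ 1 (fun x => kap R x ^ 2) :=
  (contDiff_max_pow 0).comp (contDiff_const.sub ((contDiff_norm_sq ℝ).div_const _))

lemma pd_kap_sq (R : ℝ) (i : Fin 3) (x : E 3) :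
    pd i (fun x => kap R x ^ 2) x = - (4 * kap R x / R ^ 2) * x i := by
  have hn : DifferentiableAt ℝ (fun y : E 3 => ‖y‖ ^ 2) x :=
    (contDiff_norm_sq ℝ (n := 1)).differentiable (by norm_num) x
  have hd : DifferentiableAt ℝ (fun y : E 3 => ‖y‖ ^ 2 / R ^ 2) x := by fun_prop
  have hn' : DifferentiableAt ℝ (fun y : E 3 => 1 - ‖y‖ ^ 2 / R ^ 2) x :=
    (differentiableAt_const _).fun_sub hd
  have h1 := hasDerivAt_max_pow 0 (1 - ‖x‖ ^ 2 / R ^ 2)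
  rw [show (fun x => kap R x ^ 2) = fun y => (fun t : ℝ => max t 0 ^ (0 + 2)) (1 - ‖y‖ ^ 2 / R ^ 2) from rfl,
    pd_comp h1 hn', pd_sub (differentiableAt_const _) hd, pd_const]
  have : (fun y : E 3 => ‖y‖ ^ 2 / R ^ 2) = fun y => (R ^ 2)⁻¹ * ‖y‖ ^ 2 := by
    funext y; ring
  rw [this, pd_const_mul hn, pd_norm_sq, kap]
  simp; ring

lemma hasCompactSupport_kap_sq {R : ℝ} (hR : 0 < R) : HasCompactSupport (fun x => kap R x ^ 2) := by
  refine HasCompactSupport.intro (isCompact_closedBall (0 : E 3) R) fun x hx => ?_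
  rw [mem_closedBall, dist_zero_right, not_le] at hx
  simp [kap_eq_zero hR hx.le]

lemma abs_arctan_le_abs (r : ℝ) : |Real.arctan r| ≤ |r| := by
  have h : ∀ r : ℝ, 0 ≤ r → Real.arctan r ≤ r := fun r hr => by
    have := Real.arctan_nonneg.2 hr
    by_contra hlt
    push Not at hlt
    have h1 := Real.lt_tan (x := Real.arctan r) (by linarith) (Real.arctan_lt_pi_div_two r)
    rw [Real.tan_arctan] at h1
    linarith
  rcases le_total 0 r with hr | hr
  · rw [abs_of_nonneg (Real.arctan_nonneg.2 hr), abs_of_nonneg hr]; exact h r hr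
  · rw [abs_of_nonpos (by simpa using Real.arctan_strictMono.monotone hr), abs_of_nonpos hr,
      ← Real.arctan_neg]
    exact h _ (by linarith)

lemma abs_arctan_le_two (r : ℝ) : |Real.arctan r| ≤ 2 := by
  have := Real.pi_lt_four
  exact abs_le.2 ⟨by linarith [Real.neg_pi_div_two_lt_arctan r],
    by linarith [Real.arctan_lt_pi_div_two r]⟩

lemma arctan_sq_le (r : ℝ) : Real.arctan r ^ 2 ≤ Real.arctan r * r := by
  have h := abs_arctan_le_abs r
  have h2 : 0 ≤ Real.arctan r * r := by
    rcases le_total 0 r with hr | hr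
    · exact mul_nonneg (Real.arctan_nonneg.2 hr) hr
    · exact mul_nonneg_of_nonpos_of_nonpos (by simpa using Real.arctan_strictMono.monotone hr) hr
  rw [← abs_of_nonneg h2, abs_mul, ← sq_abs]
  nlinarith [abs_nonneg (Real.arctan r)]

lemma young_bound {C w τ r d G t e k : ℝ} (hw : |w| ≤ C) (hτ : 0 < τ)
    (ht : |t| ≤ k * |r|) (hd : d ^ 2 ≤ G) (he : e = G / 2 + (τ * r) ^ 2 / 4) (hk : 0 ≤ k) :
    |w * t * τ * d| ≤ 2 * k * C * e := by
  have hC : 0 ≤ C := (abs_nonneg w).trans hw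
  have h1 : |w * t * τ * d| ≤ C * (k * |r|) * τ * |d| := by
    rw [abs_mul, abs_mul, abs_mul, abs_of_pos hτ]
    gcongr
  have h2 : |r| * τ * |d| ≤ 2 * e := by
    have := sq_nonneg (|r| * τ - |d|)
    have e1 : (|r| * τ) ^ 2 = (τ * r) ^ 2 := by rw [mul_pow, sq_abs]; ring
    have e2 : |d| ^ 2 = d ^ 2 := sq_abs d
    nlinarith [sq_nonneg d]
  calc _ ≤ C * (k * |r|) * τ * |d| := h1
    _ = C * k * (|r| * τ * |d|) := by ring
    _ ≤ C * k * (2 * e) := by gcongr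
    _ = _ := by ring

lemma discrepancy_split {τ r w G bad : ℝ} (hτ : 0 < τ) (hτ1 : τ ≤ 1 / 2) (hs : w ^ 2 - 1 = τ * r)
    (hG : 0 ≤ G) (hbad : 0 ≤ bad) (hξ : G / 2 - (τ * r) ^ 2 / 4 ≤ τ ^ 3 + bad) :
    G / 2 - (τ * r) ^ 2 / 4 ≤ 2 * w ^ 2 * (1 / (1 + r ^ 2)) * G + τ * (τ * r) ^ 2 + bad := by
  rcases le_total (r ^ 2) 1 with h | h
  · have h1 : (1 : ℝ) / 2 ≤ 1 / (1 + r ^ 2) := by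
      rw [div_le_div_iff₀ (by norm_num) (by positivity)]; linarith
    have h2 : 1 / 2 ≤ w ^ 2 := by nlinarith [sq_nonneg (r + 1)]
    have h3 : (1 : ℝ) / 2 ≤ 2 * w ^ 2 * (1 / (1 + r ^ 2)) := by nlinarith
    have h4 := mul_le_mul_of_nonneg_right h3 hG
    have h5 : 0 ≤ τ * (τ * r) ^ 2 := by positivity
    nlinarith [sq_nonneg (τ * r)]
  · have h1 : τ ^ 3 ≤ τ * (τ * r) ^ 2 := by
      have : τ ^ 3 * 1 ≤ τ ^ 3 * r ^ 2 := by gcongr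
      nlinarith
    have h2 : 0 ≤ 2 * w ^ 2 * (1 / (1 + r ^ 2)) * G := by positivity
    linarith

set_option maxHeartbeats 1000000 in
lemma pointwise_inequality {C B τ p y D w G h κ Q r A bad e l φ : ℝ} (hC : 1 ≤ C) (hB : B = 1000 * C)
    (hτ : 0 < τ) (hBτ : B * τ ≤ 1 / 4) (hp : 0 < p) (hpτ : p ≤ τ) (hy : 0 ≤ y) (hpy : p ^ 2 * y ≤ 1)
    (hG : 0 ≤ G) (hD : D ^ 2 ≤ y * G) (hw : |w| ≤ C) (hs : w ^ 2 - 1 = τ * r) (hA : |A| ≤ |r|)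
    (hA2 : |A| ≤ 2) (hAr : A ^ 2 ≤ A * r) (hκ : 0 ≤ κ) (hκ1 : κ ≤ 1) (hQ : 0 < Q) (hbad : 0 ≤ bad)
    (hξ : G / 2 - (τ * r) ^ 2 / 4 ≤ τ ^ 3 + bad) (he : e = G / 2 + (τ * r) ^ 2 / 4)
    (hφ : φ = κ ^ 2 * (p ^ 2 - B * (p ^ 2 * τ)))
    (hl : l = κ ^ 2 * (-2 * p ^ 4 + 101 / 50 * B * (p ^ 4 * τ))
      - 4 * κ / Q * (p ^ 2 - B * (p ^ 2 * τ))) :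
    φ * τ * e ≤ (l * D * (w * (τ * A)) + φ * ((τ * A + 2 * w ^ 2 * (1 / (1 + r ^ 2))) * G
        + w * (A - r / (1 + r ^ 2)) * (-(p ^ 2 * τ / 50)) * D + w * (τ * A) * (w ^ 3 - w + h)))
      - (l * D ^ 2 - l * y * e + φ * (G - 3 * e + D * h))
      + (κ ^ 2 * h ^ 2 + φ * bad) + 12 * C * e / Q := by
  set d := p * D with hd
  set N := 1 - B * τ with hN
  set n := 1 - 101 / 100 * B * τ with hn
  set Y := p ^ 2 * y with hY
  set qs := 1 / (1 + r ^ 2) with hqs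
  set U := w * A * τ * d with hU
  set V := w * (A - r / (1 + r ^ 2)) * τ * d with hV
  clear_value d N n Y qs U V
  have hB0 : 0 ≤ B * τ := by rw [hB]; positivity
  have hN1 : N ≤ 1 := by rw [hN]; linarith
  have hN2 : 1 / 2 ≤ N := by rw [hN]; linarith
  have hn1 : n ≤ 1 := by rw [hn]; linarith
  have hn2 : 1 / 2 ≤ n := by rw [hn]; linarith
  have hτ1 : τ ≤ 1 / 2 := by rw [hB] at hBτ; nlinarith
  have hp1 : p ≤ 1 := by linarith
  have hY0 : 0 ≤ Y := by rw [hY]; positivity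
  have he0 : 0 ≤ e := by rw [he]; positivity
  have hdG : d ^ 2 ≤ G := by
    calc d ^ 2 = p ^ 2 * D ^ 2 := by rw [hd]; ring
      _ ≤ p ^ 2 * (y * G) := by gcongr
      _ = Y * G := by rw [hY]; ring
      _ ≤ 1 * G := by gcongr
      _ = G := one_mul G
  have hUb : |U| ≤ 2 * C * e := by
    have := young_bound (k := 1) (t := A) hw hτ (by linarith) hdG he zero_le_one
    rw [hU]; linarith
  have hVb : |V| ≤ 4 * C * e := by
    have hq : |A - r / (1 + r ^ 2)| ≤ 2 * |r| := by
      have h1 : |r / (1 + r ^ 2)| ≤ |r| := by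
        rw [abs_div, abs_of_pos (by positivity : (0 : ℝ) < 1 + r ^ 2)]
        exact div_le_self (abs_nonneg _) (by nlinarith [sq_nonneg r])
      have := abs_sub A (r / (1 + r ^ 2))
      linarith
    have := young_bound (k := 2) hw hτ hq hdG he zero_le_two
    rw [hV]; linarith
  have hsplit := discrepancy_split hτ hτ1 hs hG hbad hξ
  rw [← hqs] at hsplit
  have hφ' : φ = κ ^ 2 * p ^ 2 * N := by rw [hφ, hN]; ring
  have hφ0 : 0 ≤ φ := by rw [hφ']; positivity
  have hκp : φ ≤ κ ^ 2 * p ^ 2 := by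
    rw [hφ']; exact mul_le_of_le_one_right (by positivity) hN1
  have hκp2 : κ ^ 2 * p ^ 2 ≤ 2 * φ := by
    have : κ ^ 2 * p ^ 2 * (1 / 2) ≤ κ ^ 2 * p ^ 2 * N := by gcongr
    linarith
  -- the two divergences in scaled variables
  have e1 : l * D ^ 2 - l * y * e + φ * (G - 3 * e + D * h) =
      -2 * κ ^ 2 * n * p ^ 2 * d ^ 2 - 4 * κ * N * d ^ 2 / Q
      + (2 * (κ ^ 2 * p ^ 2) * n * Y * e + 4 * κ * N * Y * e / Q) + φ * (G - 3 * e) + κ ^ 2 * p * N * d * h := by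
    rw [hl, hφ, hd, hN, hn, hY]; field_simp; ring
  have e2 : l * D * (w * (τ * A)) + φ * ((τ * A + 2 * w ^ 2 * qs) * G
        + w * (A - r / (1 + r ^ 2)) * (-(p ^ 2 * τ / 50)) * D + w * (τ * A) * (w ^ 3 - w + h)) =
      -2 * (κ ^ 2 * p ^ 2) * n * p * U - 4 * κ * p * N * U / Q
      + φ * ((τ * A + 2 * w ^ 2 * qs) * G - p / 50 * V + (w * (τ * A)) * (w * (τ * r) + h)) := by
    rw [← hs, hl, hU, hV, hφ, hd, hN, hn]; field_simp; ring
  rw [e1, e2]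
  have a1 : 2 * (κ ^ 2 * p ^ 2) * n * p * U ≤ φ * (8 * C * τ * e) := by
    calc 2 * (κ ^ 2 * p ^ 2) * n * p * U ≤ 2 * (κ ^ 2 * p ^ 2) * n * p * (2 * C * e) := by
          gcongr; exact (le_abs_self U).trans hUb
      _ ≤ 2 * (2 * φ) * 1 * τ * (2 * C * e) := by gcongr
      _ = _ := by ring
  have a2 : 4 * κ * p * N * U / Q ≤ 8 * C * e / Q := by
    rw [div_le_div_iff_of_pos_right hQ]
    calc 4 * κ * p * N * U ≤ 4 * κ * p * N * (2 * C * e) := by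
          gcongr; exact (le_abs_self U).trans hUb
      _ ≤ 4 * 1 * 1 * 1 * (2 * C * e) := by gcongr
      _ = _ := by ring
  have a3 : -(4 * τ * e) ≤ τ * A * G := by
    have hA3 := (abs_le.1 hA2).1
    have hGe : G ≤ 2 * e := by rw [he]; linarith [sq_nonneg (τ * r)]
    have : τ * (-2) * G ≤ τ * A * G := by gcongr
    linarith [mul_le_mul_of_nonneg_left hGe hτ.le]
  have a4 : p / 50 * V ≤ C * τ * e := by
    calc p / 50 * V ≤ p / 50 * (4 * C * e) := by gcongr; exact (le_abs_self V).trans hVb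
      _ ≤ τ / 50 * (4 * C * e) := by gcongr
      _ ≤ _ := by
        have : 0 ≤ C * τ * e := by positivity
        linarith
  have a5 : -(h ^ 2 / 4) ≤ (w * (τ * A)) * (w * (τ * r) + h) := by
    have h1 : (w * τ) ^ 2 * A ^ 2 ≤ (w * τ) ^ 2 * (A * r) := mul_le_mul_of_nonneg_left hAr (sq_nonneg _)
    have h2 := sq_nonneg (w * τ * A + h / 2)
    linarith
  have a6 : 2 * (κ ^ 2 * p ^ 2) * n * Y * e ≤ 2 * (κ ^ 2 * p ^ 2) * n * e := by
    have : 2 * (κ ^ 2 * p ^ 2) * n * Y * e ≤ 2 * (κ ^ 2 * p ^ 2) * n * 1 * e := by gcongr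
    linarith
  have a7 : 4 * κ * N * Y * e / Q ≤ 4 * C * e / Q := by
    rw [div_le_div_iff_of_pos_right hQ]
    calc 4 * κ * N * Y * e ≤ 4 * 1 * 1 * 1 * e := by gcongr
      _ ≤ 4 * C * e := by linarith [mul_le_mul_of_nonneg_right hC he0]
  have a8 : κ ^ 2 * p * N * d * h ≤ 2 * κ ^ 2 * n * p ^ 2 * d ^ 2 + κ ^ 2 * h ^ 2 / 4 := by
    have h1 : p * N * d * h ≤ p ^ 2 * d ^ 2 + h ^ 2 / 4 := by
      have h2 : |p * d * h| ≤ p ^ 2 * d ^ 2 + h ^ 2 / 4 :=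
        abs_le.2 ⟨by linarith [sq_nonneg (p * d + h / 2)], by linarith [sq_nonneg (p * d - h / 2)]⟩
      calc p * N * d * h = N * (p * d * h) := by ring
        _ ≤ N * |p * d * h| := by gcongr; exact le_abs_self _
        _ ≤ 1 * |p * d * h| := by gcongr
        _ ≤ _ := by linarith
    have h3 : p ^ 2 * d ^ 2 ≤ 2 * n * (p ^ 2 * d ^ 2) := by
      have : 0 ≤ p ^ 2 * d ^ 2 := by positivity
      linarith [mul_le_mul_of_nonneg_right hn2 this]
    have h4 := mul_le_mul_of_nonneg_left (h1.trans (add_le_add_left h3 _)) (sq_nonneg κ)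
    linarith
  have a9 : 0 ≤ 4 * κ * N * d ^ 2 / Q := by positivity
  have a10 : 2 * φ * e - 2 * (κ ^ 2 * p ^ 2) * n * e = κ ^ 2 * p ^ 2 * (2 / 100 * (B * τ)) * e := by
    rw [hφ', hN, hn]; ring
  have a11 : φ * (20 * C * τ * e) ≤ κ ^ 2 * p ^ 2 * (2 / 100 * (B * τ)) * e := by
    calc φ * (20 * C * τ * e) ≤ κ ^ 2 * p ^ 2 * (20 * C * τ * e) := by gcongr
      _ = _ := by rw [hB]; ring
  have a12 := mul_le_mul_of_nonneg_left hsplit hφ0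
  have a13 := mul_le_mul_of_nonneg_left a3 hφ0
  have a14 := mul_le_mul_of_nonneg_left a4 hφ0
  have a15 := mul_le_mul_of_nonneg_left a5 hφ0
  have a16 : φ * h ^ 2 ≤ κ ^ 2 * h ^ 2 := by
    have : φ ≤ κ ^ 2 := hκp.trans (mul_le_of_le_one_right (sq_nonneg κ) (pow_le_one₀ hp.le hp1))
    gcongr
  have a17 : φ * (τ * (τ * r) ^ 2) ≤ φ * (4 * τ * e) := by
    have : (τ * r) ^ 2 ≤ 4 * e := by rw [he]; linarith
    have : τ * (τ * r) ^ 2 ≤ τ * (4 * e) := by gcongr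
    exact mul_le_mul_of_nonneg_left (by linarith) hφ0
  have a18 : 0 ≤ φ * τ * e := by positivity
  have a19 : 0 ≤ κ ^ 2 * h ^ 2 := by positivity
  have a20 : φ * τ * e ≤ φ * (C * τ * e) := by
    have : 0 ≤ φ * (τ * e) := by positivity
    linarith [mul_le_mul_of_nonneg_right hC this]
  have a21 : φ * (G - 3 * e) = φ * (G / 2 - (τ * r) ^ 2 / 4) - 2 * φ * e := by rw [he]; ring
  have a22 : 12 * C * e / Q = 8 * C * e / Q + 4 * C * e / Q := by ring
  rw [a21, a22]
  linarith

lemma FF_mono {f : E 3 → ℝ} (hf : Continuous f) {x y : E 3} {r s : ℝ} (h : dist x y + r ≤ s) :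
    FF f r x ≤ FF f s y :=
  setIntegral_sq_mono hf (ball_subset_ball' (by linarith))

lemma discrepancy_bound {f w : E 3 → ℝ} (hf : Continuous f) (hw : ContDiff ℝ 3 w) {C η₀ τ : ℝ}
    (hC : 12 ≤ C) (hreg : ∀ x, FF f 6 x ≤ η₀ → |w x| ≤ C ∧ (∀ i, |pd i w x| ≤ C) ∧
      res w x ^ 2 ≤ C * FF f 6 x ∧ ∀ i, pd i (res w) x ^ 2 ≤ C * FF f 6 x)
    (hτ : 0 < τ) (hτ1 : τ ≤ 1) (hτη : τ ≤ η₀) {x : E 3} (hx : FF f 6 x ≤ η₀) :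
    gsq w x / 2 - W (w x) ≤ τ ^ 3 + 10 ^ 6 * C ^ 5 * τ⁻¹ ^ 12 * FF f (10 ^ 6 * C ^ 5 * τ⁻¹ ^ 9) x := by
  have hC0 : 0 < C := by linarith
  have hC1 : 1 ≤ C := by linarith
  set L := 10000 * C ^ 3 / (τ ^ 3) ^ 3 with hL
  have hL0 : 0 < L := by positivity
  have hτi : 1 ≤ τ⁻¹ := (one_le_inv₀ hτ).2 hτ1
  have hLK : 2 * L + 7 ≤ 10 ^ 6 * C ^ 5 * τ⁻¹ ^ 9 := by
    have e : L = 10000 * C ^ 3 * τ⁻¹ ^ 9 := by rw [hL]; field_simp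
    have h9 : 1 ≤ τ⁻¹ ^ 9 := one_le_pow₀ hτi
    have h3 : 1 ≤ C ^ 3 := one_le_pow₀ hC1
    have h5 : C ^ 3 ≤ C ^ 5 := pow_le_pow_right₀ hC1 (by norm_num)
    have h6 : (1 : ℝ) ≤ C ^ 3 * τ⁻¹ ^ 9 := one_le_mul_of_one_le_of_one_le h3 h9
    have h7 : C ^ 3 * τ⁻¹ ^ 9 ≤ C ^ 5 * τ⁻¹ ^ 9 := by gcongr
    rw [e]; linarith
  have hmono : FF f (2 * L + 7) x ≤ FF f (10 ^ 6 * C ^ 5 * τ⁻¹ ^ 9) x :=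
    FF_mono hf (by rw [dist_self]; linarith)
  set β := (τ ^ 3) ^ 2 / (640 * C) with hβ
  have hβ0 : 0 < β := by positivity
  have hF0 := FF_nonneg f (2 * L + 7) x
  rcases lt_or_ge (C * FF f (2 * L + 7) x) (β ^ 2) with hlt | hge
  · have hbη : β ^ 2 ≤ C * η₀ := by
      have h1 : β ≤ 1 := by
        rw [hβ, div_le_one (by positivity)]
        have : (τ ^ 3) ^ 2 ≤ 1 := pow_le_one₀ (by positivity) (pow_le_one₀ hτ.le hτ1)
        linarith
      have h2 : β ≤ τ := by
        rw [hβ, div_le_iff₀ (by positivity)]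
        have : (τ ^ 3) ^ 2 ≤ τ := by
          rw [← pow_mul]; exact pow_le_of_le_one hτ.le hτ1 (by norm_num)
        nlinarith
      nlinarith
    have h := discrepancy_le hw (x₀ := x) (L := L) (C := C) (β := β) (δ := τ ^ 3) hC1 (by positivity)
      (pow_le_one₀ hτ.le hτ1) le_rfl le_rfl fun y hy => by
        have h6 : FF f 6 y ≤ FF f (2 * L + 7) x := FF_mono hf (by linarith)
        have h7 : C * FF f 6 y ≤ β ^ 2 := (mul_le_mul_of_nonneg_left h6 hC0.le).trans hlt.le
        have h8 : FF f 6 y ≤ η₀ := by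
          by_contra hcon
          push Not at hcon
          have := mul_lt_mul_of_pos_left hcon hC0
          linarith
        obtain ⟨a1, a2, a3, a4⟩ := hreg y h8
        exact ⟨a1, a2, abs_le_of_sq_le_sq (a3.trans h7) hβ0.le,
          fun i => abs_le_of_sq_le_sq ((a4 i).trans h7) hβ0.le⟩
    have : 0 ≤ 10 ^ 6 * C ^ 5 * τ⁻¹ ^ 12 * FF f (10 ^ 6 * C ^ 5 * τ⁻¹ ^ 9) x :=
      mul_nonneg (by positivity) (FF_nonneg _ _ _)
    linarith
  · obtain ⟨-, a2, -, -⟩ := hreg x hx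
    have hg : gsq w x ≤ 3 * C ^ 2 := by
      have h := fun i => pow_le_pow_left₀ (abs_nonneg _) (a2 i) 2
      simp only [sq_abs] at h
      simp only [gsq, Fin.sum_univ_three]
      linarith [h 0, h 1, h 2]
    have hW := W_nonneg (w x)
    have e : 3 / 2 * C ^ 2 = 614400 * C ^ 4 * τ⁻¹ ^ 12 * β ^ 2 := by rw [hβ]; field_simp; norm_num
    have h1 : 614400 * C ^ 4 * τ⁻¹ ^ 12 * β ^ 2 ≤ 614400 * C ^ 4 * τ⁻¹ ^ 12 * (C * FF f (2 * L + 7) x) := by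
      gcongr
    have h2 : 614400 * C ^ 4 * τ⁻¹ ^ 12 * (C * FF f (2 * L + 7) x) ≤
        10 ^ 6 * C ^ 5 * τ⁻¹ ^ 12 * FF f (10 ^ 6 * C ^ 5 * τ⁻¹ ^ 9) x := by
      have : 614400 * C ^ 5 * τ⁻¹ ^ 12 * FF f (2 * L + 7) x ≤
        10 ^ 6 * C ^ 5 * τ⁻¹ ^ 12 * FF f (10 ^ 6 * C ^ 5 * τ⁻¹ ^ 9) x := by gcongr; norm_num
      calc _ = 614400 * C ^ 5 * τ⁻¹ ^ 12 * FF f (2 * L + 7) x := by ring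
        _ ≤ _ := this
    have h3 : 0 ≤ τ ^ 3 := by positivity
    linarith

/-- A weighted Fubini estimate for integrals over balls of varying radius. -/
lemma integral_variable_ball {f g ρ : E 3 → ℝ} (hf : Continuous f) (hfs : HasCompactSupport f)
    (hg : Continuous g) (hgs : HasCompactSupport g) (hρ : Continuous ρ) {K r : ℝ}
    (hK : ∀ y, ∫ x, {x | dist y x < ρ x}.indicator g x ≤ K)
    (hr : ∀ y x, g x ≠ 0 → dist y x < ρ x → y ∈ ball (0 : E 3) r) :
    Integrable (fun x => g x * FF f (ρ x) x) ∧ ∫ x, g x * FF f (ρ x) x ≤ K * FF f r 0 := by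
  have hf2 : Integrable (fun y => f y ^ 2) := (hf.pow 2).integrable_of_hasCompactSupport
    (by simpa [sq] using hfs.mul_left (f := f))
  have hgi : Integrable g := hg.integrable_of_hasCompactSupport hgs
  set U : Set (E 3 × E 3) := {z | dist z.2 z.1 < ρ z.1} with hU
  have hUo : IsOpen U := isOpen_lt (by fun_prop) (by fun_prop)
  have hF : Integrable (U.indicator fun z : E 3 × E 3 => g z.1 * f z.2 ^ 2) (volume.prod volume) :=
    (hgi.mul_prod hf2).indicator hUo.measurableSet
  have e1 : ∀ x, ∫ y, U.indicator (fun z : E 3 × E 3 => g z.1 * f z.2 ^ 2) (x, y) = g x * FF f (ρ x) x := by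
    intro x
    rw [FF, ← integral_const_mul, ← integral_indicator measurableSet_ball]
    refine integral_congr_ae (Eventually.of_forall fun y => ?_)
    by_cases h : dist y x < ρ x <;> simp [indicator, hU, h]
  have e2 : ∀ y, ∫ x, U.indicator (fun z : E 3 × E 3 => g z.1 * f z.2 ^ 2) (x, y) =
      (∫ x, {x | dist y x < ρ x}.indicator g x) * f y ^ 2 := by
    intro y
    rw [← integral_mul_const]
    refine integral_congr_ae (Eventually.of_forall fun x => ?_)
    by_cases h : dist y x < ρ x <;> simp [indicator, hU, h]
  have hi : Integrable (fun x => g x * FF f (ρ x) x) := by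
    have := hF.integral_prod_left
    simpa only [e1] using this
  refine ⟨hi, ?_⟩
  calc ∫ x, g x * FF f (ρ x) x
      = ∫ x, ∫ y, U.indicator (fun z : E 3 × E 3 => g z.1 * f z.2 ^ 2) (x, y) := by simp only [e1]
    _ = ∫ y, ∫ x, U.indicator (fun z : E 3 × E 3 => g z.1 * f z.2 ^ 2) (x, y) :=
        integral_integral_swap (f := fun x y => U.indicator (fun z : E 3 × E 3 => g z.1 * f z.2 ^ 2) (x, y)) hF
    _ = ∫ y, (∫ x, {x | dist y x < ρ x}.indicator g x) * f y ^ 2 := by simp only [e2]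
    _ ≤ ∫ y, (ball (0 : E 3) r).indicator (fun y => K * f y ^ 2) y := by
        refine integral_mono ?_ ((hf2.const_mul K).indicator measurableSet_ball) fun y => ?_
        · have := hF.integral_prod_right
          simpa only [e2] using this
        · by_cases hy : y ∈ ball (0 : E 3) r
          · rw [indicator_of_mem hy]
            exact mul_le_mul_of_nonneg_right (hK y) (sq_nonneg _)
          · rw [indicator_of_notMem hy]
            have : ∀ x, {x | dist y x < ρ x}.indicator g x = 0 := fun x => by
              by_cases h : dist y x < ρ x
              · by_cases hgx : g x = 0
                · simp [indicator, hgx]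
                · exact absurd (hr y x hgx h) hy
              · simp [indicator, h]
            simp [this]
    _ = K * FF f r 0 := by
        rw [integral_indicator measurableSet_ball, integral_const_mul, FF]

/-- The radial weight multiplying the stress tensor. -/
def wt (B a R : ℝ) (x : E 3) : ℝ := kap R x ^ 2 * (tau a x ^ 100 - B * (tau a x ^ 100 * tau a x))

lemma contDiff_wt (B R : ℝ) {a : ℝ} (ha : 0 < a) : ContDiff ℝ 1 (wt B a R) :=
  (contDiff_kap_sq R).mul (((contDiff_tau ha).pow 100).sub
    (contDiff_const.mul (((contDiff_tau ha).pow 100).mul (contDiff_tau ha))))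

lemma hasCompactSupport_wt (B a : ℝ) {R : ℝ} (hR : 0 < R) : HasCompactSupport (wt B a R) :=
  (hasCompactSupport_kap_sq hR).mul_right

lemma pd_wt (B R : ℝ) {a : ℝ} (ha : 0 < a) (i : Fin 3) (x : E 3) :
    pd i (wt B a R) x = (kap R x ^ 2 * (-2 * (tau a x ^ 50) ^ 4 + 101 / 50 * B * ((tau a x ^ 50) ^ 4 * tau a x))
      - 4 * kap R x / R ^ 2 * ((tau a x ^ 50) ^ 2 - B * ((tau a x ^ 50) ^ 2 * tau a x))) * x i := by
  have ht : DifferentiableAt ℝ (tau a) x := (contDiff_tau (n := 1) ha).differentiable (by norm_num) x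
  have hk : DifferentiableAt ℝ (fun x => kap R x ^ 2) x := (contDiff_kap_sq R).differentiable (by norm_num) x
  have h1 : pd i (fun x => tau a x ^ 100 - B * (tau a x ^ 100 * tau a x)) x =
      (100 * tau a x ^ 99 - B * (101 * tau a x ^ 100)) * pd i (tau a) x := by
    refine pd_comp (g := fun t => t ^ 100 - B * (t ^ 100 * t)) ?_ ht
    have a1 : HasDerivAt (fun t : ℝ => t ^ 100) (100 * tau a x ^ 99) (tau a x) := by
      simpa using hasDerivAt_pow 100 (tau a x)
    have a2 : HasDerivAt (fun t : ℝ => t ^ 100 * t) (101 * tau a x ^ 100) (tau a x) := by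
      refine (a1.mul (hasDerivAt_id _)).congr_deriv ?_
      simp only [id]; ring
    exact a1.sub (a2.const_mul B)
  have h2 : pd i (wt B a R) x = pd i (fun x => kap R x ^ 2 *
    (tau a x ^ 100 - B * (tau a x ^ 100 * tau a x))) x := rfl
  rw [h2, pd_mul hk ((ht.fun_pow 100).fun_sub (((ht.fun_pow 100).fun_mul ht).const_mul B)), h1, pd_kap_sq, pd_tau ha]
  ring

/-- The test function of the phase-field equation. -/
def tst (a : ℝ) (w : E 3 → ℝ) (x : E 3) : ℝ :=
  w x * (tau a x * Real.arctan ((w x ^ 2 - 1) / tau a x))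

lemma contDiff_tst {a : ℝ} (ha : 0 < a) {w : E 3 → ℝ} (hw : ContDiff ℝ 1 w) :
    ContDiff ℝ 1 (tst a w) :=
  hw.mul ((contDiff_tau ha).mul (Real.contDiff_arctan.comp
    (((hw.pow 2).sub contDiff_const).div (contDiff_tau ha) fun x => (tau_pos ha x).ne')))

lemma pd_tst {a : ℝ} (ha : 0 < a) {w : E 3 → ℝ} (hw : ContDiff ℝ 1 w) (i : Fin 3) (x : E 3) {r : ℝ}
    (hr : r = (w x ^ 2 - 1) / tau a x) :
    pd i (tst a w) x = (tau a x * Real.arctan r + 2 * w x ^ 2 * (1 / (1 + r ^ 2))) * pd i w x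
      + w x * (Real.arctan r - r / (1 + r ^ 2)) * (-((tau a x ^ 50) ^ 2 * tau a x / 50)) * x i := by
  have ht0 := tau_pos ha x
  have ht : DifferentiableAt ℝ (tau a) x := (contDiff_tau (n := 1) ha).differentiable (by norm_num) x
  have hw' : DifferentiableAt ℝ w x := hw.differentiable (by norm_num) x
  have hinv : DifferentiableAt ℝ (fun y => (tau a y)⁻¹) x := ht.fun_inv ht0.ne'
  have hs : DifferentiableAt ℝ (fun y => w y ^ 2 - 1) x := (hw'.fun_pow 2).sub_const 1
  have hq : DifferentiableAt ℝ (fun y => (w y ^ 2 - 1) * (tau a y)⁻¹) x := hs.fun_mul hinv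
  have h1 : pd i (fun y => (w y ^ 2 - 1) * (tau a y)⁻¹) x =
      2 * w x * pd i w x * (tau a x)⁻¹ + (w x ^ 2 - 1) * (-(tau a x ^ 2)⁻¹ * pd i (tau a) x) := by
    rw [pd_mul hs hinv, pd_sub (hw'.fun_pow 2) (by fun_prop), pd_const, pd_sq hw', sub_zero,
      pd_comp (g := fun t => t⁻¹) (hasDerivAt_inv ht0.ne') ht]
  have hr' : (w x ^ 2 - 1) * (tau a x)⁻¹ = r := by rw [hr]; rfl
  have h2 : pd i (fun y => Real.arctan ((w y ^ 2 - 1) * (tau a y)⁻¹)) x = 1 / (1 + r ^ 2) *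
      pd i (fun y => (w y ^ 2 - 1) * (tau a y)⁻¹) x := by
    refine pd_comp (g := Real.arctan) ?_ hq
    rw [hr']; exact Real.hasDerivAt_arctan r
  have hat : DifferentiableAt ℝ (fun y => Real.arctan ((w y ^ 2 - 1) * (tau a y)⁻¹)) x :=
    hq.arctan
  have h3 : pd i (tst a w) x = pd i (fun y => w y * (tau a y * Real.arctan ((w y ^ 2 - 1) * (tau a y)⁻¹))) x := rfl
  have hwr : w x ^ 2 - 1 = r * tau a x := by rw [hr]; field_simp
  rw [h3, pd_mul hw' (ht.fun_mul hat), pd_mul ht hat, h2, h1, pd_tau ha, hr', hwr]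
  have : 1 + r ^ 2 ≠ 0 := by positivity
  field_simp
  ring

lemma weighted_energy_le {f w : E 3 → ℝ} (hf : Continuous f) (hw : ContDiff ℝ 3 w)
    {C η₀ a R : ℝ} (hC : 12 ≤ C)
    (hreg : ∀ x, FF f 6 x ≤ η₀ → |w x| ≤ C ∧ (∀ i, |pd i w x| ≤ C) ∧
      res w x ^ 2 ≤ C * FF f 6 x ∧ ∀ i, pd i (res w) x ^ 2 ≤ C * FF f 6 x)
    (ha : 0 < a) (hτ1 : ∀ x, tau a x ≤ 1) (hτη : ∀ x, tau a x ≤ η₀)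
    (hτB : ∀ x, 1000 * C * tau a x ≤ 1 / 4) (hR : 0 < R) (hFR : FF f (R + 6) 0 ≤ η₀)
    (hbad : Integrable fun x => wt (1000 * C) a R x * (10 ^ 6 * C ^ 5 * (tau a x)⁻¹ ^ 12 *
      FF f (10 ^ 6 * C ^ 5 * (tau a x)⁻¹ ^ 9) x)) :
    ∫ x, wt (1000 * C) a R x * tau a x * en w x ≤
      (∫ x, kap R x ^ 2 * res w x ^ 2) +
      (∫ x, wt (1000 * C) a R x * (10 ^ 6 * C ^ 5 * (tau a x)⁻¹ ^ 12 *
        FF f (10 ^ 6 * C ^ 5 * (tau a x)⁻¹ ^ 9) x)) +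
      12 * C / R ^ 2 * ∫ x in ball (0 : E 3) R, en w x := by
  have hw2 : ContDiff ℝ 2 w := hw.of_le (by norm_num)
  have hw1 : ContDiff ℝ 1 w := hw.of_le (by norm_num)
  set B := 1000 * C with hB
  set bad : E 3 → ℝ := fun x => 10 ^ 6 * C ^ 5 * (tau a x)⁻¹ ^ 12 *
      FF f (10 ^ 6 * C ^ 5 * (tau a x)⁻¹ ^ 9) x with hbad'
  set T : Fin 3 → E 3 → ℝ := fun i y => wt B a R y * (tst a w y * pd i w y) with hT
  set S : Fin 3 → E 3 → ℝ := fun i y => wt B a R y * (rad w y * pd i w y - en w y * y i) with hS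
  have hTc : ∀ i, ContDiff ℝ 1 (T i) := fun i =>
    (contDiff_wt B R ha).mul ((contDiff_tst ha hw1).mul (hw2.pd_two i))
  have hSc : ∀ i, ContDiff ℝ 1 (S i) := fun i =>
    (contDiff_wt B R ha).mul (((contDiff_rad hw2).mul (hw2.pd_two i)).sub
      ((contDiff_en hw2).mul (contDiff_coord i)))
  have hTs : ∀ i, HasCompactSupport (T i) := fun i => (hasCompactSupport_wt B a hR).mul_right
  have hSs : ∀ i, HasCompactSupport (S i) := fun i => (hasCompactSupport_wt B a hR).mul_right
  have hTi : ∀ i, Integrable (pd i (T i)) := fun i =>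
    ((hTc i).pd_one i).integrable_of_hasCompactSupport ((hTs i).pd i)
  have hSi : ∀ i, Integrable (pd i (S i)) := fun i =>
    ((hSc i).pd_one i).integrable_of_hasCompactSupport ((hSs i).pd i)
  have hTI : Integrable fun x => ∑ i, pd i (T i) x := integrable_finsetSum _ fun i _ => hTi i
  have hSI : Integrable fun x => ∑ i, pd i (S i) x := integrable_finsetSum _ fun i _ => hSi i
  have hT0 : ∫ x, ∑ i, pd i (T i) x = 0 := by
    rw [integral_finsetSum _ fun i _ => hTi i]
    exact Finset.sum_eq_zero fun i _ => integral_pd_eq_zero (hTc i) (hTs i)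
  have hS0 : ∫ x, ∑ i, pd i (S i) x = 0 := by
    rw [integral_finsetSum _ fun i _ => hSi i]
    exact Finset.sum_eq_zero fun i _ => integral_pd_eq_zero (hSc i) (hSs i)
  have hLI : Integrable fun x => wt B a R x * tau a x * en w x := by
    refine Continuous.integrable_of_hasCompactSupport ?_
      ((hasCompactSupport_wt B a hR).mul_right.mul_right)
    exact ((contDiff_wt B R ha).continuous.mul (contDiff_tau (n := 1) ha).continuous).mul
      (continuous_en hw1)
  have hHI : Integrable fun x => kap R x ^ 2 * res w x ^ 2 := by
    refine Continuous.integrable_of_hasCompactSupport ?_ (hasCompactSupport_kap_sq hR).mul_right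
    exact ((continuous_kap R).pow 2).mul ((continuous_res hw2).pow 2)
  have hEI : Integrable ((ball (0 : E 3) R).indicator (en w)) :=
    ((continuous_en hw1).integrableOn_ball 0 R).integrable_indicator measurableSet_ball
  have hpt : ∀ x, wt B a R x * tau a x * en w x ≤ ∑ i, pd i (T i) x - ∑ i, pd i (S i) x +
      (kap R x ^ 2 * res w x ^ 2 + wt B a R x * bad x) +
      12 * C / R ^ 2 * (ball (0 : E 3) R).indicator (en w) x := by
    intro x
    have hwd : DifferentiableAt ℝ (wt B a R) x := (contDiff_wt B R ha).differentiable (by norm_num) x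
    have hzd : DifferentiableAt ℝ (tst a w) x := (contDiff_tst ha hw1).differentiable (by norm_num) x
    have eT := div_test hw2 x hwd hzd (fun i => pd_wt B R ha i x) (fun i => pd_tst ha hw1 i x rfl)
    have eS := div_stress hw2 x hwd (fun i => pd_wt B R ha i x)
    simp only [hT, hS]
    rw [eT, eS]
    by_cases hx : x ∈ ball (0 : E 3) R
    · rw [indicator_of_mem hx]
      have hx6 : FF f 6 x ≤ η₀ := (FF_mono hf (by
        rw [mem_ball] at hx; linarith)).trans hFR
      obtain ⟨h1, -, -, -⟩ := hreg x hx6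
      have ht := tau_pos ha x
      have hp := tau_pow ha x
      have hd := discrepancy_bound hf hw hC hreg ht (hτ1 x) (hτη x) hx6
      have hs : w x ^ 2 - 1 = tau a x * ((w x ^ 2 - 1) / tau a x) := by field_simp
      have hW : (tau a x * ((w x ^ 2 - 1) / tau a x)) ^ 2 / 4 = W (w x) := by rw [← hs, W]
      have hpy : (tau a x ^ 50) ^ 2 * ‖x‖ ^ 2 ≤ 1 := by
        have h0 : 0 ≤ tau a x ^ 100 * a := by positivity
        have e0 : (tau a x ^ 50) ^ 2 * ‖x‖ ^ 2 = tau a x ^ 100 * (a + ‖x‖ ^ 2) - tau a x ^ 100 * a := by ring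
        linarith
      have hpi := pointwise_inequality (C := C) (B := B) (τ := tau a x) (p := tau a x ^ 50)
        (y := ‖x‖ ^ 2) (D := rad w x) (w := w x) (G := gsq w x) (h := res w x) (κ := kap R x)
        (Q := R ^ 2) (r := (w x ^ 2 - 1) / tau a x)
        (A := Real.arctan ((w x ^ 2 - 1) / tau a x)) (bad := bad x) (e := en w x)
        (φ := wt B a R x)
        (by linarith) hB ht (hτB x) (by positivity) (pow_le_of_le_one ht.le (hτ1 x) (by norm_num))
        (by positivity) hpy (gsq_nonneg w x) (rad_sq_le w x) h1 hs (abs_arctan_le_abs _)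
        (abs_arctan_le_two _) (arctan_sq_le _) (kap_nonneg R x) (kap_le_one R x) (by positivity)
        (mul_nonneg (by positivity) (FF_nonneg _ _ _)) (by rw [hW]; exact hd) (by rw [hW]; rfl)
        (by rw [← pow_mul]; rfl) rfl
      refine hpi.trans (le_of_eq ?_)
      simp only [tst, W']
      ring
    · rw [indicator_of_notMem hx]
      have hk : kap R x = 0 := kap_eq_zero hR (by simpa using hx)
      have hw0 : wt B a R x = 0 := by simp [wt, hk]
      rw [hw0, hk]
      simp
  have hI1 : Integrable fun x => ∑ i, pd i (T i) x - ∑ i, pd i (S i) x := hTI.sub hSI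
  have hI2 : Integrable fun x => kap R x ^ 2 * res w x ^ 2 + wt B a R x * bad x := hHI.add hbad
  have hI3 : Integrable fun x => ∑ i, pd i (T i) x - ∑ i, pd i (S i) x +
      (kap R x ^ 2 * res w x ^ 2 + wt B a R x * bad x) := hI1.add hI2
  have hI4 : Integrable fun x => 12 * C / R ^ 2 * (ball (0 : E 3) R).indicator (en w) x :=
    hEI.const_mul _
  refine (integral_mono hLI (hI3.add hI4) hpt).trans (le_of_eq ?_)
  have e1 := integral_add hI3 hI4
  have e2 := integral_add hI1 hI2
  have e3 := integral_sub hTI hSI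
  have e4 := integral_add hHI hbad
  simp only [Pi.add_apply]
  rw [e1, e2, e3, e4, hT0, hS0, integral_const_mul, integral_indicator measurableSet_ball]
  ring

/-- The slowly growing radius `(a + |x|²)^(1/4)`. -/
def sg (a : ℝ) (x : E 3) : ℝ := (tau a x)⁻¹ ^ 25

lemma sg_pos {a : ℝ} (ha : 0 < a) (x : E 3) : 0 < sg a x := pow_pos (inv_pos.2 (tau_pos ha x)) _

lemma sg_pow {a : ℝ} (ha : 0 < a) (x : E 3) : (sg a x ^ 2) ^ 2 = a + ‖x‖ ^ 2 := by
  have h := tau_pow ha x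
  have ht := tau_pos ha x
  have e : (sg a x ^ 2) ^ 2 = (tau a x ^ 100)⁻¹ := by rw [sg]; simp only [inv_pow]; ring
  rw [e]
  exact inv_eq_of_mul_eq_one_right h

lemma sg_sq_le {a : ℝ} (ha : 0 < a) (x y : E 3) : sg a x ^ 2 ≤ sg a y ^ 2 + dist x y := by
  have hx := sg_pow ha x
  have hy := sg_pow ha y
  have hn : ‖x‖ ≤ ‖y‖ + dist x y := by
    rw [dist_eq_norm]; have := norm_add_le y (x - y); simpa using this
  have hd := dist_nonneg (x := x) (y := y)
  have h1 : ‖y‖ ≤ sg a y ^ 2 := abs_le_of_sq_le_sq' (by linarith) (by positivity) |>.2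
  refine abs_le_of_sq_le_sq' ?_ (by positivity) |>.2
  rw [hx]
  have h2 : ‖x‖ ^ 2 ≤ (‖y‖ + dist x y) ^ 2 := pow_le_pow_left₀ (norm_nonneg _) hn 2
  have h3 := mul_le_mul_of_nonneg_right h1 hd
  nlinarith

lemma sg_comparable {a : ℝ} (ha : 0 < a) (h2 : ∀ x, 2 ≤ sg a x) {x y : E 3}
    (h : dist y x < sg a x) : sg a x ≤ 2 * sg a y := by
  have h1 := sg_sq_le ha x y
  rw [dist_comm] at h1
  have hx := h2 x
  have hy := h2 y
  refine abs_le_of_sq_le_sq' ?_ (by positivity) |>.2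
  nlinarith [mul_le_mul_of_nonneg_right hx (by linarith : 0 ≤ sg a x)]

lemma integral_indicator_le {a : ℝ} (ha : 0 < a) (h2 : ∀ x, 2 ≤ sg a x) {g ρ : E 3 → ℝ}
    (hg0 : ∀ x, 0 ≤ g x) (hg : ∀ x, g x ≤ (sg a x)⁻¹ ^ 3) (hρ : ∀ x, ρ x ≤ sg a x) (y : E 3) :
    ∫ x, {x | dist y x < ρ x}.indicator g x ≤ 64 * (volume : Measure (E 3)).real (ball 0 1) := by
  have hy := sg_pos ha y
  have hV : (volume : Measure (E 3)).real (ball y (2 * sg a y)) =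
      (2 * sg a y) ^ 3 * (volume : Measure (E 3)).real (ball 0 1) := by
    rw [Measure.real, Measure.addHaar_ball volume y (by positivity)]
    simp [Measure.real, ENNReal.toReal_ofReal (by positivity : 0 ≤ (2 * sg a y) ^ 3)]
  have hle : ∀ x, {x | dist y x < ρ x}.indicator g x ≤
      (ball y (2 * sg a y)).indicator (fun _ => 8 * (sg a y)⁻¹ ^ 3) x := by
    intro x
    by_cases hx : dist y x < ρ x
    · rw [indicator_of_mem (show x ∈ {x | dist y x < ρ x} from hx)]
      have hx' : dist y x < sg a x := hx.trans_le (hρ x)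
      have hc := sg_comparable ha h2 hx'
      have hxp := sg_pos ha x
      rw [indicator_of_mem (show x ∈ ball y (2 * sg a y) by rw [mem_ball, dist_comm]; linarith)]
      have hc' : sg a y ≤ 2 * sg a x := by
        have h1 := sg_sq_le ha y x
        have := h2 x
        refine abs_le_of_sq_le_sq' ?_ (by positivity) |>.2
        nlinarith
      have hi : (sg a x)⁻¹ ≤ 2 * (sg a y)⁻¹ := by
        rw [inv_eq_one_div, inv_eq_one_div, mul_one_div, div_le_div_iff₀ hxp hy]; linarith
      calc g x ≤ (sg a x)⁻¹ ^ 3 := hg x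
        _ ≤ (2 * (sg a y)⁻¹) ^ 3 := pow_le_pow_left₀ (by positivity) hi 3
        _ = 8 * (sg a y)⁻¹ ^ 3 := by ring
    · rw [indicator_of_notMem (show x ∉ {x | dist y x < ρ x} from hx)]
      exact indicator_nonneg (fun _ _ => by positivity) _
  refine (integral_mono_of_nonneg (.of_forall fun x => indicator_nonneg (fun z _ => hg0 z) _)
    ((integrable_indicator_iff measurableSet_ball).2 (continuous_const.integrableOn_ball y _))
    (.of_forall hle)).trans (le_of_eq ?_)
  rw [integral_indicator measurableSet_ball, setIntegral_const, hV, smul_eq_mul]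
  field_simp
  ring

lemma integral_bad_le {f : E 3 → ℝ} (hf : Continuous f) (hfs : HasCompactSupport f) {C a R : ℝ}
    (hC : 12 ≤ C) (ha : 0 < a) (hτ2 : ∀ x, tau a x ≤ 1 / 2)
    (hτB : ∀ x, 1000 * C * tau a x ≤ 1 / 4) (hτK : ∀ x, 10 ^ 6 * C ^ 5 * tau a x ≤ 1)
    (hR : 0 < R) (haR : a + R ^ 2 ≤ R ^ 4) :
    Integrable (fun x => wt (1000 * C) a R x * (10 ^ 6 * C ^ 5 * (tau a x)⁻¹ ^ 12 *
      FF f (10 ^ 6 * C ^ 5 * (tau a x)⁻¹ ^ 9) x)) ∧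
    ∫ x, wt (1000 * C) a R x * (10 ^ 6 * C ^ 5 * (tau a x)⁻¹ ^ 12 *
      FF f (10 ^ 6 * C ^ 5 * (tau a x)⁻¹ ^ 9) x) ≤
      64 * (volume : Measure (E 3)).real (ball 0 1) * FF f (2 * R) 0 := by
  set K := 10 ^ 6 * C ^ 5 with hK
  have hK0 : 0 < K := by rw [hK]; positivity
  clear_value K
  have htc : Continuous (tau a) := (contDiff_tau (n := 1) ha).continuous
  have htp := tau_pos ha
  have hic : Continuous fun x => (tau a x)⁻¹ := htc.inv₀ fun x => (htp x).ne'
  have hi2 : ∀ x, 2 ≤ (tau a x)⁻¹ := fun x => by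
    rw [le_inv_comm₀ (by norm_num) (htp x)]; simpa using hτ2 x
  have hs2 : ∀ x, 2 ≤ sg a x := fun x => by
    have h1 : (1 : ℝ) ≤ (tau a x)⁻¹ := by linarith [hi2 x]
    have h2 : (tau a x)⁻¹ ≤ (tau a x)⁻¹ ^ 25 := le_self_pow₀ h1 (by norm_num)
    rw [sg]; linarith [hi2 x]
  have hKi : ∀ x, K ≤ (tau a x)⁻¹ := fun x => by
    rw [le_inv_comm₀ hK0 (htp x), inv_eq_one_div, le_div_iff₀ hK0]; linarith [hτK x]
  have hg0 : ∀ x, 0 ≤ wt (1000 * C) a R x * (K * (tau a x)⁻¹ ^ 12) := by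
    intro x
    have ht := htp x
    have h1 : 0 ≤ tau a x ^ 100 - 1000 * C * (tau a x ^ 100 * tau a x) := by
      have := mul_le_mul_of_nonneg_left (hτB x) (pow_pos ht 100).le
      linarith [pow_pos ht 100]
    have h2 : 0 ≤ wt (1000 * C) a R x := mul_nonneg (sq_nonneg _) h1
    positivity
  have hg1 : ∀ x, wt (1000 * C) a R x * (K * (tau a x)⁻¹ ^ 12) ≤ (sg a x)⁻¹ ^ 3 := by
    intro x
    have ht := htp x
    have h1 : wt (1000 * C) a R x ≤ tau a x ^ 100 := by
      have h2 : kap R x ^ 2 ≤ 1 := pow_le_one₀ (kap_nonneg R x) (kap_le_one R x)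
      have h3 : 0 ≤ 1000 * C * (tau a x ^ 100 * tau a x) := by positivity
      have h4 := mul_le_mul_of_nonneg_right (hτB x) (pow_pos ht 100).le
      have h5 : 0 ≤ tau a x ^ 100 - 1000 * C * (tau a x ^ 100 * tau a x) := by
        linarith [pow_pos ht 100]
      calc wt (1000 * C) a R x ≤ 1 * (tau a x ^ 100 - 1000 * C * (tau a x ^ 100 * tau a x)) :=
            mul_le_mul_of_nonneg_right h2 h5
        _ ≤ tau a x ^ 100 := by linarith
    have ht1 : tau a x ≤ 1 := (hτ2 x).trans (by norm_num)
    calc wt (1000 * C) a R x * (K * (tau a x)⁻¹ ^ 12)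
        ≤ tau a x ^ 100 * ((tau a x)⁻¹ * (tau a x)⁻¹ ^ 12) :=
          mul_le_mul h1 (mul_le_mul_of_nonneg_right (hKi x) (by positivity)) (by positivity)
            (by positivity)
      _ = tau a x ^ 87 := by field_simp
      _ ≤ tau a x ^ 75 := pow_le_pow_of_le_one ht.le ht1 (by norm_num)
      _ = (sg a x)⁻¹ ^ 3 := by rw [sg]; simp only [inv_pow, inv_inv]; ring
  have hρ : ∀ x, K * (tau a x)⁻¹ ^ 9 ≤ sg a x := by
    intro x
    have ht := htp x
    calc K * (tau a x)⁻¹ ^ 9 ≤ (tau a x)⁻¹ * (tau a x)⁻¹ ^ 9 :=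
          mul_le_mul_of_nonneg_right (hKi x) (by positivity)
      _ = (tau a x)⁻¹ ^ 10 := by ring
      _ ≤ (tau a x)⁻¹ ^ 25 := pow_le_pow_right₀ (by linarith [hi2 x]) (by norm_num)
  have hgc : Continuous fun x => wt (1000 * C) a R x * (K * (tau a x)⁻¹ ^ 12) :=
    (contDiff_wt _ R ha).continuous.mul (continuous_const.mul (hic.pow 12))
  have hgs : HasCompactSupport fun x => wt (1000 * C) a R x * (K * (tau a x)⁻¹ ^ 12) :=
    (hasCompactSupport_wt _ a hR).mul_right
  have hρc : Continuous fun x => K * (tau a x)⁻¹ ^ 9 := continuous_const.mul (hic.pow 9)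
  have hI : ∀ y, ∫ x, {x | dist y x < K * (tau a x)⁻¹ ^ 9}.indicator
      (fun x => wt (1000 * C) a R x * (K * (tau a x)⁻¹ ^ 12)) x ≤
      64 * (volume : Measure (E 3)).real (ball 0 1) := integral_indicator_le ha hs2 hg0 hg1 hρ
  have h := integral_variable_ball hf hfs
    (g := fun x => wt (1000 * C) a R x * (K * (tau a x)⁻¹ ^ 12)) (ρ := fun x => K * (tau a x)⁻¹ ^ 9)
    hgc hgs hρc hI (r := 2 * R) (by
      intro y x hx hyx
      have hxR : ‖x‖ < R := by
        by_contra hcon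
        exact hx (by simp [wt, kap_eq_zero hR (not_lt.1 hcon)])
      have hsR : sg a x ≤ R := by
        refine le_of_not_gt fun hlt => ?_
        have h4 : R ^ 4 < sg a x ^ 4 := pow_lt_pow_left₀ hlt hR.le (by norm_num)
        have := sg_pow ha x
        have h2 : ‖x‖ ^ 2 ≤ R ^ 2 := pow_le_pow_left₀ (norm_nonneg _) hxR.le 2
        have e4 : sg a x ^ 4 = (sg a x ^ 2) ^ 2 := by ring
        linarith
      have := hρ x
      rw [mem_ball]
      have := dist_triangle y x 0
      rw [dist_zero_right x] at this
      linarith)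
  have e : ∀ x, wt (1000 * C) a R x * (K * (tau a x)⁻¹ ^ 12) * FF f (K * (tau a x)⁻¹ ^ 9) x =
      wt (1000 * C) a R x * (K * (tau a x)⁻¹ ^ 12 * FF f (K * (tau a x)⁻¹ ^ 9) x) :=
    fun x => mul_assoc _ _ _
  simp only [e] at h
  exact h

lemma setIntegral_mono_ball {g : E 3 → ℝ} (hg : Continuous g) (hg0 : ∀ x, 0 ≤ g x) {x y : E 3}
    {r s : ℝ} (h : ball x r ⊆ ball y s) : ∫ z in ball x r, g z ≤ ∫ z in ball y s, g z :=
  setIntegral_mono_set (hg.integrableOn_ball y s) (.of_forall hg0) h.eventuallyLE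

lemma wt_lower_bound {B a R : ℝ} (ha : 0 < a) (hR : 2 ≤ R) {x : E 3} (hx : ‖x‖ < 1)
    (hτ1 : tau a x ≤ 1) (hτB : B * tau a x ≤ 1 / 4) :
    1 / (4 * (a + 1) ^ 2) ≤ wt B a R x * tau a x := by
  have ht := tau_pos ha x
  have hp := tau_pow ha x
  have hx2 : ‖x‖ ^ 2 ≤ 1 := pow_le_one₀ (norm_nonneg _) hx.le
  set T := tau a x ^ 100 with hT
  have hT0 : 0 < T := by positivity
  have hT1 : T ≤ tau a x := pow_le_of_le_one ht.le hτ1 (by norm_num)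
  have hTa : 1 / (a + 1) ≤ T := by
    rw [div_le_iff₀ (by positivity), ← hp]
    exact mul_le_mul_of_nonneg_left (by linarith) hT0.le
  have hk : 3 / 4 ≤ kap R x := by
    refine le_trans ?_ (le_max_left _ _)
    have : ‖x‖ ^ 2 / R ^ 2 ≤ 1 / 4 := by
      rw [div_le_iff₀ (by positivity)]; nlinarith
    linarith
  have hk2 : 9 / 16 ≤ kap R x ^ 2 := by nlinarith
  have hM : 3 / 4 * T ≤ T - B * (T * tau a x) := by
    have := mul_le_mul_of_nonneg_left hτB hT0.le
    linarith
  have h1 : 9 / 16 * (3 / 4 * T) ≤ wt B a R x := mul_le_mul hk2 hM (by positivity) (sq_nonneg _)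
  have h2 : 9 / 16 * (3 / 4 * T) * T ≤ wt B a R x * tau a x :=
    mul_le_mul h1 hT1 hT0.le (le_trans (by positivity) h1)
  have h3 : (1 / (a + 1)) ^ 2 ≤ T ^ 2 := pow_le_pow_left₀ (by positivity) hTa 2
  have e : 1 / (4 * (a + 1) ^ 2) = (1 / (a + 1)) ^ 2 / 4 := by field_simp
  rw [e]
  nlinarith [sq_nonneg T]

lemma exists_unit_energy_bound {C η₀ : ℝ} (hC : 12 ≤ C) (hη : 0 < η₀) : ∃ K R₀ : ℝ, 0 < K ∧ 8 ≤ R₀ ∧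
    ∀ f w : E 3 → ℝ, Continuous f → HasCompactSupport f → ContDiff ℝ 3 w →
    (∀ x, FF f 6 x ≤ η₀ → |w x| ≤ C ∧ (∀ i, |pd i w x| ≤ C) ∧
      res w x ^ 2 ≤ C * FF f 6 x ∧ ∀ i, pd i (res w) x ^ 2 ≤ C * FF f 6 x) →
    ∀ R, R₀ ≤ R → FF f (2 * R) 0 ≤ η₀ → ∫ x in ball (0 : E 3) 1, en w x ≤
      K * (FF f (2 * R) 0 + (∫ x in ball (0 : E 3) R, en w x) / R ^ 2) := by
  have hC0 : 0 < C := by linarith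
  have hC5 : 1 ≤ C ^ 5 := one_le_pow₀ (by linarith)
  set t : ℝ := min η₀ (1 / (10 ^ 6 * C ^ 5)) with ht
  have ht0 : 0 < t := lt_min hη (by positivity)
  set a : ℝ := (t ^ 100)⁻¹ with ha'
  have ha : 0 < a := by positivity
  have hat : 1 ≤ a * t ^ 100 := by rw [ha', inv_mul_cancel₀ (by positivity)]
  have hτt : ∀ x, tau a x ≤ t := tau_le ha ht0 hat
  clear_value a
  have hτη : ∀ x, tau a x ≤ η₀ := fun x => (hτt x).trans (min_le_left _ _)
  have hτK : ∀ x, 10 ^ 6 * C ^ 5 * tau a x ≤ 1 := fun x => by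
    have := (hτt x).trans (min_le_right _ _)
    rw [le_div_iff₀ (by positivity)] at this
    linarith
  have hCC : C ≤ C ^ 5 := le_self_pow₀ (by linarith) (by norm_num)
  have hτB : ∀ x, 1000 * C * tau a x ≤ 1 / 4 := fun x => by
    have h1 := mul_le_mul_of_nonneg_right hCC (tau_pos ha x).le
    linarith [hτK x]
  have hτ2 : ∀ x, tau a x ≤ 1 / 2 := fun x => by
    have h1 := mul_le_mul_of_nonneg_right hC5 (tau_pos ha x).le
    linarith [hτK x, tau_pos ha x]
  set m : ℝ := 1 / (4 * (a + 1) ^ 2) with hm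
  have hm0 : 0 < m := by positivity
  clear_value m
  set ω : ℝ := (volume : Measure (E 3)).real (ball 0 1)
  set V : ℝ := ((volume : Measure (E 3)).restrict (ball 0 6)).real univ
  have hω : 0 ≤ ω := measureReal_nonneg
  have hV : 0 ≤ V := measureReal_nonneg
  refine ⟨m⁻¹ * (C * V + 64 * ω + 12 * C), max 8 a, by positivity, le_max_left _ _, ?_⟩
  intro f w hf hfs hw hreg R hR hFR
  have hR8 : 8 ≤ R := (le_max_left _ _).trans hR
  have hRa : a ≤ R := (le_max_right _ _).trans hR
  have hR0 : 0 < R := by linarith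
  have haR : a + R ^ 2 ≤ R ^ 4 := by
    have h1 : 64 ≤ R ^ 2 := by nlinarith
    have h2 := mul_le_mul_of_nonneg_right h1 (sq_nonneg R)
    nlinarith
  have hFR6 : FF f (R + 6) 0 ≤ FF f (2 * R) 0 := FF_mono hf (by rw [dist_self]; linarith)
  have hw1 : ContDiff ℝ 1 w := hw.of_le (by norm_num)
  have hw2 : ContDiff ℝ 2 w := hw.of_le (by norm_num)
  obtain ⟨hbI, hb⟩ := integral_bad_le hf hfs hC ha hτ2 hτB hτK hR0 haR
  have hmain := weighted_energy_le hf hw hC hreg ha (fun x => (hτ2 x).trans (by norm_num)) hτη hτB hR0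
    (hFR6.trans hFR) hbI
  have hwt0 : ∀ x, 0 ≤ wt (1000 * C) a R x * tau a x := by
    intro x
    have ht := tau_pos ha x
    have h1 : 0 ≤ tau a x ^ 100 - 1000 * C * (tau a x ^ 100 * tau a x) := by
      have := mul_le_mul_of_nonneg_left (hτB x) (pow_pos ht 100).le
      linarith [pow_pos ht 100]
    have h2 : 0 ≤ wt (1000 * C) a R x := mul_nonneg (sq_nonneg _) h1
    positivity
  have hlow : m * ∫ x in ball (0 : E 3) 1, en w x ≤ ∫ x, wt (1000 * C) a R x * tau a x * en w x := by
    have hLI : Integrable fun x => wt (1000 * C) a R x * tau a x * en w x := by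
      refine Continuous.integrable_of_hasCompactSupport ?_
        ((hasCompactSupport_wt _ a hR0).mul_right.mul_right)
      exact ((contDiff_wt _ R ha).continuous.mul (contDiff_tau (n := 1) ha).continuous).mul
        (continuous_en hw1)
    rw [← integral_const_mul]
    refine le_trans ?_ (setIntegral_le_integral (s := ball (0 : E 3) 1) hLI
      (.of_forall fun x => mul_nonneg (hwt0 x) (en_nonneg w x)))
    refine setIntegral_mono_on (((continuous_en hw1).integrableOn_ball 0 1).const_mul m)
      hLI.integrableOn measurableSet_ball fun x hx => ?_
    refine mul_le_mul_of_nonneg_right ?_ (en_nonneg w x)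
    rw [hm]
    exact wt_lower_bound ha (by linarith) (by simpa using hx) ((hτ2 x).trans (by norm_num)) (hτB x)
  have hH : ∫ x, kap R x ^ 2 * res w x ^ 2 ≤ C * (V * FF f (2 * R) 0) := by
    have e : (fun x => kap R x ^ 2 * res w x ^ 2) =
        (ball (0 : E 3) R).indicator fun x => kap R x ^ 2 * res w x ^ 2 := by
      ext x
      by_cases hx : x ∈ ball (0 : E 3) R
      · rw [indicator_of_mem hx]
      · rw [indicator_of_notMem hx, kap_eq_zero hR0 (by simpa using hx)]; ring
    rw [e, integral_indicator measurableSet_ball]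
    have hc1 : Continuous fun x => kap R x ^ 2 * res w x ^ 2 :=
      ((continuous_kap R).pow 2).mul ((continuous_res hw2).pow 2)
    have hc2 : Continuous fun x => C * FF f 6 x := continuous_const.mul (continuous_FF hf hfs 6)
    have h1 : ∫ x in ball (0 : E 3) R, kap R x ^ 2 * res w x ^ 2 ≤
        ∫ x in ball (0 : E 3) R, C * FF f 6 x := by
      refine setIntegral_mono_on (hc1.integrableOn_ball 0 R) (hc2.integrableOn_ball 0 R)
        measurableSet_ball fun x hx => ?_
      have hx6 : FF f 6 x ≤ η₀ := (FF_mono hf (by rw [mem_ball] at hx; linarith)).trans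
        (hFR6.trans hFR)
      have h2 : kap R x ^ 2 ≤ 1 := pow_le_one₀ (kap_nonneg R x) (kap_le_one R x)
      have h3 := mul_le_mul_of_nonneg_right h2 (sq_nonneg (res w x))
      linarith [(hreg x hx6).2.2.1]
    refine h1.trans ?_
    rw [integral_const_mul]
    exact mul_le_mul_of_nonneg_left ((integral_FF_le hf hfs 6 0 R).trans
      (mul_le_mul_of_nonneg_left hFR6 hV)) hC0.le
  set X := ∫ x in ball (0 : E 3) 1, en w x
  set F := FF f (2 * R) 0 with hF
  set Y := ∫ x in ball (0 : E 3) R, en w x with hY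
  have hF0 : 0 ≤ F := FF_nonneg _ _ _
  have hY0 : 0 ≤ Y / R ^ 2 := div_nonneg (integral_nonneg fun x => en_nonneg w x) (by positivity)
  have e1 : 12 * C / R ^ 2 * Y = 12 * C * (Y / R ^ 2) := by ring
  rw [e1] at hmain
  have h4 : m * X ≤ (C * V + 64 * ω + 12 * C) * (F + Y / R ^ 2) := by
    have p1 : 0 ≤ C * F := by positivity
    have p2 : 0 ≤ (C * V + 64 * ω) * (Y / R ^ 2) := by positivity
    linarith
  rw [mul_assoc, inv_mul_eq_div, le_div_iff₀ hm0]
  linarith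

lemma abs_sub_le_of_pd_bound {w : E 3 → ℝ} (hw : ContDiff ℝ 1 w) {C : ℝ} (hC : 0 ≤ C)
    (h : ∀ x ∈ ball (0 : E 3) 1, ∀ i, |pd i w x| ≤ C) {x : E 3} (hx : x ∈ ball (0 : E 3) 1) :
    |w x - w 0| ≤ 2 * C * ‖x‖ := by
  have hb : ∀ x ∈ ball (0 : E 3) 1, ‖fderiv ℝ w x‖ ≤ 2 * C := by
    intro x hx
    refine abs_le_of_sq_le_sq' ?_ (by positivity) |>.2
    rw [← gsq_eq, gsq]
    have hi : ∀ i, pd i w x ^ 2 ≤ C ^ 2 := fun i => sq_le_sq' (abs_le.1 (h x hx i)).1 (abs_le.1 (h x hx i)).2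
    rw [Fin.sum_univ_three]
    nlinarith [hi 0, hi 1, hi 2, sq_nonneg C]
  have := (convex_ball (0 : E 3) 1).norm_image_sub_le_of_norm_fderiv_le
    (fun y _ => hw.differentiable (by norm_num) y) hb (mem_ball_self one_pos) hx
  simpa using this

lemma abs_sq_sub_one_le_of_energy {w : E 3 → ℝ} (hw : ContDiff ℝ 1 w) {C δ : ℝ} (hC : 1 ≤ C)
    (hδ : 0 < δ) (hδ1 : δ ≤ 1) (h : ∀ x ∈ ball (0 : E 3) 1, |w x| ≤ C ∧ ∀ i, |pd i w x| ≤ C)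
    (hE : ∫ x in ball (0 : E 3) 1, en w x <
      δ ^ 2 / 16 * (volume : Measure (E 3)).real (ball 0 (δ / (8 * C ^ 2)))) :
    |w 0 ^ 2 - 1| ≤ δ := by
  by_contra hcon
  rw [not_le] at hcon
  set s := δ / (8 * C ^ 2) with hs
  have hC2 : 1 ≤ C ^ 2 := one_le_pow₀ hC
  have hs0 : 0 < s := by positivity
  have hs1 : s ≤ 1 := by
    rw [hs, div_le_one (by positivity)]; linarith
  have hsub : ball (0 : E 3) s ⊆ ball 0 1 := ball_subset_ball hs1
  have hlow : ∀ x ∈ ball (0 : E 3) s, δ ^ 2 / 16 ≤ en w x := by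
    intro x hx
    have h1 := abs_sub_le_of_pd_bound hw (by linarith) (fun y hy => (h y hy).2) (hsub hx)
    have h2 := (h x (hsub hx)).1
    have h3 := (h 0 (mem_ball_self one_pos)).1
    have hxs : ‖x‖ ≤ s := by simpa using (mem_ball.1 hx).le
    have h4 : |w x ^ 2 - w 0 ^ 2| ≤ δ / 2 := by
      have e : w x ^ 2 - w 0 ^ 2 = (w x - w 0) * (w x + w 0) := by ring
      rw [e, abs_mul]
      calc |w x - w 0| * |w x + w 0| ≤ (2 * C * s) * (2 * C) :=
            mul_le_mul (h1.trans (mul_le_mul_of_nonneg_left hxs (by linarith)))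
              ((abs_add_le _ _).trans (by linarith)) (abs_nonneg _) (by positivity)
        _ = δ / 2 := by rw [hs]; field_simp; ring
    have h5 : δ / 2 ≤ |w x ^ 2 - 1| := by
      have := abs_sub_abs_le_abs_sub (w 0 ^ 2 - 1) (w 0 ^ 2 - w x ^ 2)
      rw [abs_sub_comm (w 0 ^ 2) (w x ^ 2)] at this
      have e : w 0 ^ 2 - 1 - (w 0 ^ 2 - w x ^ 2) = w x ^ 2 - 1 := by ring
      rw [e] at this
      linarith
    have h6 : (δ / 2) ^ 2 ≤ (w x ^ 2 - 1) ^ 2 := by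
      rw [← sq_abs (w x ^ 2 - 1)]; exact pow_le_pow_left₀ (by positivity) h5 2
    rw [en, W]
    have := gsq_nonneg w x
    linarith
  have h7 : δ ^ 2 / 16 * (volume : Measure (E 3)).real (ball 0 s) ≤ ∫ x in ball (0 : E 3) s, en w x := by
    have e : ∫ _ in ball (0 : E 3) s, δ ^ 2 / 16 = δ ^ 2 / 16 * (volume : Measure (E 3)).real (ball 0 s) := by
      rw [setIntegral_const, smul_eq_mul, mul_comm]
    rw [← e]
    exact setIntegral_mono_on (continuous_const.integrableOn_ball 0 s)
      ((continuous_en hw).integrableOn_ball 0 s) measurableSet_ball hlow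
  have h8 := setIntegral_mono_ball (continuous_en hw) (en_nonneg w) hsub
  linarith

/-- Clearing-out at unit scale. -/
lemma exists_clearing_out {κ : ℝ} (hκ : 0 < κ) : ∃ η R₀ : ℝ, 0 < η ∧ 0 < R₀ ∧ ∀ v : E 3 → ℝ,
    ContDiff ℝ 2 v → HasCompactSupport v → ∀ R, R₀ ≤ R → FF (res v) (2 * R) 0 ≤ η →
    ∫ x in ball (0 : E 3) (2 * R), en v x ≤ η * R ^ 2 → |v 0 ^ 2 - 1| ≤ κ := by
  obtain ⟨C, η₀, hC, hη₀, hreg⟩ := exists_regularisation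
  obtain ⟨K, R₀, hK, hR₀, hunit⟩ := exists_unit_energy_bound hC hη₀
  have hC0 : 0 < C := by linarith
  set δ := min (κ / 2) 1 with hδ
  have hδ0 : 0 < δ := lt_min (by linarith) one_pos
  have hδ1 : δ ≤ 1 := min_le_right _ _
  have hδκ : δ ≤ κ / 2 := min_le_left _ _
  set m := δ ^ 2 / 16 * (volume : Measure (E 3)).real (ball 0 (δ / (8 * C ^ 2))) with hm
  have hm0 : 0 < m := by
    have : 0 < (volume : Measure (E 3)).real (ball 0 (δ / (8 * C ^ 2))) :=
      ENNReal.toReal_pos (measure_ball_pos volume _ (by positivity)).ne' measure_ball_lt_top.ne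
    positivity
  set d := δ / (2 * C + 1) with hd
  have hd0 : 0 < d := by positivity
  have hd1 : d ≤ 1 := by rw [hd, div_le_one (by positivity)]; linarith
  have hdC : d * (2 * C + 1) = δ := by rw [hd]; field_simp
  clear_value δ d m
  refine ⟨min η₀ (min (m / (4 * K * C)) (d ^ 2 / C)), R₀, lt_min hη₀ (lt_min (by positivity) (by positivity)),
    by linarith, ?_⟩
  intro v hv hvs R hR hF hE
  set η := min η₀ (min (m / (4 * K * C)) (d ^ 2 / C)) with hη
  have hη1 : η ≤ η₀ := min_le_left _ _
  have hη2 : η ≤ m / (4 * K * C) := (min_le_right _ _).trans (min_le_left _ _)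
  have hη3 : η ≤ d ^ 2 / C := (min_le_right _ _).trans (min_le_right _ _)
  clear_value η
  rw [le_div_iff₀ (by positivity)] at hη2 hη3
  obtain ⟨w, hw, -, hpt, hen⟩ := hreg v hv hvs
  have hf : Continuous (res v) := continuous_res hv
  have hfs : HasCompactSupport (res v) := hvs.res hv
  have hR0 : 0 < R := by linarith
  have hw1 : ContDiff ℝ 1 w := hw.of_le (by norm_num)
  have hv1 : ContDiff ℝ 1 v := hv.of_le (by norm_num)
  have h1 := hunit (res v) w hf hfs hw
    (fun x hx => ⟨(hpt x hx).1, (hpt x hx).2.1, (hpt x hx).2.2.1, (hpt x hx).2.2.2.1⟩) R hR (hF.trans hη1)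
  have hF8 : FF (res v) (R + 8) 0 ≤ FF (res v) (2 * R) 0 := FF_mono hf (by rw [dist_self]; linarith)
  have h2 := hen 0 R (hF8.trans (hF.trans hη1))
  have h3 : ∫ x in ball (0 : E 3) (R + 8), en v x ≤ ∫ x in ball (0 : E 3) (2 * R), en v x :=
    setIntegral_mono_ball (continuous_en hv1) (en_nonneg v) (ball_subset_ball (by linarith))
  have hball : ∀ x ∈ ball (0 : E 3) 1, |w x| ≤ C ∧ ∀ i, |pd i w x| ≤ C := by
    intro x hx
    have hx6 : FF (res v) 6 x ≤ η₀ := (FF_mono hf (by rw [mem_ball] at hx; linarith)).trans (hF.trans hη1)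
    exact ⟨(hpt x hx6).1, (hpt x hx6).2.1⟩
  have hη0 : 0 ≤ η := (FF_nonneg _ _ _).trans hF
  have h4 : (∫ x in ball (0 : E 3) R, en w x) / R ^ 2 ≤ 2 * C * η := by
    rw [div_le_iff₀ (by positivity)]
    have hR1 : 1 ≤ R ^ 2 := one_le_pow₀ (by linarith)
    have h5 : FF (res v) (R + 8) 0 ≤ η * R ^ 2 := by
      have := mul_le_mul_of_nonneg_left hR1 hη0
      linarith
    have h6 := mul_le_mul_of_nonneg_left (add_le_add (h3.trans hE) h5) hC0.le
    linarith
  have h7 : ∫ x in ball (0 : E 3) 1, en w x < m := by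
    have h8 : FF (res v) (2 * R) 0 + (∫ x in ball (0 : E 3) R, en w x) / R ^ 2 ≤ 3 * C * η := by
      have := mul_le_mul_of_nonneg_right hC hη0
      linarith
    have h9 := mul_le_mul_of_nonneg_left h8 hK.le
    have h10 : K * (3 * C * η) ≤ 3 / 4 * m := by linarith
    linarith
  have h11 := abs_sq_sub_one_le_of_energy hw1 (by linarith) hδ0 hδ1 hball (by rw [← hm]; exact h7)
  have h06 : FF (res v) 6 0 ≤ η :=
    (FF_mono hf (by rw [dist_self]; linarith)).trans hF
  have h12 := (hpt 0 (h06.trans hη1)).2.2.2.2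
  have h13 : |w 0 - v 0| ≤ d := by
    refine abs_le_of_sq_le_sq ?_ hd0.le
    have := mul_le_mul_of_nonneg_left h06 hC0.le
    linarith
  have h14 := (hball 0 (mem_ball_self one_pos)).1
  have h15 : |w 0 ^ 2 - v 0 ^ 2| ≤ δ := by
    have e : w 0 ^ 2 - v 0 ^ 2 = (w 0 - v 0) * (2 * w 0 - (w 0 - v 0)) := by ring
    rw [e, abs_mul, ← hdC]
    refine mul_le_mul h13 ((abs_sub _ _).trans ?_) (abs_nonneg _) hd0.le
    rw [abs_mul, abs_two]; linarith
  have e : v 0 ^ 2 - 1 = (w 0 ^ 2 - 1) - (w 0 ^ 2 - v 0 ^ 2) := by ring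
  rw [e]
  exact (abs_sub _ _).trans (by linarith)

lemma fderiv_affine {F : Type*} [NormedAddCommGroup F] [NormedSpace ℝ F] (g : E 3 → F) (x : E 3)
    (s : ℝ) (y : E 3) : fderiv ℝ (fun y => g (x + s • y)) y = s • fderiv ℝ g (x + s • y) := by
  have h := fderiv_comp_smul (f := fun z => g (x + z)) (x := y) s
  rw [fderiv_comp_add_left] at h
  exact h

lemma lap_affine (u : E 3 → ℝ) (x : E 3) (s : ℝ) (y : E 3) :
    lap (fun y => u (x + s • y)) y = s ^ 2 * lap u (x + s • y) := by
  have h1 : fderiv ℝ (fun y => u (x + s • y)) = fun y => s • fderiv ℝ u (x + s • y) :=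
    funext fun y => fderiv_affine u x s y
  have h2 : fderiv ℝ (fun y => s • fderiv ℝ u (x + s • y)) y =
      s • s • fderiv ℝ (fderiv ℝ u) (x + s • y) := by
    rw [fderiv_affine (fun z => s • fderiv ℝ u z) x s y]
    congr 1
    exact congrFun (fderiv_const_smul_field (R := ℝ) (f := fderiv ℝ u) s) _
  simp only [lap, h1, h2]
  rw [Finset.mul_sum]
  refine Finset.sum_congr rfl fun i _ => ?_
  simp [smul_eq_mul]; ring

lemma en_affine (u : E 3 → ℝ) (x : E 3) {s : ℝ} (hs : 0 < s) (y : E 3) :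
    en (fun y => u (x + s • y)) y = s * areaDensity s u (x + s • y) := by
  rw [en, gsq_eq, fderiv_affine, norm_smul, areaDensity, Real.norm_eq_abs, abs_of_pos hs]
  field_simp

lemma res_affine_sq (u : E 3 → ℝ) (x : E 3) {s : ℝ} (hs : 0 < s) (y : E 3) :
    res (fun y => u (x + s • y)) y ^ 2 = s ^ 2 * willDensity s u (x + s • y) := by
  rw [res, lap_affine, willDensity]
  field_simp

lemma res_congr {v w : E 3 → ℝ} {y : E 3} (h : v =ᶠ[nhds y] w) : res v y = res w y := by
  rw [res, res, lap, lap, h.fderiv.fderiv_eq, h.eq_of_nhds]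

lemma en_congr {v w : E 3 → ℝ} {y : E 3} (h : v =ᶠ[nhds y] w) : en v y = en w y := by
  rw [en, en, gsq_eq, gsq_eq, h.fderiv_eq, h.eq_of_nhds]

/-- Clearing-out at scale `ε`. -/
lemma exists_clearing_out_scaled {κ : ℝ} (hκ : 0 < κ) : ∃ η R₀ : ℝ, 0 < η ∧ 0 < R₀ ∧
    ∀ (Ω : Set (E 3)) (u : E 3 → ℝ), IsOpen Ω → ContDiffOn ℝ 2 u Ω → ∀ (x : E 3) (ε ρ : ℝ), 0 < ε →
    R₀ * ε ≤ ρ → closedBall x (2 * ρ) ⊆ Ω → ∫ y in ball x ρ, willDensity ε u y ≤ η * ε →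
    ∫ y in ball x ρ, areaDensity ε u y ≤ η * ρ ^ 2 → |u x ^ 2 - 1| ≤ κ := by
  obtain ⟨η, R₀, hη, hR₀, hco⟩ := exists_clearing_out hκ
  refine ⟨η / 4, 2 * R₀, by positivity, by positivity, ?_⟩
  intro Ω u hΩ hu x ε ρ hε hρ hsub hwill harea
  have hρ0 : 0 < ρ := lt_of_lt_of_le (by positivity) hρ
  have hrad : 0 < ρ / ε := by positivity
  set b : ContDiffBump (0 : E 3) := ⟨ρ / ε, 2 * (ρ / ε), hrad, by linarith⟩ with hb
  set v : E 3 → ℝ := fun y => b y * u (x + ε • y) with hv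
  have hvs : HasCompactSupport v := b.hasCompactSupport.mul_right
  have hvc : ContDiff ℝ 2 v := by
    rw [contDiff_iff_contDiffAt]
    intro y
    by_cases hy : y ∈ tsupport b
    · rw [b.tsupport_eq, mem_closedBall_zero_iff] at hy
      have hyΩ : x + ε • y ∈ Ω := hsub (by
        rw [mem_closedBall, dist_eq_norm, add_sub_cancel_left, norm_smul, Real.norm_eq_abs, abs_of_pos hε]
        calc ε * ‖y‖ ≤ ε * (2 * (ρ / ε)) := mul_le_mul_of_nonneg_left hy hε.le
          _ = 2 * ρ := by field_simp)
      have h1 : ContDiffAt ℝ 2 u (x + ε • y) := hu.contDiffAt (hΩ.mem_nhds hyΩ)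
      have h2 : ContDiffAt ℝ 2 (fun y : E 3 => x + ε • y) y := by fun_prop
      exact b.contDiff.contDiffAt.mul (h1.comp y h2)
    · refine (contDiffAt_const (c := (0 : ℝ))).congr_of_eventuallyEq ?_
      filter_upwards [notMem_tsupport_iff_eventuallyEq.1 hy] with z hz
      simp [hv, hz]
  have hvu : ∀ y ∈ ball (0 : E 3) (ρ / ε), v =ᶠ[nhds y] fun y => u (x + ε • y) := by
    intro y hy
    filter_upwards [b.eventuallyEq_one_of_mem_ball (x := y) hy] with z hz
    simp [hv, hz]
  have h2R : 2 * (ρ / (2 * ε)) = ρ / ε := by field_simp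
  have hερ : ε * (ρ / ε) = ρ := by field_simp
  have hF : FF (res v) (ρ / ε) 0 = ε⁻¹ * ∫ y in ball x ρ, willDensity ε u y := by
    rw [FF, setIntegral_congr_fun measurableSet_ball
      (g := fun y => ε ^ 2 * willDensity ε u (x + ε • y))
      (fun y hy => by simp only [res_congr (hvu y hy), res_affine_sq u x hε]),
      integral_const_mul, setIntegral_ball_scale _ x hε, hερ]
    field_simp
  have hE : ∫ y in ball (0 : E 3) (ρ / ε), en v y = (ε ^ 2)⁻¹ * ∫ y in ball x ρ, areaDensity ε u y := by
    rw [setIntegral_congr_fun measurableSet_ball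
      (g := fun y => ε * areaDensity ε u (x + ε • y))
      (fun y hy => by simp only [en_congr (hvu y hy), en_affine u x hε]),
      integral_const_mul, setIntegral_ball_scale _ x hε, hερ]
    field_simp
  have h0 : v 0 = u x := by
    have := (hvu 0 (mem_ball_self hrad)).eq_of_nhds
    simpa using this
  rw [← h0]
  refine hco v hvc hvs (ρ / (2 * ε)) ?_ ?_ ?_
  · rw [le_div_iff₀ (by positivity)]; linarith
  · rw [h2R, hF, inv_mul_le_iff₀ hε]
    linarith [mul_pos hη hε]
  · rw [h2R, hE, inv_mul_le_iff₀ (by positivity)]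
    refine harea.trans (le_of_eq ?_)
    field_simp
    norm_num

lemma exists_local_extension {Ω : Set (E 3)} {u : E 3 → ℝ} (hΩ : IsOpen Ω) (hu : ContDiffOn ℝ 2 u Ω)
    {x : E 3} {r : ℝ} (hr : 0 < r) (hsub : closedBall x (2 * r) ⊆ Ω) :
    ∃ v : E 3 → ℝ, ContDiff ℝ 2 v ∧ ∀ y ∈ ball x r, v =ᶠ[nhds y] u := by
  set b : ContDiffBump x := ⟨r, 2 * r, hr, by linarith⟩ with hb
  refine ⟨fun y => b y * u y, contDiff_iff_contDiffAt.2 fun y => ?_, fun y hy => ?_⟩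
  · by_cases hy : y ∈ tsupport b
    · rw [b.tsupport_eq] at hy
      exact b.contDiff.contDiffAt.mul (hu.contDiffAt (hΩ.mem_nhds (hsub hy)))
    · refine (contDiffAt_const (c := (0 : ℝ))).congr_of_eventuallyEq ?_
      filter_upwards [notMem_tsupport_iff_eventuallyEq.1 hy] with z hz
      simp [hz]
  · filter_upwards [b.eventuallyEq_one_of_mem_ball (x := y) hy] with z hz
    simp [hz]

lemma areaDensity_congr {ε : ℝ} {v w : E 3 → ℝ} {y : E 3} (h : v =ᶠ[nhds y] w) :
    areaDensity ε v y = areaDensity ε w y := by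
  rw [areaDensity, areaDensity, h.fderiv_eq, h.eq_of_nhds]

lemma willDensity_congr {ε : ℝ} {v w : E 3 → ℝ} {y : E 3} (h : v =ᶠ[nhds y] w) :
    willDensity ε v y = willDensity ε w y := by
  rw [willDensity, willDensity, lap, lap, h.fderiv.fderiv_eq, h.eq_of_nhds]

lemma areaDensity_nonneg {ε : ℝ} (hε : 0 < ε) (v : E 3 → ℝ) (y : E 3) : 0 ≤ areaDensity ε v y := by
  have := W_nonneg (v y)
  unfold areaDensity; positivity

lemma willDensity_nonneg (ε : ℝ) (v : E 3 → ℝ) (y : E 3) : 0 ≤ willDensity ε v y := sq_nonneg _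

lemma decay_pointwise {ε c t G P M h : ℝ} (hε : 0 < ε) (ht : |t ^ 2 - 1| ≤ 1 / 4) (hG : 0 ≤ G)
    (hP : P ^ 2 ≤ M * G) (hM : 0 ≤ M) :
    c ^ 2 * (ε / 2 * G + (1 / ε) * W t) ≤
      ε * (2 * c * W' t * P + c ^ 2 * (3 * t ^ 2 - 1) * G) + c ^ 2 * W' t * (h + (1 / ε) * W' t)
        + (ε / 2 * (c ^ 2 * h ^ 2) + 10 * ε * (M * W t)) := by
  have hW := W_nonneg t
  have h2 := abs_le.1 ht
  have eW : W' t ^ 2 = 4 * t ^ 2 * W t := by unfold W' W; ring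
  have lo : 3 * W t ≤ W' t ^ 2 := by rw [eW]; nlinarith
  have hi : W' t ^ 2 ≤ 5 * W t := by rw [eW]; nlinarith
  generalize W t = w at *
  generalize W' t = w' at *
  have hcG : 0 ≤ c ^ 2 * G := by positivity
  have a1 : 5 / 4 * (c ^ 2 * G) ≤ c ^ 2 * (3 * t ^ 2 - 1) * G := by nlinarith
  have a2 : 0 ≤ (c * w') ^ 2 * (1 / ε) / 2 + c ^ 2 * w' * h + ε / 2 * (c ^ 2 * h ^ 2) := by
    have e : (c * w') ^ 2 * (1 / ε) / 2 + c ^ 2 * w' * h + ε / 2 * (c ^ 2 * h ^ 2) =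
        c ^ 2 * (w' + ε * h) ^ 2 / (2 * ε) := by field_simp; ring
    rw [e]; positivity
  have a3 : -(c ^ 2 * G / 2) - 2 * (M * w' ^ 2) ≤ 2 * c * w' * P := by
    have hk : (2 * c * w' * P) ^ 2 ≤ (c ^ 2 * G / 2 + 2 * (M * w' ^ 2)) ^ 2 := by
      have h5 := mul_le_mul_of_nonneg_left hP (by positivity : 0 ≤ 4 * (c * w') ^ 2)
      nlinarith [sq_nonneg (c ^ 2 * G / 2 - 2 * (M * w' ^ 2))]
    have := (abs_le_of_sq_le_sq' hk (by positivity)).1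
    linarith
  have a4 : M * w' ^ 2 ≤ 5 * (M * w) := by
    have := mul_le_mul_of_nonneg_left hi hM; linarith
  have a5 : 3 * (c ^ 2 * ((1 / ε) * w)) ≤ (c * w') ^ 2 * (1 / ε) := by
    have := mul_le_mul_of_nonneg_left lo (by positivity : 0 ≤ c ^ 2 * (1 / ε)); linarith
  have a6 : 0 ≤ c ^ 2 * ((1 / ε) * w) := by positivity
  have a7 := mul_le_mul_of_nonneg_left (show 3 / 4 * (c ^ 2 * G) - 10 * (M * w) ≤
    2 * c * w' * P + c ^ 2 * (3 * t ^ 2 - 1) * G by linarith) hε.le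
  have a8 : 0 ≤ ε * (c ^ 2 * G) := by positivity
  linarith

lemma energy_decay {v χ : E 3 → ℝ} (hv : ContDiff ℝ 2 v) (hχ : ContDiff ℝ 1 χ) (hχs : HasCompactSupport χ)
    (hsupp : ∀ y, χ y ≠ 0 → |v y ^ 2 - 1| ≤ 1 / 4) {ε : ℝ} (hε : 0 < ε) :
    ∫ y, χ y ^ 2 * areaDensity ε v y ≤
      ∫ y, (ε / 2 * (χ y ^ 2 * willDensity ε v y) + 10 * ε * (gsq χ y * W (v y))) := by
  have hv1 : ContDiff ℝ 1 v := hv.of_le (by norm_num)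
  have hWv : ContDiff ℝ 1 fun y => W' (v y) := contDiff_W'.comp hv1
  set T : Fin 3 → E 3 → ℝ := fun i y => χ y ^ 2 * (W' (v y) * pd i v y) with hT
  have hχ2s : HasCompactSupport fun y => χ y ^ 2 :=
    hχs.comp_left (g := fun t => t ^ 2) (by simp)
  have hTc : ∀ i, ContDiff ℝ 1 (T i) := fun i => (hχ.pow 2).mul (hWv.mul (hv.pd_two i))
  have hTs : ∀ i, HasCompactSupport (T i) := fun i => hχ2s.mul_right
  have hTi : ∀ i, Integrable (pd i (T i)) := fun i =>
    ((hTc i).pd_one i).integrable_of_hasCompactSupport ((hTs i).pd i)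
  have hTI : Integrable fun x => ∑ i, pd i (T i) x := integrable_finsetSum _ fun i _ => hTi i
  have hT0 : ∫ x, ∑ i, pd i (T i) x = 0 := by
    rw [integral_finsetSum _ fun i _ => hTi i]
    exact Finset.sum_eq_zero fun i _ => integral_pd_eq_zero (hTc i) (hTs i)
  have harea : Continuous (areaDensity ε v) := by
    unfold areaDensity
    exact (continuous_const.mul ((hv1.continuous_fderiv (by norm_num)).norm.pow 2)).add
      (continuous_const.mul (continuous_W.comp hv.continuous))
  have hwill : Continuous (willDensity ε v) := by
    unfold willDensity
    exact ((continuous_const.mul (continuous_lap hv)).sub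
      (continuous_const.mul (continuous_W'.comp hv.continuous))).pow 2
  have hgs : HasCompactSupport (gsq χ) := by
    refine HasCompactSupport.intro hχs.isCompact fun y hy => ?_
    rw [gsq_eq, (notMem_tsupport_iff_eventuallyEq.1 hy).fderiv_eq]
    simp
  have hI1 : Integrable fun y => χ y ^ 2 * areaDensity ε v y :=
    ((hχ.continuous.pow 2).mul harea).integrable_of_hasCompactSupport hχ2s.mul_right
  have hI2 : Integrable fun y => χ y ^ 2 * willDensity ε v y :=
    ((hχ.continuous.pow 2).mul hwill).integrable_of_hasCompactSupport hχ2s.mul_right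
  have hI3 : Integrable fun y => gsq χ y * W (v y) :=
    ((continuous_gsq hχ).mul (continuous_W.comp hv.continuous)).integrable_of_hasCompactSupport
      hgs.mul_right
  have hI4 : Integrable fun y => ε / 2 * (χ y ^ 2 * willDensity ε v y) + 10 * ε * (gsq χ y * W (v y)) :=
    (hI2.const_mul _).add (hI3.const_mul _)
  have hpt : ∀ y, χ y ^ 2 * areaDensity ε v y ≤ ε * ∑ i, pd i (T i) y +
      (ε / 2 * (χ y ^ 2 * willDensity ε v y) + 10 * ε * (gsq χ y * W (v y))) := by
    intro y
    have dχ : DifferentiableAt ℝ χ y := hχ.differentiable (by norm_num) y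
    have dv : DifferentiableAt ℝ v y := hv.differentiable (by norm_num) y
    have dW : DifferentiableAt ℝ (fun y => W' (v y)) y := hWv.differentiable (by norm_num) y
    have dp : ∀ i, DifferentiableAt ℝ (pd i v) y := fun i => (hv.pd_two i).differentiable (by norm_num) y
    have hTy : ∀ i, pd i (T i) y = 2 * χ y * pd i χ y * (W' (v y) * pd i v y) +
        χ y ^ 2 * ((3 * v y ^ 2 - 1) * pd i v y * pd i v y + W' (v y) * pd i (pd i v) y) := by
      intro i
      rw [hT, pd_mul (dχ.fun_pow 2) (dW.fun_mul (dp i)), pd_sq dχ, pd_mul dW (dp i),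
        pd_comp (g := W') (hasDerivAt_W' (v y)) dv]
    have hsum : ∑ i, pd i (T i) y = 2 * χ y * W' (v y) * (∑ i, pd i χ y * pd i v y)
        + χ y ^ 2 * (3 * v y ^ 2 - 1) * gsq v y + χ y ^ 2 * W' (v y) * lap v y := by
      rw [lap_eq hv]
      simp only [hTy, gsq, Fin.sum_univ_three]
      ring
    by_cases hy : χ y = 0
    · rw [hsum, hy]
      have : 0 ≤ ε * (gsq χ y * W (v y)) :=
        mul_nonneg hε.le (mul_nonneg (gsq_nonneg _ _) (W_nonneg _))
      nlinarith
    · have hP : (∑ i, pd i χ y * pd i v y) ^ 2 ≤ gsq χ y * gsq v y :=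
        Finset.sum_mul_sq_le_sq_mul_sq _ _ _
      have h := decay_pointwise (c := χ y) (h := ε * lap v y - (1 / ε) * W' (v y)) hε (hsupp y hy)
        (gsq_nonneg v y) hP (gsq_nonneg χ y)
      rw [areaDensity, ← gsq_eq, willDensity, hsum]
      refine h.trans (le_of_eq ?_)
      ring
  have hI5 : Integrable fun y => ε * ∑ i, pd i (T i) y := hTI.const_mul ε
  refine (integral_mono hI1 (hI5.add hI4) hpt).trans (le_of_eq ?_)
  have e1 := integral_add hI5 hI4
  simp only [Pi.add_apply]
  rw [e1, integral_const_mul, hT0, mul_zero, zero_add]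

/-- A continuous cutoff, equal to `1` on `closedBall x r` and vanishing outside `ball x (2 * r)`. -/
def cut (x : E 3) (r : ℝ) : BoundedContinuousFunction (E 3) ℝ :=
  BoundedContinuousFunction.ofNormedAddCommGroup (fun y => max 0 (min 1 (2 - dist y x / r)))
    (by fun_prop) 1 (fun y => by
      rw [Real.norm_eq_abs, abs_of_nonneg (le_max_left _ _)]
      exact max_le zero_le_one (min_le_left _ _))

lemma cut_apply (x : E 3) (r : ℝ) (y : E 3) : cut x r y = max 0 (min 1 (2 - dist y x / r)) := rfl

lemma cut_nonneg (x : E 3) (r : ℝ) (y : E 3) : 0 ≤ cut x r y := le_max_left _ _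

lemma cut_le_one (x : E 3) (r : ℝ) (y : E 3) : cut x r y ≤ 1 := max_le zero_le_one (min_le_left _ _)

lemma cut_eq_one {x y : E 3} {r : ℝ} (hr : 0 < r) (hy : y ∈ closedBall x r) : cut x r y = 1 := by
  have : dist y x / r ≤ 1 := (div_le_one hr).2 hy
  rw [cut_apply, min_eq_left (by linarith), max_eq_right zero_le_one]

lemma cut_eq_zero {x y : E 3} {r : ℝ} (hr : 0 < r) (hy : y ∉ closedBall x (2 * r)) : cut x r y = 0 := by
  rw [mem_closedBall, not_le] at hy
  have : 2 ≤ dist y x / r := (le_div_iff₀ hr).2 hy.le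
  rw [cut_apply, max_eq_left ((min_le_right _ _).trans (by linarith))]

lemma integral_cut_le (x : E 3) {r : ℝ} (hr : 0 < r) (μ : Measure (E 3)) [IsFiniteMeasure μ] :
    ∫ y, cut x r y ∂μ ≤ μ.real (closedBall x (2 * r)) := by
  rw [← integral_indicator_one measurableSet_closedBall]
  refine integral_mono ((cut x r).integrable μ)
    ((integrable_const (1 : ℝ)).indicator measurableSet_closedBall) fun y => ?_
  by_cases hy : y ∈ closedBall x (2 * r)
  · rw [indicator_of_mem hy]; exact cut_le_one x r y
  · rw [indicator_of_notMem hy, cut_eq_zero hr hy]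

lemma le_integral_cut (x : E 3) {r : ℝ} (hr : 0 < r) (μ : Measure (E 3)) [IsFiniteMeasure μ] :
    μ.real (closedBall x r) ≤ ∫ y, cut x r y ∂μ := by
  rw [← integral_indicator_one measurableSet_closedBall]
  refine integral_mono ((integrable_const (1 : ℝ)).indicator measurableSet_closedBall)
    ((cut x r).integrable μ) fun y => ?_
  by_cases hy : y ∈ closedBall x r
  · rw [indicator_of_mem hy, cut_eq_one hr hy]; rfl
  · rw [indicator_of_notMem hy]; exact cut_nonneg x r y

section
variable {Ω : Set (E 3)} {x : E 3} {r : ℝ} {g : E 3 → ℝ}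

lemma integrable_cut_mul (hr : 0 < r) (hsub : closedBall x (2 * r) ⊆ Ω) (hg : ContinuousOn g Ω) :
    Integrable fun y => cut x r y * g y := by
  have h1 : IntegrableOn (fun y => cut x r y * g y) (closedBall x (2 * r)) :=
    ((cut x r).continuous.continuousOn.mul (hg.mono hsub)).integrableOn_compact
      (isCompact_closedBall x _)
  refine (integrableOn_iff_integrable_of_support_subset fun y hy => ?_).1 h1
  by_contra hcon
  exact hy (by simp [cut_eq_zero hr hcon])

lemma setIntegral_le_cut (hr : 0 < r) (hsub : closedBall x (2 * r) ⊆ Ω) (hg : ContinuousOn g Ω)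
    (hg0 : ∀ y, 0 ≤ g y) : ∫ y in ball x r, g y ≤ ∫ y in Ω, cut x r y * g y := by
  have h1 : ∫ y in ball x r, g y = ∫ y in ball x r, cut x r y * g y :=
    setIntegral_congr_fun measurableSet_ball fun y hy => by
      simp [cut_eq_one hr (ball_subset_closedBall hy)]
  rw [h1]
  refine setIntegral_mono_set (integrable_cut_mul hr hsub hg).integrableOn
    (.of_forall fun y => mul_nonneg (cut_nonneg x r y) (hg0 y)) (LE.le.eventuallyLE ?_)
  exact (ball_subset_closedBall.trans (closedBall_subset_closedBall (by linarith))).trans hsub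

lemma cut_le_setIntegral (hr : 0 < r) (hΩ : IsOpen Ω) (hsub : closedBall x (2 * r) ⊆ Ω)
    (hg : ContinuousOn g Ω) (hg0 : ∀ y, 0 ≤ g y) :
    ∫ y in Ω, cut x r y * g y ≤ ∫ y in closedBall x (2 * r), g y := by
  have hi := integrable_cut_mul hr hsub hg
  rw [← integral_indicator hΩ.measurableSet, ← integral_indicator measurableSet_closedBall]
  refine integral_mono (hi.indicator hΩ.measurableSet)
    (((hg.mono hsub).integrableOn_compact (isCompact_closedBall x _)).integrable_indicator
      measurableSet_closedBall) fun y => ?_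
  by_cases hy : y ∈ closedBall x (2 * r)
  · rw [indicator_of_mem hy, indicator_of_mem (hsub hy)]
    have := mul_le_mul_of_nonneg_right (cut_le_one x r y) (hg0 y)
    linarith
  · rw [indicator_of_notMem hy]
    by_cases hyΩ : y ∈ Ω
    · rw [indicator_of_mem hyΩ, cut_eq_zero hr hy, zero_mul]
    · rw [indicator_of_notMem hyΩ]

end

lemma c0_pos : 0 < c0 := by unfold c0; positivity

lemma continuousOn_areaDensity {Ω : Set (E 3)} {u : E 3 → ℝ} (hΩ : IsOpen Ω) (hu : ContDiffOn ℝ 2 u Ω)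
    (ε : ℝ) : ContinuousOn (areaDensity ε u) Ω := by
  have h1 : ContinuousOn (fderiv ℝ u) Ω := hu.continuousOn_fderiv_of_isOpen hΩ (by norm_num)
  unfold areaDensity
  exact (continuousOn_const.mul (h1.norm.pow 2)).add
    (continuousOn_const.mul (continuous_W.comp_continuousOn hu.continuousOn))

lemma continuousOn_willDensity {Ω : Set (E 3)} {u : E 3 → ℝ} (hΩ : IsOpen Ω) (hu : ContDiffOn ℝ 2 u Ω)
    (ε : ℝ) : ContinuousOn (willDensity ε u) Ω := by
  have h1 : ContDiffOn ℝ 1 (fderiv ℝ u) Ω := hu.fderiv_of_isOpen hΩ (by norm_num)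
  have h2 : ContinuousOn (fderiv ℝ (fderiv ℝ u)) Ω := h1.continuousOn_fderiv_of_isOpen hΩ (by norm_num)
  have h3 : ContinuousOn (lap u) Ω := by
    unfold lap
    exact continuousOn_finsetSum _ fun i _ => (h2.clm_apply continuousOn_const).clm_apply continuousOn_const
  unfold willDensity
  exact ((continuousOn_const.mul h3).sub
    (continuousOn_const.mul (continuous_W'.comp_continuousOn hu.continuousOn))).pow 2

lemma eventually_area_le {Ω : Set (E 3)} (hΩ : IsOpen Ω) {ε : ℕ → ℝ} (hε : ∀ k, 0 < ε k)
    {u : ℕ → E 3 → ℝ} (hu : ∀ k, ContDiffOn ℝ 2 (u k) Ω) {x : E 3} {r t : ℝ} (hr : 0 < r)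
    (hsub : closedBall x (2 * r) ⊆ Ω) {μ : Measure (E 3)} [IsFiniteMeasure μ]
    (hμ : weakConvA Ω ε u μ)
    (ht : μ.real (closedBall x (2 * r)) < t) :
    ∀ᶠ k in atTop, ∫ y in ball x r, areaDensity (ε k) (u k) y ≤ c0 * t := by
  have h := (hμ (cut x r)).eventually_lt_const (lt_of_le_of_lt (integral_cut_le x hr μ) ht)
  filter_upwards [h] with k hk
  have h1 := setIntegral_le_cut hr hsub (continuousOn_areaDensity hΩ (hu k) (ε k))
    (areaDensity_nonneg (hε k) (u k))
  rw [one_div, inv_mul_lt_iff₀ c0_pos] at hk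
  linarith

lemma eventually_will_le {Ω : Set (E 3)} (hΩ : IsOpen Ω) {ε : ℕ → ℝ} (hε : ∀ k, 0 < ε k)
    {u : ℕ → E 3 → ℝ} (hu : ∀ k, ContDiffOn ℝ 2 (u k) Ω) {x : E 3} {r t : ℝ} (hr : 0 < r)
    (hsub : closedBall x (2 * r) ⊆ Ω) {α : Measure (E 3)} [IsFiniteMeasure α]
    (hα : weakConvW Ω ε u α)
    (ht : α.real (closedBall x (2 * r)) < t) :
    ∀ᶠ k in atTop, ∫ y in ball x r, willDensity (ε k) (u k) y ≤ c0 * t * ε k := by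
  have h := (hα (cut x r)).eventually_lt_const (lt_of_le_of_lt (integral_cut_le x hr α) ht)
  filter_upwards [h] with k hk
  have h1 := setIntegral_le_cut hr hsub (continuousOn_willDensity hΩ (hu k) (ε k))
    (willDensity_nonneg (ε k) (u k))
  rw [one_div, inv_mul_lt_iff₀ (mul_pos c0_pos (hε k))] at hk
  linarith

lemma setIntegral_ball_mono_of_continuousOn {Ω : Set (E 3)} {g : E 3 → ℝ} (hg : ContinuousOn g Ω)
    (hg0 : ∀ y, 0 ≤ g y) {x y : E 3} {r s : ℝ} (hsub : closedBall x r ⊆ Ω) (h : ball y s ⊆ ball x r) :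
    ∫ z in ball y s, g z ≤ ∫ z in ball x r, g z :=
  setIntegral_mono_set
    (((hg.mono hsub).integrableOn_compact (isCompact_closedBall x _)).mono_set ball_subset_closedBall)
    (.of_forall hg0) (LE.le.eventuallyLE h)

lemma exists_eventually_near_one {κ : ℝ} (hκ : 0 < κ) : ∃ η : ℝ, 0 < η ∧
    ∀ {Ω : Set (E 3)} {ε : ℕ → ℝ} {u : ℕ → E 3 → ℝ} {μ α : Measure (E 3)} [IsFiniteMeasure μ]
      [IsFiniteMeasure α] {x : E 3} {r : ℝ}, IsOpen Ω → (∀ k, 0 < ε k) → Tendsto ε atTop (nhds 0) →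
      (∀ k, ContDiffOn ℝ 2 (u k) Ω) → weakConvA Ω ε u μ → weakConvW Ω ε u α → 0 < r →
      closedBall x (4 * r) ⊆ Ω → μ.real (closedBall x (4 * r)) < η * r ^ 2 →
      α.real (closedBall x (4 * r)) < η → ∀ᶠ k in atTop, ∀ y ∈ ball x r, |u k y ^ 2 - 1| ≤ κ := by
  obtain ⟨η, R₀, hη, hR₀, H⟩ := exists_clearing_out_scaled hκ
  have hc := c0_pos
  refine ⟨η / c0, by positivity, ?_⟩
  intro Ω ε u μ α _ _ x r hΩ hε hε0 hu hμ hα hr hsub h1 h2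
  have e4 : 2 * (2 * r) = 4 * r := by ring
  have hA := eventually_area_le hΩ hε hu (by positivity : 0 < 2 * r) (by rwa [e4]) hμ (by rwa [e4])
  have hB := eventually_will_le hΩ hε hu (by positivity : 0 < 2 * r) (by rwa [e4]) hα (by rwa [e4])
  have hC := hε0.eventually_lt_const (by positivity : 0 < r / R₀)
  have hs2 : closedBall x (2 * r) ⊆ Ω := (closedBall_subset_closedBall (by linarith)).trans hsub
  filter_upwards [hA, hB, hC] with k ha hb hk y hy
  have hyx : dist y x < r := hy
  have hball : ball y r ⊆ ball x (2 * r) := ball_subset_ball' (by linarith)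
  refine H Ω (u k) hΩ (hu k) y (ε k) r (hε k) ?_ ?_ ?_ ?_
  · rw [lt_div_iff₀ hR₀] at hk; linarith
  · exact (closedBall_subset_closedBall' (by linarith)).trans hsub
  · refine ((setIntegral_ball_mono_of_continuousOn (continuousOn_willDensity hΩ (hu k) (ε k))
      (willDensity_nonneg (ε k) (u k)) hs2 hball).trans hb).trans_eq ?_
    field_simp
  · refine ((setIntegral_ball_mono_of_continuousOn (continuousOn_areaDensity hΩ (hu k) (ε k))
      (areaDensity_nonneg (hε k) (u k)) hs2 hball).trans ha).trans_eq ?_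
    field_simp

lemma local_energy_decay {x : E 3} {r : ℝ} (hr : 0 < r) {χ : E 3 → ℝ} (hχ : ContDiff ℝ 1 χ)
    (hχs : HasCompactSupport χ) (hout : ∀ y, y ∉ ball x r → χ y = 0 ∧ gsq χ y = 0)
    (hin : ∀ y ∈ closedBall x (r / 2), χ y = 1) (hχ1 : ∀ y, χ y ^ 2 ≤ 1) {M : ℝ} (hM0 : 0 ≤ M)
    (hM : ∀ y ∈ closedBall x r, ‖gsq χ y‖ ≤ M) {Ω : Set (E 3)} {u : E 3 → ℝ} {ε : ℝ} (hΩ : IsOpen Ω)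
    (hu : ContDiffOn ℝ 2 u Ω) (hε : 0 < ε) (hsub : closedBall x (2 * r) ⊆ Ω)
    (hone : ∀ y ∈ ball x r, |u y ^ 2 - 1| ≤ 1 / 4) :
    ∫ y in closedBall x (r / 2), areaDensity ε u y ≤
      ε / 2 * (∫ y in ball x r, willDensity ε u y) +
        10 * M * ε ^ 2 * ∫ y in ball x r, areaDensity ε u y := by
  obtain ⟨v, hv, hvu⟩ := exists_local_extension hΩ hu hr hsub
  have hr2 : closedBall x r ⊆ Ω := (closedBall_subset_closedBall (by linarith)).trans hsub
  have hiA : IntegrableOn (areaDensity ε u) (closedBall x r) :=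
    ((continuousOn_areaDensity hΩ hu ε).mono hr2).integrableOn_compact (isCompact_closedBall x _)
  have hiB : IntegrableOn (willDensity ε u) (closedBall x r) :=
    ((continuousOn_willDensity hΩ hu ε).mono hr2).integrableOn_compact (isCompact_closedBall x _)
  have hiA' := hiA.mono_set ball_subset_closedBall
  have hiB' := hiB.mono_set ball_subset_closedBall
  have hdec := energy_decay hv hχ hχs (fun y hy => by
    have hyb : y ∈ ball x r := by
      by_contra hcon; exact hy (hout y hcon).1
    rw [(hvu y hyb).eq_of_nhds]; exact hone y hyb) hε
  have hnn : ∀ y, 0 ≤ χ y ^ 2 * areaDensity ε v y := fun y =>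
    mul_nonneg (sq_nonneg _) (areaDensity_nonneg hε v y)
  have hcv : Continuous (areaDensity ε v) := by
    unfold areaDensity
    exact (continuous_const.mul ((hv.continuous_fderiv (by norm_num)).norm.pow 2)).add
      (continuous_const.mul (continuous_W.comp hv.continuous))
  have hχ2s : HasCompactSupport fun y => χ y ^ 2 :=
    hχs.comp_left (g := fun t => t ^ 2) (by simp)
  have hI : Integrable fun y => χ y ^ 2 * areaDensity ε v y :=
    ((hχ.continuous.pow 2).mul hcv).integrable_of_hasCompactSupport hχ2s.mul_right
  have hleft : ∫ y in closedBall x (r / 2), areaDensity ε u y ≤ ∫ y, χ y ^ 2 * areaDensity ε v y := by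
    refine le_trans (le_of_eq ?_) (setIntegral_le_integral (s := closedBall x (r / 2)) hI (.of_forall hnn))
    refine setIntegral_congr_fun measurableSet_closedBall fun y hy => ?_
    have h1 : χ y = 1 := hin y hy
    have h2 : y ∈ ball x r := closedBall_subset_ball (by linarith) hy
    simp only [h1, one_pow, one_mul]
    exact (areaDensity_congr (hvu y h2)).symm
  have hsum : IntegrableOn (fun y => ε / 2 * willDensity ε u y + 10 * M * ε ^ 2 * areaDensity ε u y)
      (ball x r) := (hiB'.const_mul _).add (hiA'.const_mul _)
  have hright : ∫ y, (ε / 2 * (χ y ^ 2 * willDensity ε v y) + 10 * ε * (gsq χ y * W (v y))) ≤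
      ∫ y in ball x r, (ε / 2 * willDensity ε u y + 10 * M * ε ^ 2 * areaDensity ε u y) := by
    rw [← integral_indicator measurableSet_ball]
    refine integral_mono_of_nonneg (.of_forall fun y => ?_)
      (hsum.integrable_indicator measurableSet_ball) (.of_forall fun y => ?_)
    · have := gsq_nonneg χ y
      have := W_nonneg (v y)
      have := willDensity_nonneg ε v y
      simp only [Pi.zero_apply]
      positivity
    · by_cases hy : y ∈ ball x r
      · rw [indicator_of_mem hy]
        simp only
        rw [willDensity_congr (hvu y hy), (hvu y hy).eq_of_nhds]
        have hw := willDensity_nonneg ε u y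
        have hWy := W_nonneg (u y)
        have hg : gsq χ y ≤ M := (le_abs_self _).trans (hM y (ball_subset_closedBall hy))
        have hWA : W (u y) ≤ ε * areaDensity ε u y := by
          have : ε * areaDensity ε u y = ε ^ 2 / 2 * ‖fderiv ℝ u y‖ ^ 2 + W (u y) := by
            unfold areaDensity; field_simp
          rw [this]; nlinarith [sq_nonneg (ε * ‖fderiv ℝ u y‖)]
        have a1 : ε / 2 * (χ y ^ 2 * willDensity ε u y) ≤ ε / 2 * willDensity ε u y :=
          mul_le_mul_of_nonneg_left (mul_le_of_le_one_left hw (hχ1 y)) (by positivity)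
        have a2 : 10 * ε * (gsq χ y * W (u y)) ≤ 10 * ε * (M * (ε * areaDensity ε u y)) :=
          mul_le_mul_of_nonneg_left (mul_le_mul hg hWA hWy hM0) (by positivity)
        linarith
      · rw [indicator_of_notMem hy]
        simp [(hout y hy).1, (hout y hy).2]
  refine (hleft.trans (hdec.trans hright)).trans_eq ?_
  rw [integral_add (hiB'.const_mul _) (hiA'.const_mul _), integral_const_mul, integral_const_mul]

lemma exists_local_energy_decay (x : E 3) {r : ℝ} (hr : 0 < r) : ∃ M : ℝ, 0 ≤ M ∧
    ∀ {Ω : Set (E 3)} {u : E 3 → ℝ} {ε : ℝ}, IsOpen Ω → ContDiffOn ℝ 2 u Ω → 0 < ε →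
      closedBall x (2 * r) ⊆ Ω → (∀ y ∈ ball x r, |u y ^ 2 - 1| ≤ 1 / 4) →
      ∫ y in closedBall x (r / 2), areaDensity ε u y ≤
        ε / 2 * (∫ y in ball x r, willDensity ε u y) +
          10 * M * ε ^ 2 * ∫ y in ball x r, areaDensity ε u y := by
  obtain ⟨χ, hin, hrout⟩ : ∃ χ : ContDiffBump x, χ.rIn = r / 2 ∧ χ.rOut = 3 * r / 4 :=
    ⟨⟨r / 2, 3 * r / 4, by positivity, by linarith⟩, rfl, rfl⟩
  have hχ : ContDiff ℝ 1 χ := χ.contDiff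
  have hχs : HasCompactSupport χ := χ.hasCompactSupport
  have hout : ∀ y, y ∉ ball x r → χ y = 0 ∧ gsq χ y = 0 := by
    intro y hy
    have hn : y ∉ tsupport χ := by
      rw [χ.tsupport_eq]
      exact fun h => hy (closedBall_subset_ball (by rw [hrout]; linarith) h)
    refine ⟨image_eq_zero_of_notMem_tsupport hn, ?_⟩
    rw [gsq_eq, (notMem_tsupport_iff_eventuallyEq.1 hn).fderiv_eq]
    simp
  obtain ⟨M, hM⟩ := (isCompact_closedBall x r).exists_bound_of_continuousOn
    (continuous_gsq hχ).continuousOn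
  have hM0 : 0 ≤ M := (norm_nonneg _).trans (hM x (mem_closedBall_self hr.le))
  refine ⟨M, hM0, ?_⟩
  exact fun hΩ hu hε hsub hone => local_energy_decay hr hχ hχs hout
    (fun y hy => χ.one_of_mem_closedBall (by rwa [hin])) (fun y => pow_le_one₀ χ.nonneg χ.le_one)
    hM0 hM hΩ hu hε hsub hone

lemma measure_closedBall_eq_zero_of_near_one {Ω : Set (E 3)} {ε : ℕ → ℝ} {u : ℕ → E 3 → ℝ}
    {μ α : Measure (E 3)} [IsFiniteMeasure μ] [IsFiniteMeasure α] {x : E 3} {r : ℝ} (hΩ : IsOpen Ω)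
    (hε : ∀ k, 0 < ε k) (hε0 : Tendsto ε atTop (nhds 0)) (hu : ∀ k, ContDiffOn ℝ 2 (u k) Ω)
    (hμ : weakConvA Ω ε u μ) (hα : weakConvW Ω ε u α) (hr : 0 < r) (hsub : closedBall x (2 * r) ⊆ Ω)
    (hone : ∀ᶠ k in atTop, ∀ y ∈ ball x r, |u k y ^ 2 - 1| ≤ 1 / 4) :
    μ (closedBall x (r / 4)) = 0 := by
  have hc := c0_pos
  obtain ⟨M, hM0, hM⟩ := exists_local_energy_decay x hr
  set s := μ.real (closedBall x (2 * r)) + 1 with hs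
  set t := α.real (closedBall x (2 * r)) + 1 with ht
  have hA := eventually_area_le (t := s) hΩ hε hu hr hsub hμ (by rw [hs]; linarith)
  have hB := eventually_will_le (t := t) hΩ hε hu hr hsub hα (by rw [ht]; linarith)
  have e2 : 2 * (r / 4) = r / 2 := by ring
  have hr4 : closedBall x (2 * (r / 4)) ⊆ Ω := (closedBall_subset_closedBall (by linarith)).trans hsub
  have key : ∀ᶠ k in atTop, (1 / c0) * ∫ y in Ω, cut x (r / 4) y * areaDensity (ε k) (u k) y ≤
      (t / 2 + 10 * M * s) * ε k ^ 2 := by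
    filter_upwards [hA, hB, hone] with k ha hb h1
    have hεk := hε k
    have h2 := cut_le_setIntegral (by positivity : 0 < r / 4) hΩ hr4
      (continuousOn_areaDensity hΩ (hu k) (ε k)) (areaDensity_nonneg hεk (u k))
    rw [e2] at h2
    have h3 := hM hΩ (hu k) hεk hsub h1
    have h4 := mul_le_mul_of_nonneg_left hb (by positivity : 0 ≤ ε k / 2)
    have h5 := mul_le_mul_of_nonneg_left ha (by positivity : 0 ≤ 10 * M * ε k ^ 2)
    rw [one_div, inv_mul_le_iff₀ hc]
    linarith
  have hlim : Tendsto (fun k => (t / 2 + 10 * M * s) * ε k ^ 2) atTop (nhds 0) := by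
    simpa using (hε0.pow 2).const_mul (t / 2 + 10 * M * s)
  have h6 := le_of_tendsto_of_tendsto (hμ (cut x (r / 4))) hlim key
  have h7 := (le_integral_cut x (by positivity : 0 < r / 4) μ).trans h6
  exact (measureReal_eq_zero_iff).1 (le_antisymm h7 measureReal_nonneg)

lemma ae_exists_measureReal_closedBall_le (ρ : Measure (E 3)) [IsFiniteMeasure ρ] :
    ∀ᵐ x : E 3, ∃ C : ℝ, ∀ᶠ r in nhdsWithin (0 : ℝ) (Ioi 0), ρ.real (closedBall x r) ≤ C * r ^ 3 := by
  filter_upwards [Besicovitch.ae_tendsto_rnDeriv ρ (volume : Measure (E 3)),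
    Measure.rnDeriv_lt_top ρ (volume : Measure (E 3))] with x hx hfin
  obtain ⟨C, hC1, hC2⟩ := exists_between hfin
  refine ⟨C.toReal * (volume : Measure (E 3)).real (ball 0 1), ?_⟩
  filter_upwards [hx.eventually_lt_const hC1, self_mem_nhdsWithin] with r hr hr0
  have hr0' : (0 : ℝ) < r := hr0
  have h1 : ρ (closedBall x r) ≤ C * volume (closedBall x r) :=
    ((ENNReal.div_lt_iff (Or.inl (measure_closedBall_pos volume x hr0').ne')
      (Or.inl measure_closedBall_lt_top.ne)).1 hr).le
  rw [Measure.addHaar_closedBall volume x hr0'.le, finrank_euclideanSpace_fin] at h1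
  have h2 := ENNReal.toReal_mono
    (ENNReal.mul_ne_top hC2.ne (ENNReal.mul_ne_top ENNReal.ofReal_ne_top measure_ball_lt_top.ne)) h1
  rw [ENNReal.toReal_mul, ENNReal.toReal_mul, ENNReal.toReal_ofReal (by positivity)] at h2
  refine h2.trans_eq ?_
  rw [Measure.real]; ring

lemma isOpen_compl_sptM (μ : Measure (E 3)) : IsOpen (sptM μ)ᶜ := by
  refine Metric.isOpen_iff.2 fun x hx => ?_
  simp only [sptM, mem_compl_iff, mem_ofPred_eq, not_forall, not_lt, nonpos_iff_eq_zero] at hx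
  obtain ⟨r, hr, h0⟩ := hx
  refine ⟨r, hr, fun y hy hcon => ?_⟩
  have h1 : 0 < r - dist y x := sub_pos.2 hy
  have h2 := hcon _ h1
  exact h2.ne' (measure_mono_null (ball_subset_ball' (by linarith)) h0)

lemma ae_notMem_sptM {Ω : Set (E 3)} {ε : ℕ → ℝ} {u : ℕ → E 3 → ℝ}
    {μ α : Measure (E 3)} [IsFiniteMeasure μ] [IsFiniteMeasure α] (hΩ : IsOpen Ω)
    (hε : ∀ k, 0 < ε k) (hε0 : Tendsto ε atTop (nhds 0)) (hu : ∀ k, ContDiffOn ℝ 2 (u k) Ω)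
    (hμ : weakConvA Ω ε u μ) (hα : weakConvW Ω ε u α) :
    ∀ᵐ x : E 3, x ∈ Ω → x ∉ sptM μ := by
  obtain ⟨η, hη, H⟩ := exists_eventually_near_one (by norm_num : (0 : ℝ) < 1 / 4)
  filter_upwards [ae_exists_measureReal_closedBall_le μ, ae_exists_measureReal_closedBall_le α]
    with x ⟨C, hC⟩ ⟨D, hD⟩ hxΩ
  have hlim1 : Tendsto (fun s : ℝ => C * s) (nhdsWithin 0 (Ioi 0)) (nhds 0) := by
    have : Tendsto (fun s : ℝ => C * s) (nhds 0) (nhds (C * 0)) := (continuous_const_mul C).tendsto 0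
    rw [mul_zero] at this
    exact this.mono_left nhdsWithin_le_nhds
  have hlim2 : Tendsto (fun s : ℝ => D * s ^ 3) (nhdsWithin 0 (Ioi 0)) (nhds 0) := by
    have : Tendsto (fun s : ℝ => D * s ^ 3) (nhds 0) (nhds (D * 0 ^ 3)) :=
      (by fun_prop : Continuous fun s : ℝ => D * s ^ 3).tendsto 0
    rw [zero_pow (by norm_num), mul_zero] at this
    exact this.mono_left nhdsWithin_le_nhds
  obtain ⟨δ, hδ, hδΩ⟩ := Metric.isOpen_iff.1 hΩ x hxΩ
  have hsmall : ∀ᶠ s in nhdsWithin (0 : ℝ) (Ioi 0), s < δ :=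
    mem_of_superset (Ioo_mem_nhdsGT hδ) fun s hs => hs.2
  obtain ⟨s, h1, h2, h3, h4, h5, hs⟩ := (hC.and (hD.and ((hlim1.eventually_lt_const
    (by positivity : 0 < η / 16)).and ((hlim2.eventually_lt_const hη).and
    (hsmall.and self_mem_nhdsWithin))))).exists
  have hs0 : (0 : ℝ) < s := hs
  have e4 : 4 * (s / 4) = s := by ring
  have hsΩ : closedBall x s ⊆ Ω := (closedBall_subset_ball h5).trans hδΩ
  have hone := H (x := x) (r := s / 4) hΩ hε hε0 hu hμ hα (by positivity) (by rwa [e4])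
    (by
      rw [e4]
      have := mul_lt_mul_of_pos_right h3 (by positivity : 0 < s ^ 2)
      linarith) (by rw [e4]; linarith)
  have h0 := measure_closedBall_eq_zero_of_near_one hΩ hε hε0 hu hμ hα (by positivity : 0 < s / 4)
    ((closedBall_subset_closedBall (by linarith)).trans hsΩ) hone
  intro hcon
  exact (hcon (s / 4 / 4) (by positivity)).ne' (measure_mono_null ball_subset_closedBall h0)

lemma integrableOn_abs_sub {Ω : Set (E 3)} {μ : Measure (E 3)} {w ulim : E 3 → ℝ} (hΩ : IsOpen Ω)
    (hΩb : Bornology.IsBounded Ω) (hw : ContinuousOn w (closure Ω))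
    (hnull : ∀ᵐ x : E 3, x ∈ Ω → x ∉ sptM μ)
    (hpm : ∀ x ∈ Ω \ sptM μ, ulim x = 1 ∨ ulim x = -1)
    (hlc : ∀ x ∈ Ω \ sptM μ, ∃ ρ > 0, ∀ y ∈ ball x ρ, y ∈ Ω \ sptM μ → ulim y = ulim x) :
    IntegrableOn (fun x => |w x - ulim x|) Ω := by
  have hK : IsCompact (closure Ω) := hΩb.isCompact_closure
  have hvol : volume Ω < ⊤ := hΩb.measure_lt_top
  have hopen : IsOpen (Ω \ sptM μ) := hΩ.inter (isOpen_compl_sptM μ)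
  have hae : (Ω \ sptM μ : Set (E 3)) =ᵐ[volume] Ω := by
    filter_upwards [hnull] with x hx
    exact propext ⟨fun h => h.1, fun h => ⟨h, hx h⟩⟩
  have hcont : ContinuousOn ulim (Ω \ sptM μ) := by
    intro x hx
    obtain ⟨ρ, hρ, h⟩ := hlc x hx
    refine (continuousWithinAt_const (b := ulim x)).congr_of_eventuallyEq ?_ rfl
    filter_upwards [inter_mem_nhdsWithin _ (ball_mem_nhds x hρ)] with y hy
    exact h y hy.2 hy.1
  have hl : IntegrableOn ulim Ω := by
    rw [← integrableOn_congr_set_ae hae]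
    refine IntegrableOn.of_bound ((measure_mono sdiff_subset).trans_lt hvol)
      (hcont.aestronglyMeasurable hopen.measurableSet) 1 ?_
    filter_upwards [ae_restrict_mem hopen.measurableSet] with x hx
    rcases hpm x hx with h | h <;> simp [h]
  have hwi : IntegrableOn w Ω := (hw.integrableOn_compact hK).mono_set subset_closure
  exact (hwi.sub hl).abs

/-- On a preconnected set a continuous function with values near `±1` keeps its sign. -/
lemma near_sign_of_isPreconnected {s : Set (E 3)} (hs : IsPreconnected s) {w : E 3 → ℝ}
    (hw : ContinuousOn w s) {κ : ℝ} (hκ : κ < 1) (h : ∀ y ∈ s, |w y ^ 2 - 1| ≤ κ) {c : ℝ}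
    (hc : c = 1 ∨ c = -1) :
    (∀ y ∈ s, |w y - c| ≤ κ) ∨ (∀ y ∈ s, 1 ≤ |w y - c|) := by
  have hne : ∀ y ∈ s, c * w y ≠ 0 := by
    intro y hy h0
    have hw0 : w y = 0 := by
      rcases hc with rfl | rfl <;> linarith
    have := h y hy
    rw [hw0] at this
    norm_num at this
    linarith
  have hcc : c * c = 1 := by rcases hc with rfl | rfl <;> norm_num
  have habs : ∀ t : ℝ, |t - c| = |c * t - 1| := by
    intro t
    rcases hc with rfl | rfl
    · rw [one_mul]
    · rw [← abs_neg]; congr 1; ring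
  have hcont : ContinuousOn (fun y => c * w y) s := continuousOn_const.mul hw
  have hsign : (∀ y ∈ s, 0 < c * w y) ∨ (∀ y ∈ s, c * w y < 0) := by
    by_contra! hcon
    obtain ⟨⟨y, hy, hy0⟩, z, hz, hz0⟩ := hcon
    obtain ⟨p, hp, hp0⟩ := hs.intermediate_value hy hz hcont ⟨hy0, hz0⟩
    exact hne p hp hp0
  refine hsign.imp (fun hpos y hy => ?_) fun hneg y hy => ?_
  · have h1 := h y hy
    have h2 := hpos y hy
    have e : w y ^ 2 - 1 = (c * w y - 1) * (c * w y + 1) := by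
      have : (c * w y - 1) * (c * w y + 1) = c * c * w y ^ 2 - 1 := by ring
      rw [this, hcc, one_mul]
    rw [e, abs_mul, abs_of_pos (by linarith : 0 < c * w y + 1)] at h1
    rw [habs]
    nlinarith [abs_nonneg (c * w y - 1)]
  · rw [habs, abs_of_neg (by linarith [hneg y hy])]
    linarith [hneg y hy]

/-- Small balls around a non-atom have small measure. -/
lemma eventually_measureReal_closedBall_lt {α : Measure (E 3)} [IsFiniteMeasure α] {x : E 3}
    (hx : α {x} = 0) {η : ℝ} (hη : 0 < η) :
    ∀ᶠ s in nhds (0 : ℝ), α.real (closedBall x s) < η := by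
  have h := tendsto_measure_cthickening_of_isClosed (μ := α) (s := {x})
    ⟨1, one_pos, measure_ne_top _ _⟩ isClosed_singleton
  rw [hx] at h
  filter_upwards [h.eventually_lt_const (ENNReal.ofReal_pos.2 hη)] with s hs
  have hsub : closedBall x s ⊆ cthickening s {x} := closedBall_subset_cthickening_singleton x s
  rw [Measure.real, ← ENNReal.toReal_ofReal hη.le]
  exact (ENNReal.toReal_lt_toReal (measure_ne_top _ _) ENNReal.ofReal_ne_top).2
    ((measure_mono hsub).trans_lt hs)

lemma exists_ball_eventually_near {Ω : Set (E 3)} {ε : ℕ → ℝ} {u : ℕ → E 3 → ℝ} {ulim : E 3 → ℝ}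
    {μ α : Measure (E 3)} [IsFiniteMeasure μ] [IsFiniteMeasure α] (hΩ : IsOpen Ω)
    (hΩb : Bornology.IsBounded Ω) (hε : ∀ k, 0 < ε k) (hε0 : Tendsto ε atTop (nhds 0))
    (hu : ∀ k, ContDiffOn ℝ 2 (u k) (closure Ω)) (hμ : weakConvA Ω ε u μ) (hα : weakConvW Ω ε u α)
    (hL1 : Tendsto (fun k => ∫ x in Ω, |u k x - ulim x|) atTop (nhds 0))
    (hpm : ∀ x ∈ Ω \ sptM μ, ulim x = 1 ∨ ulim x = -1)
    (hlc : ∀ x ∈ Ω \ sptM μ, ∃ ρ > 0, ∀ y ∈ ball x ρ, y ∈ Ω \ sptM μ → ulim y = ulim x)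
    {x : E 3} (hx : x ∈ Ω \ sptM μ) (hatom : α {x} = 0) {κ : ℝ} (hκ : 0 < κ) (hκ1 : κ < 1) :
    ∃ r > 0, ∀ᶠ k in atTop, ∀ y ∈ ball x r, |u k y - ulim y| ≤ κ := by
  have huΩ : ∀ k, ContDiffOn ℝ 2 (u k) Ω := fun k => (hu k).mono subset_closure
  obtain ⟨η, hη, H⟩ := exists_eventually_near_one hκ
  have hopen : IsOpen (Ω \ sptM μ) := hΩ.inter (isOpen_compl_sptM μ)
  obtain ⟨δ, hδ, hδs⟩ := Metric.isOpen_iff.1 hopen x hx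
  obtain ⟨ρ, hρ, hρs⟩ := hlc x hx
  have hx2 := hx.2
  simp only [sptM, mem_ofPred_eq, not_forall, not_lt, nonpos_iff_eq_zero] at hx2
  obtain ⟨r₀, hr₀, hμ0⟩ := hx2
  have hlt : ∀ {a : ℝ}, 0 < a → ∀ᶠ s in nhdsWithin (0 : ℝ) (Ioi 0), s < a := fun ha =>
    mem_of_superset (Ioo_mem_nhdsGT ha) fun s hs => hs.2
  obtain ⟨s, h1, h2, h3, h4, hs⟩ := (((eventually_measureReal_closedBall_lt hatom hη).filter_mono
    nhdsWithin_le_nhds).and ((hlt hδ).and ((hlt hρ).and ((hlt hr₀).and self_mem_nhdsWithin)))).exists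
  have hs0 : (0 : ℝ) < s := hs
  have e4 : 4 * (s / 4) = s := by ring
  have hsG : closedBall x s ⊆ Ω \ sptM μ := (closedBall_subset_ball h2).trans hδs
  have hbs : ball x (s / 4) ⊆ closedBall x s :=
    ball_subset_closedBall.trans (closedBall_subset_closedBall (by linarith))
  have hconst : ∀ y ∈ ball x (s / 4), ulim y = ulim x := fun y hy =>
    hρs y (ball_subset_ball (by linarith) hy) (hsG (hbs hy))
  have hone := H (x := x) (r := s / 4) hΩ hε hε0 huΩ hμ hα (by positivity)
    (by rw [e4]; exact hsG.trans fun y hy => hy.1)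
    (by
      rw [e4, Measure.real, measure_mono_null (closedBall_subset_ball h4) hμ0]
      simp only [ENNReal.toReal_zero]
      positivity) (by rwa [e4])
  have hvol : 0 < (volume : Measure (E 3)).real (ball x (s / 4)) :=
    ENNReal.toReal_pos (measure_ball_pos volume x (by positivity)).ne' measure_ball_lt_top.ne
  have hnull := ae_notMem_sptM hΩ hε hε0 huΩ hμ hα
  refine ⟨s / 4, by positivity, ?_⟩
  filter_upwards [hone, hL1.eventually_lt_const hvol] with k hk hL
  have hbΩ : ball x (s / 4) ⊆ Ω := fun y hy => (hsG (hbs hy)).1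
  rcases near_sign_of_isPreconnected (convex_ball x (s / 4)).isPreconnected
    ((huΩ k).continuousOn.mono hbΩ) hκ1 hk (hpm x hx) with h | h
  · intro y hy
    rw [hconst y hy]
    exact h y hy
  · exfalso
    have hI := integrableOn_abs_sub hΩ hΩb (hu k).continuousOn hnull hpm hlc
    have h5 : ∫ y in ball x (s / 4), |u k y - ulim y| ≤ ∫ y in Ω, |u k y - ulim y| :=
      setIntegral_mono_set hI (.of_forall fun y => abs_nonneg _) (LE.le.eventuallyLE hbΩ)
    have h6 := setIntegral_ge_of_const_le_real (c := (1 : ℝ)) measurableSet_ball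
      measure_ball_lt_top.ne (fun y hy => by rw [hconst y hy]; exact h y hy)
      (hI.mono_set hbΩ).integrable
    rw [one_mul] at h6
    linarith

lemma tendstoUniformlyOn_of_no_atoms {Ω Ω' : Set (E 3)} {ε : ℕ → ℝ} {u : ℕ → E 3 → ℝ}
    {ulim : E 3 → ℝ} {μ α : Measure (E 3)} [IsFiniteMeasure μ] [IsFiniteMeasure α] (hΩ : IsOpen Ω)
    (hΩb : Bornology.IsBounded Ω) (hε : ∀ k, 0 < ε k) (hε0 : Tendsto ε atTop (nhds 0))
    (hu : ∀ k, ContDiffOn ℝ 2 (u k) (closure Ω)) (hμ : weakConvA Ω ε u μ) (hα : weakConvW Ω ε u α)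
    (hL1 : Tendsto (fun k => ∫ x in Ω, |u k x - ulim x|) atTop (nhds 0))
    (hpm : ∀ x ∈ Ω \ sptM μ, ulim x = 1 ∨ ulim x = -1)
    (hlc : ∀ x ∈ Ω \ sptM μ, ∃ ρ > 0, ∀ y ∈ ball x ρ, y ∈ Ω \ sptM μ → ulim y = ulim x)
    (hsub : closure Ω' ⊆ Ω \ sptM μ) (hcpt : IsCompact (closure Ω'))
    (hatom : ∀ x ∈ closure Ω', α {x} = 0) :
    TendstoUniformlyOn (fun k => u k) ulim atTop Ω' := by
  refine Metric.tendstoUniformlyOn_iff.2 fun δ hδ => ?_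
  have hκ : 0 < min (δ / 2) (1 / 2) := by positivity
  have key : ∀ᶠ k in atTop, ∀ y ∈ closure Ω', |u k y - ulim y| ≤ min (δ / 2) (1 / 2) := by
    refine hcpt.induction_on (p := fun s => ∀ᶠ k in atTop, ∀ y ∈ s, |u k y - ulim y| ≤ min (δ / 2) (1 / 2))
      (by simp) (fun s t hst ht => ht.mono fun k hk y hy => hk y (hst hy))
      (fun s t hs ht => ?_) fun x hx => ?_
    · filter_upwards [hs, ht] with k h1 h2 y hy
      exact hy.elim (h1 y) (h2 y)
    · obtain ⟨r, hr, h⟩ := exists_ball_eventually_near hΩ hΩb hε hε0 hu hμ hα hL1 hpm hlc (hsub hx)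
        (hatom x hx) hκ ((min_le_right _ _).trans_lt (by norm_num))
      exact ⟨ball x r, mem_nhdsWithin_of_mem_nhds (ball_mem_nhds x hr), h⟩
  filter_upwards [key] with k hk y hy
  rw [dist_comm, Real.dist_eq]
  have := (hk y (subset_closure hy)).trans (min_le_left _ _)
  linarith

theorem stmt14 (Ω : Set (E 3)) (hΩo : IsOpen Ω) (hΩb : Bornology.IsBounded Ω)
    (ε : ℕ → ℝ) (hεpos : ∀ k, 0 < ε k) (hε0 : Tendsto ε atTop (nhds 0))
    (u : ℕ → E 3 → ℝ) (hu : ∀ k, ContDiffOn ℝ 2 (u k) (closure Ω))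
    (A : ℝ) (hA : ∀ k, Se (ε k) Ω (u k) + We (ε k) Ω (u k) ≤ A)
    (θ : ℝ) (hθ : 1 ≤ θ) (hbd : ∀ k, ∀ x ∈ frontier Ω, |u k x| ≤ θ)
    (μ α : Measure (E 3)) [IsFiniteMeasure μ] [IsFiniteMeasure α]
    (hμ : weakConvA Ω ε u μ) (hα : weakConvW Ω ε u α)
    (ulim : E 3 → ℝ)
    (hL1 : Tendsto (fun k => ∫ x in Ω, |u k x - ulim x|) atTop (nhds 0))
    (hpm : ∀ x ∈ Ω \ sptM μ, ulim x = 1 ∨ ulim x = -1)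
    (hlc : ∀ x ∈ Ω \ sptM μ, ∃ ρ > 0, ∀ y ∈ ball x ρ, y ∈ Ω \ sptM μ → ulim y = ulim x)
    (Ω' : Set (E 3)) (hΩ'o : IsOpen Ω') (hsub : closure Ω' ⊆ Ω \ sptM μ)
    (hcpt : IsCompact (closure Ω'))
    (hnoatom : ∀ x ∈ closure Ω', α {x} = 0) :
    TendstoUniformlyOn (fun k => u k) ulim atTop Ω' :=
  tendstoUniformlyOn_of_no_atoms hΩo hΩb hεpos hε0 hu hμ hα hL1 hpm hlc hsub hcpt hnoatom

end
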